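/- For every odd p ≥ 3, every quasisymmetric self-homeomorphism f of S_p satisfies f(O) = O and f(M) = M (images taken as sets); i.e., f cannot interchange the outer and middle squares. -/

import Mathlib

open Set Metric

noncomputable section

/-- Level-`n` approximation `Q_n` of the standard `1/p`-Sierpiński carpet in `ℂ ≅ ℝ²`:
`Q_0` is the closed unit square, and `Q_{n+1}` is the union of the images of `Q_n` under
the `p² - 1` contractions `z ↦ (z + i + j·√-1)/p` with `(i,j)` ranging over all non-middle
positions; this is the usual subdivide-and-remove-middle-squares construction. -/
def carpetApprox (p : ℕ) : ℕ → Set ℂ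
  | 0 => {z : ℂ | z.re ∈ Set.Icc (0:ℝ) 1 ∧ z.im ∈ Set.Icc (0:ℝ) 1}
  | n + 1 =>
      ⋃ (i : ℕ) (j : ℕ) (_ : i < p) (_ : j < p)
        (_ : ¬(i = (p - 1) / 2 ∧ j = (p - 1) / 2)),
        (fun z : ℂ => (z + (i : ℂ) + (j : ℂ) * Complex.I) / (p : ℂ)) '' carpetApprox p n

/-- The standard `1/p`-Sierpiński carpet `S_p ⊆ ℝ² ≅ ℂ`. -/
def sierpinskiCarpet (p : ℕ) : Set ℂ := ⋂ n, carpetApprox p n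

/-- `η : [0,∞) → [0,∞)` is a (self-)homeomorphism of `[0,∞)`: it is continuous, strictly
increasing on `[0,∞)`, fixes `0` and maps `[0,∞)` onto `[0,∞)`. -/
def IsQSControl (η : ℝ → ℝ) : Prop :=
  ContinuousOn η (Set.Ici 0) ∧ StrictMonoOn η (Set.Ici 0) ∧ η 0 = 0 ∧
    Set.SurjOn η (Set.Ici 0) (Set.Ici 0)

/-- A map `f` between metric spaces is quasisymmetric: for some homeomorphism
`η : [0,∞) → [0,∞)` one has `d(f u, f v) ≤ η(d(u,v)/d(u,w)) · d(f u, f w)` for all `u,v,w`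
with `u ≠ w`. -/
def IsQSMap {X Y : Type*} [MetricSpace X] [MetricSpace Y] (f : X → Y) : Prop :=
  ∃ η : ℝ → ℝ, IsQSControl η ∧
    ∀ u v w : X, u ≠ w → dist (f u) (f v) ≤ η (dist u v / dist u w) * dist (f u) (f w)

/-- The boundary of the axis-parallel closed square with lower-left corner `c` and
side length `l`. -/
def squareBoundary (c : ℂ) (l : ℝ) : Set ℂ :=
  {z : ℂ | max |z.re - (c.re + l / 2)| |z.im - (c.im + l / 2)| = l / 2}

/-- The outer square `O = ∂([0,1]×[0,1])`. -/
def outerSquare : Set ℂ := squareBoundary 0 1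

/-- The middle square `M = ∂([(p-1)/(2p),(p+1)/(2p)]²)`. -/
def middleSquare (p : ℕ) : Set ℂ :=
  squareBoundary ((((p : ℝ) - 1) / (2 * p) : ℝ) * (1 + Complex.I)) (1 / p)

end

/-- The standing hypothesis on the subdivision parameter: an odd integer at least three. -/
class OddBase (p : ℕ) : Prop where
  three_le : 3 ≤ p
  odd : Odd p

set_option linter.unusedSectionVars false

namespace Carpet

noncomputable section

/-- Index of the middle row and column. -/
def mid (p : ℕ) : ℕ := (p - 1) / 2

/-- Positions of the subsquares that are kept. -/
abbrev Digit (p : ℕ) : Type :=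
  {d : ℕ × ℕ // d.1 < p ∧ d.2 < p ∧ ¬(d.1 = mid p ∧ d.2 = mid p)}

/-- Finite words of digits; they address the subsquares of all levels. -/
abbrev Word (p : ℕ) : Type := List (Digit p)

/-- The contraction of the unit square onto the subsquare with position `d`. -/
def cellMap {p : ℕ} (d : Digit p) (z : ℂ) : ℂ :=
  (z + (d.1.1 : ℂ) + (d.1.2 : ℂ) * Complex.I) / (p : ℂ)

/-- The contraction of the unit square onto the subsquare with address `w`. -/
def wordMap {p : ℕ} : Word p → ℂ → ℂ
  | [], z => z
  | d :: w, z => cellMap d (wordMap w z)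

/-- Integer abscissa of the lower left corner of the subsquare `w`, at scale `p ^ w.length`. -/
def cornerX {p : ℕ} : Word p → ℕ
  | [] => 0
  | d :: w => d.1.1 * p ^ w.length + cornerX w

/-- Integer ordinate of the lower left corner of the subsquare `w`, at scale `p ^ w.length`. -/
def cornerY {p : ℕ} : Word p → ℕ
  | [] => 0
  | d :: w => d.1.2 * p ^ w.length + cornerY w

/-- The closed unit square. -/
def unitSq : Set ℂ := {z | z.re ∈ Icc (0 : ℝ) 1 ∧ z.im ∈ Icc (0 : ℝ) 1}

/-- The open unit square. -/
def openSq : Set ℂ := {z | z.re ∈ Ioo (0 : ℝ) 1 ∧ z.im ∈ Ioo (0 : ℝ) 1}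

/-- The closed middle subsquare. -/
def solidMid (p : ℕ) : Set ℂ :=
  {z | p * z.re ∈ Icc (mid p : ℝ) (mid p + 1) ∧ p * z.im ∈ Icc (mid p : ℝ) (mid p + 1)}

/-- The open middle subsquare. -/
def openMid (p : ℕ) : Set ℂ :=
  {z | p * z.re ∈ Ioo (mid p : ℝ) (mid p + 1) ∧ p * z.im ∈ Ioo (mid p : ℝ) (mid p + 1)}

/-- The closed removed square with address `w`. -/
def solid {p : ℕ} (w : Word p) : Set ℂ := wordMap w '' solidMid p

/-- The open removed square with address `w`. -/
def hole {p : ℕ} (w : Word p) : Set ℂ := wordMap w '' openMid p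

/-- The peripheral squares: the outer one and the boundaries of the removed squares. -/
def circ {p : ℕ} : Option (Word p) → Set ℂ
  | none => outerSquare
  | some w => wordMap w '' middleSquare p

variable {p : ℕ}

lemma openSq_subset : openSq ⊆ unitSq := fun _ hz =>
  ⟨Ioo_subset_Icc_self hz.1, Ioo_subset_Icc_self hz.2⟩

lemma mem_outer_iff {z : ℂ} :
    z ∈ outerSquare ↔ z ∈ unitSq ∧ z ∉ openSq := by
  simp only [outerSquare, squareBoundary, unitSq, openSq, mem_ofPred_eq, mem_Icc, mem_Ioo,
    Complex.zero_re, Complex.zero_im]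
  constructor
  · intro h
    have h1 := le_max_left |z.re - (0 + 1 / 2)| |z.im - (0 + 1 / 2)|
    have h2 := le_max_right |z.re - (0 + 1 / 2)| |z.im - (0 + 1 / 2)|
    rw [h] at h1 h2
    rw [abs_le] at h1 h2
    refine ⟨⟨⟨by linarith, by linarith⟩, ⟨by linarith, by linarith⟩⟩, ?_⟩
    rintro ⟨⟨a, b⟩, c, d⟩
    have : max |z.re - (0 + 1 / 2)| |z.im - (0 + 1 / 2)| < 1 / 2 := by
      apply max_lt <;> rw [abs_lt] <;> constructor <;> linarith
    linarith
  · rintro ⟨⟨⟨a, b⟩, c, d⟩, h⟩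
    apply le_antisymm
    · apply max_le <;> rw [abs_le] <;> constructor <;> linarith
    · by_contra hlt
      push Not at hlt
      rw [max_lt_iff, abs_lt, abs_lt] at hlt
      exact h ⟨⟨by linarith, by linarith⟩, by linarith, by linarith⟩

lemma outer_subset_unitSq : outerSquare ⊆ unitSq := fun _ hz => (mem_outer_iff.1 hz).1

variable [hp : OddBase p]

lemma two_mid_add_one : 2 * mid p + 1 = p := by
  obtain ⟨h1, k, hk⟩ := hp
  simp only [mid]; omega

lemma one_le_mid : 1 ≤ mid p := by
  have := hp.three_le
  have := two_mid_add_one (p := p)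
  omega

lemma cast_base : (p : ℝ) = 2 * (mid p : ℝ) + 1 := by
  exact_mod_cast (two_mid_add_one (p := p)).symm

lemma one_le_mid_cast : (1 : ℝ) ≤ mid p := by exact_mod_cast one_le_mid (p := p)

lemma three_le_cast : (3 : ℝ) ≤ p := by exact_mod_cast hp.three_le

lemma base_pos : (0 : ℝ) < p := by linarith [three_le_cast (p := p)]

lemma pow_base_pos (n : ℕ) : (0 : ℝ) < (p : ℝ) ^ n := pow_pos base_pos n

lemma mem_middle_iff {z : ℂ} :
    z ∈ middleSquare p ↔ z ∈ solidMid p ∧ z ∉ openMid p := by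
  have hp0 := base_pos (p := p)
  have hc := cast_base (p := p)
  set m : ℝ := (mid p : ℝ)
  have key : ∀ x : ℝ, x - (((p : ℝ) - 1) / (2 * p) + 1 / p / 2) = (p * x - m - 1 / 2) / p := by
    intro x; field_simp; rw [hc]; ring
  simp only [middleSquare, squareBoundary, solidMid, openMid, mem_ofPred_eq, mem_Icc, mem_Ioo]
  have hre : (((((p : ℝ) - 1) / (2 * p) : ℝ) : ℂ) * (1 + Complex.I)).re
      = ((p : ℝ) - 1) / (2 * p) := by
    simp only [Complex.re_ofReal_mul]; simp
  have him : (((((p : ℝ) - 1) / (2 * p) : ℝ) : ℂ) * (1 + Complex.I)).im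
      = ((p : ℝ) - 1) / (2 * p) := by
    simp only [Complex.im_ofReal_mul]; simp
  rw [hre, him, key, key, abs_div, abs_div, abs_of_pos hp0, max_div_div_right hp0.le,
    div_right_comm, div_left_inj' hp0.ne']
  constructor
  · intro h
    have h1 := le_max_left |p * z.re - m - 1 / 2| |p * z.im - m - 1 / 2|
    have h2 := le_max_right |p * z.re - m - 1 / 2| |p * z.im - m - 1 / 2|
    rw [h] at h1 h2
    rw [abs_le] at h1 h2
    refine ⟨⟨⟨by linarith, by linarith⟩, ⟨by linarith, by linarith⟩⟩, ?_⟩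
    rintro ⟨⟨a, b⟩, c, d⟩
    have : max |p * z.re - m - 1 / 2| |p * z.im - m - 1 / 2| < 1 / 2 := by
      apply max_lt <;> rw [abs_lt] <;> constructor <;> linarith
    linarith
  · rintro ⟨⟨⟨a, b⟩, c, d⟩, h⟩
    apply le_antisymm
    · apply max_le <;> rw [abs_le] <;> constructor <;> linarith
    · by_contra hlt
      push Not at hlt
      rw [max_lt_iff, abs_lt, abs_lt] at hlt
      exact h ⟨⟨by linarith, by linarith⟩, by linarith, by linarith⟩

lemma cellMap_re (d : Digit p) (z : ℂ) : (cellMap d z).re = (d.1.1 + z.re) / p := by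
  simp only [cellMap]
  rw [show ((p : ℕ) : ℂ) = ((p : ℝ) : ℂ) by simp, Complex.div_ofReal_re]
  simp [add_comm]

lemma cellMap_im (d : Digit p) (z : ℂ) : (cellMap d z).im = (d.1.2 + z.im) / p := by
  simp only [cellMap]
  rw [show ((p : ℕ) : ℂ) = ((p : ℝ) : ℂ) by simp, Complex.div_ofReal_im]
  simp [add_comm]

lemma wordMap_re (w : Word p) (z : ℂ) :
    (wordMap w z).re = (cornerX w + z.re) / p ^ w.length := by
  induction w with
  | nil => simp [wordMap, cornerX]
  | cons d w ih =>
    have := base_pos (p := p)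
    simp only [wordMap, cellMap_re, ih, cornerX, List.length_cons]
    push_cast
    field_simp
    ring

lemma wordMap_im (w : Word p) (z : ℂ) :
    (wordMap w z).im = (cornerY w + z.im) / p ^ w.length := by
  induction w with
  | nil => simp [wordMap, cornerY]
  | cons d w ih =>
    have := base_pos (p := p)
    simp only [wordMap, cellMap_im, ih, cornerY, List.length_cons]
    push_cast
    field_simp
    ring

lemma wordMap_append (v w : Word p) (z : ℂ) :
    wordMap (v ++ w) z = wordMap v (wordMap w z) := by
  induction v with
  | nil => rfl
  | cons d v ih => simp [wordMap, ih]

lemma scaled_wordMap_re (w : Word p) (z : ℂ) :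
    (p : ℝ) ^ w.length * (wordMap w z).re = cornerX w + z.re := by
  have := pow_base_pos (p := p) w.length
  rw [wordMap_re]; field_simp

lemma scaled_wordMap_im (w : Word p) (z : ℂ) :
    (p : ℝ) ^ w.length * (wordMap w z).im = cornerY w + z.im := by
  have := pow_base_pos (p := p) w.length
  rw [wordMap_im]; field_simp

lemma wordMap_injective (w : Word p) : Function.Injective (wordMap w) := by
  intro a b h
  have h1 := scaled_wordMap_re w a
  have h2 := scaled_wordMap_im w a
  rw [h, scaled_wordMap_re] at h1
  rw [h, scaled_wordMap_im] at h2
  apply Complex.ext <;> linarith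

lemma cellMap_injective (d : Digit p) : Function.Injective (cellMap d) :=
  wordMap_injective [d]

lemma continuous_wordMap (w : Word p) : Continuous (wordMap w) := by
  induction w with
  | nil => exact continuous_id
  | cons d w ih =>
    simp only [wordMap]
    unfold cellMap
    fun_prop

/-- The inverse of `wordMap w`. -/
def wordInv (w : Word p) (z : ℂ) : ℂ :=
  ⟨p ^ w.length * z.re - cornerX w, p ^ w.length * z.im - cornerY w⟩

lemma wordMap_wordInv (w : Word p) (z : ℂ) : wordMap w (wordInv w z) = z := by
  have := pow_base_pos (p := p) w.length
  apply Complex.ext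
  · rw [wordMap_re]; simp only [wordInv]; field_simp; ring
  · rw [wordMap_im]; simp only [wordInv]; field_simp; ring

lemma wordInv_wordMap (w : Word p) (z : ℂ) : wordInv w (wordMap w z) = z :=
  wordMap_injective w (wordMap_wordInv w _)

lemma continuous_wordInv (w : Word p) : Continuous (wordInv w) := by
  have : wordInv w = fun z => (((p ^ w.length * z.re - cornerX w : ℝ) : ℂ)
      + ((p ^ w.length * z.im - cornerY w : ℝ) : ℂ) * Complex.I) := by
    funext z
    exact Complex.mk_eq_add_mul_I _ _
  rw [this]
  fun_prop

lemma mem_wordMap_image {w : Word p} {A : Set ℂ} {z : ℂ} :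
    z ∈ wordMap w '' A ↔ wordInv w z ∈ A := by
  constructor
  · rintro ⟨y, hy, rfl⟩; rwa [wordInv_wordMap]
  · intro h; exact ⟨_, h, wordMap_wordInv w z⟩

lemma cornerX_lt (w : Word p) : cornerX w + 1 ≤ p ^ w.length := by
  induction w with
  | nil => simp [cornerX]
  | cons d w ih =>
    simp only [cornerX, List.length_cons, pow_succ]
    have h1 : d.1.1 + 1 ≤ p := d.2.1
    calc d.1.1 * p ^ w.length + cornerX w + 1 ≤ d.1.1 * p ^ w.length + p ^ w.length := by omega
      _ = (d.1.1 + 1) * p ^ w.length := by ring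
      _ ≤ p * p ^ w.length := Nat.mul_le_mul_right _ h1
      _ = _ := by ring

lemma cornerY_lt (w : Word p) : cornerY w + 1 ≤ p ^ w.length := by
  induction w with
  | nil => simp [cornerY]
  | cons d w ih =>
    simp only [cornerY, List.length_cons, pow_succ]
    have h1 : d.1.2 + 1 ≤ p := d.2.2.1
    calc d.1.2 * p ^ w.length + cornerY w + 1 ≤ d.1.2 * p ^ w.length + p ^ w.length := by omega
      _ = (d.1.2 + 1) * p ^ w.length := by ring
      _ ≤ p * p ^ w.length := Nat.mul_le_mul_right _ h1
      _ = _ := by ring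

lemma wordMap_mem_unitSq (w : Word p) {z : ℂ} (hz : z ∈ unitSq) : wordMap w z ∈ unitSq := by
  have h0 := pow_base_pos (p := p) w.length
  have h1 : (cornerX w : ℝ) + 1 ≤ p ^ w.length := by exact_mod_cast cornerX_lt w
  have h2 : (cornerY w : ℝ) + 1 ≤ p ^ w.length := by exact_mod_cast cornerY_lt w
  obtain ⟨⟨a, b⟩, c, d⟩ := hz
  refine ⟨⟨?_, ?_⟩, ?_, ?_⟩
  · rw [wordMap_re]; positivity
  · rw [wordMap_re, div_le_one h0]; linarith
  · rw [wordMap_im]; positivity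
  · rw [wordMap_im, div_le_one h0]; linarith

lemma wordMap_mem_openSq (w : Word p) {z : ℂ} (hz : z ∈ openSq) : wordMap w z ∈ openSq := by
  have h0 := pow_base_pos (p := p) w.length
  have h1 : (cornerX w : ℝ) + 1 ≤ p ^ w.length := by exact_mod_cast cornerX_lt w
  have h2 : (cornerY w : ℝ) + 1 ≤ p ^ w.length := by exact_mod_cast cornerY_lt w
  obtain ⟨⟨a, b⟩, c, d⟩ := hz
  refine ⟨⟨?_, ?_⟩, ?_, ?_⟩
  · rw [wordMap_re]; positivity
  · rw [wordMap_re, div_lt_one h0]; linarith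
  · rw [wordMap_im]; positivity
  · rw [wordMap_im, div_lt_one h0]; linarith

lemma openMid_subset_solidMid : openMid p ⊆ solidMid p := fun _ hz =>
  ⟨Ioo_subset_Icc_self hz.1, Ioo_subset_Icc_self hz.2⟩

lemma solidMid_subset_openSq : solidMid p ⊆ openSq := by
  have h1 := one_le_mid_cast (p := p)
  have h2 := cast_base (p := p)
  have h3 := base_pos (p := p)
  rintro z ⟨⟨a, b⟩, c, d⟩
  refine ⟨⟨?_, ?_⟩, ?_, ?_⟩ <;> nlinarith

lemma middle_subset_solidMid : middleSquare p ⊆ solidMid p := fun _ hz => (mem_middle_iff.1 hz).1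

lemma circ_some_subset_solid (w : Word p) : circ (some w) ⊆ solid w :=
  image_mono middle_subset_solidMid

lemma hole_subset_solid (w : Word p) : hole w ⊆ solid w := image_mono openMid_subset_solidMid

lemma mem_circ_some_iff {w : Word p} {z : ℂ} :
    z ∈ circ (some w) ↔ z ∈ solid w ∧ z ∉ hole w := by
  simp only [circ, solid, hole, mem_wordMap_image, mem_middle_iff]

lemma solid_subset_openSq (w : Word p) : solid w ⊆ openSq := by
  rintro _ ⟨y, hy, rfl⟩
  exact wordMap_mem_openSq w (solidMid_subset_openSq hy)

lemma solid_cons (d : Digit p) (w : Word p) : solid (d :: w) = cellMap d '' solid w := by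
  simp only [solid, image_image, wordMap]

lemma hole_cons (d : Digit p) (w : Word p) : hole (d :: w) = cellMap d '' hole w := by
  simp only [hole, image_image, wordMap]

lemma circ_cons (d : Digit p) (w : Word p) :
    circ (some (d :: w)) = cellMap d '' circ (some w) := by
  simp only [circ, image_image, wordMap]

lemma isClosed_unitSq : IsClosed unitSq := by
  have : unitSq = Complex.re ⁻¹' Icc 0 1 ∩ Complex.im ⁻¹' Icc 0 1 := rfl
  rw [this]
  exact (isClosed_Icc.preimage Complex.continuous_re).inter
    (isClosed_Icc.preimage Complex.continuous_im)

lemma isOpen_openMid : IsOpen (openMid p) := by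
  have : openMid p = (fun z : ℂ => p * z.re) ⁻¹' Ioo (mid p : ℝ) (mid p + 1)
      ∩ (fun z : ℂ => p * z.im) ⁻¹' Ioo (mid p : ℝ) (mid p + 1) := rfl
  rw [this]
  exact (isOpen_Ioo.preimage (by fun_prop)).inter (isOpen_Ioo.preimage (by fun_prop))

lemma isClosed_solidMid : IsClosed (solidMid p) := by
  have : solidMid p = (fun z : ℂ => p * z.re) ⁻¹' Icc (mid p : ℝ) (mid p + 1)
      ∩ (fun z : ℂ => p * z.im) ⁻¹' Icc (mid p : ℝ) (mid p + 1) := rfl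
  rw [this]
  exact (isClosed_Icc.preimage (by fun_prop)).inter (isClosed_Icc.preimage (by fun_prop))

lemma image_eq_preimage (w : Word p) (A : Set ℂ) : wordMap w '' A = wordInv w ⁻¹' A := by
  ext z; exact mem_wordMap_image

lemma isOpen_hole (w : Word p) : IsOpen (hole w) := by
  rw [hole, image_eq_preimage]; exact isOpen_openMid.preimage (continuous_wordInv w)

lemma isClosed_solid (w : Word p) : IsClosed (solid w) := by
  rw [solid, image_eq_preimage]; exact isClosed_solidMid.preimage (continuous_wordInv w)

lemma isBounded_unitSq : Bornology.IsBounded unitSq := by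
  refine (Metric.isBounded_closedBall (x := (0 : ℂ)) (r := 2)).subset fun z hz => ?_
  rw [mem_closedBall, dist_zero_right]
  obtain ⟨⟨a, b⟩, c, d⟩ := hz
  refine (Complex.norm_le_abs_re_add_abs_im z).trans ?_
  rw [abs_of_nonneg a, abs_of_nonneg c]; linarith

lemma isCompact_unitSq : IsCompact unitSq :=
  Metric.isCompact_of_isClosed_isBounded isClosed_unitSq isBounded_unitSq

/-- Grid positions of points are determined once one of them is interior to its subsquare. -/
lemma digit_eq_of_openSq {i j i' j' : ℕ} {y y' : ℂ} (hy : y ∈ openSq) (hy' : y' ∈ unitSq)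
    (hre : i + y.re = i' + y'.re) (him : j + y.im = j' + y'.im) : i = i' ∧ j = j' := by
  obtain ⟨⟨a, b⟩, c, d⟩ := hy
  obtain ⟨⟨a', b'⟩, c', d'⟩ := hy'
  have h1 : (i : ℝ) < i' + 1 := by linarith
  have h2 : (i' : ℝ) < i + 1 := by linarith
  have h3 : (j : ℝ) < j' + 1 := by linarith
  have h4 : (j' : ℝ) < j + 1 := by linarith
  norm_cast at h1 h2 h3 h4
  omega

lemma cellMap_eq_openSq {d d' : Digit p} {y y' : ℂ} (hy : y ∈ openSq) (hy' : y' ∈ unitSq)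
    (h : cellMap d y = cellMap d' y') : d = d' ∧ y = y' := by
  have h0 := base_pos (p := p)
  have h1 := congrArg Complex.re h
  have h2 := congrArg Complex.im h
  rw [cellMap_re, cellMap_re, div_left_inj' h0.ne'] at h1
  rw [cellMap_im, cellMap_im, div_left_inj' h0.ne'] at h2
  have hd : d = d' := by
    obtain ⟨a, b⟩ := digit_eq_of_openSq hy hy' h1 h2
    exact Subtype.ext (Prod.ext a b)
  subst hd
  exact ⟨rfl, cellMap_injective d h⟩

lemma cellMap_openSq_not_solidMid {d : Digit p} {y : ℂ} (hy : y ∈ openSq) :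
    cellMap d y ∉ solidMid p := by
  have h0 := base_pos (p := p)
  rintro ⟨⟨a, b⟩, c, e⟩
  rw [cellMap_re] at a b
  rw [cellMap_im] at c e
  rw [mul_div_cancel₀ _ h0.ne'] at a b c e
  exact d.2.2.2 (digit_eq_of_openSq (i' := mid p) (j' := mid p)
    (y' := ⟨d.1.1 + y.re - mid p, d.1.2 + y.im - mid p⟩) hy
    ⟨⟨by simp; linarith, by simp; linarith⟩, by simp; linarith, by simp; linarith⟩
    (by simp) (by simp))

lemma cellMap_unitSq_not_openMid {d : Digit p} {y : ℂ} (hy : y ∈ unitSq) :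
    cellMap d y ∉ openMid p := by
  have h0 := base_pos (p := p)
  rintro ⟨⟨a, b⟩, c, e⟩
  rw [cellMap_re] at a b
  rw [cellMap_im] at c e
  rw [mul_div_cancel₀ _ h0.ne'] at a b c e
  obtain ⟨h1, h2⟩ := digit_eq_of_openSq (i := mid p) (j := mid p)
    (y := ⟨d.1.1 + y.re - mid p, d.1.2 + y.im - mid p⟩) (y' := y)
    ⟨⟨by simp; linarith, by simp; linarith⟩, by simp; linarith, by simp; linarith⟩
    hy (i' := d.1.1) (j' := d.1.2) (by simp) (by simp)
  exact d.2.2.2 ⟨h1.symm, h2.symm⟩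

end

noncomputable section

variable {p : ℕ} [hp : OddBase p]

lemma mem_approx_succ {n : ℕ} {z : ℂ} :
    z ∈ carpetApprox p (n + 1) ↔ ∃ d : Digit p, ∃ y ∈ carpetApprox p n, cellMap d y = z := by
  simp only [carpetApprox, mem_iUnion, mem_image, exists_prop]
  constructor
  · rintro ⟨i, j, hi, hj, hij, y, hy, rfl⟩
    exact ⟨⟨(i, j), hi, hj, hij⟩, y, hy, rfl⟩
  · rintro ⟨d, y, hy, rfl⟩
    exact ⟨d.1.1, d.1.2, d.2.1, d.2.2.1, d.2.2.2, y, hy, rfl⟩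

lemma approx_succ_subset (n : ℕ) : carpetApprox p (n + 1) ⊆ carpetApprox p n := by
  induction n with
  | zero =>
    intro z hz
    obtain ⟨d, y, hy, rfl⟩ := mem_approx_succ.1 hz
    exact wordMap_mem_unitSq [d] hy
  | succ n ih =>
    intro z hz
    obtain ⟨d, y, hy, rfl⟩ := mem_approx_succ.1 hz
    exact mem_approx_succ.2 ⟨d, y, ih hy, rfl⟩

lemma approx_antitone : Antitone (carpetApprox p) :=
  antitone_nat_of_succ_le approx_succ_subset

instance : Finite (Digit p) := by
  refine Finite.of_injective (β := Fin p × Fin p)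
    (fun d => (⟨d.1.1, d.2.1⟩, ⟨d.1.2, d.2.2.1⟩)) ?_
  intro d e h
  simp only [Prod.mk.injEq, Fin.mk.injEq] at h
  exact Subtype.ext (Prod.ext h.1 h.2)

lemma mem_carpet_iff {z : ℂ} :
    z ∈ sierpinskiCarpet p ↔ ∃ d : Digit p, ∃ y ∈ sierpinskiCarpet p, cellMap d y = z := by
  constructor
  · intro h
    have h1 : ∀ n, ∃ d : Digit p, ∃ y ∈ carpetApprox p n, cellMap d y = z := fun n =>
      mem_approx_succ.1 (mem_iInter.1 h (n + 1))
    choose d y hy hyz using h1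
    obtain ⟨e, he⟩ := Finite.exists_infinite_fiber d
    have he' : (d ⁻¹' {e}).Infinite := infinite_coe_iff.1 he
    obtain ⟨n₀, hn₀, -⟩ := he'.exists_gt 0
    refine ⟨e, y n₀, mem_iInter.2 fun n => ?_, ?_⟩
    · obtain ⟨m, hm, hnm⟩ := he'.exists_gt n
      have : y n₀ = y m := by
        apply cellMap_injective e
        have e1 := hyz n₀
        have e2 := hyz m
        rw [mem_preimage, mem_singleton_iff] at hm hn₀
        rw [hm] at e2
        rw [hn₀] at e1
        rw [e1, e2]
      rw [this]
      exact approx_antitone hnm.le (hy m)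
    · rw [← hyz n₀]
      rw [mem_preimage, mem_singleton_iff] at hn₀
      rw [hn₀]
  · rintro ⟨d, y, hy, rfl⟩
    refine mem_iInter.2 fun n => approx_succ_subset n ?_
    exact mem_approx_succ.2 ⟨d, y, mem_iInter.1 hy n, rfl⟩

lemma carpet_subset_unitSq : sierpinskiCarpet p ⊆ unitSq := fun _ hz => mem_iInter.1 hz 0

lemma hole_subset_openSq (w : Word p) : hole w ⊆ openSq :=
  (hole_subset_solid w).trans (solid_subset_openSq w)

lemma carpet_not_hole {z : ℂ} (hz : z ∈ sierpinskiCarpet p) (w : Word p) : z ∉ hole w := by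
  induction w generalizing z with
  | nil =>
    obtain ⟨d, y, hy, rfl⟩ := mem_carpet_iff.1 hz
    rintro ⟨x, hx, hxy⟩
    refine cellMap_unitSq_not_openMid (carpet_subset_unitSq hy) (d := d) ?_
    rw [← hxy]; exact hx
  | cons e w ih =>
    obtain ⟨d, y, hy, rfl⟩ := mem_carpet_iff.1 hz
    rw [hole_cons]
    rintro ⟨x, hx, hxy⟩
    obtain ⟨rfl, rfl⟩ := cellMap_eq_openSq (hole_subset_openSq w hx) (carpet_subset_unitSq hy) hxy
    exact ih hy hx

lemma exists_grid_index {x : ℝ} (hx : x ∈ Icc (0 : ℝ) 1) :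
    ∃ i : ℕ, i < p ∧ p * x - i ∈ Icc (0 : ℝ) 1 := by
  have h0 := base_pos (p := p)
  rcases eq_or_lt_of_le hx.2 with h | h
  · refine ⟨p - 1, ?_, ?_⟩
    · have := hp.three_le; omega
    · rw [h, Nat.cast_sub (by have := hp.three_le; omega)]
      constructor <;> simp
  · refine ⟨⌊p * x⌋₊, ?_, ?_, ?_⟩
    · rw [Nat.floor_lt (by have := hx.1; positivity)]; nlinarith
    · linarith [Nat.floor_le (a := p * x) (by have := hx.1; positivity)]
    · linarith [Nat.lt_floor_add_one (p * x)]

lemma exists_grid_position {z : ℂ} (hz : z ∈ unitSq) :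
    ∃ i j : ℕ, i < p ∧ j < p ∧ p * z.re - i ∈ Icc (0 : ℝ) 1 ∧ p * z.im - j ∈ Icc (0 : ℝ) 1 := by
  obtain ⟨i, hi, hi'⟩ := exists_grid_index (p := p) hz.1
  obtain ⟨j, hj, hj'⟩ := exists_grid_index (p := p) hz.2
  exact ⟨i, j, hi, hj, hi', hj'⟩

lemma eq_cellMap_of_position {z : ℂ} (d : Digit p) (h1 : p * z.re - d.1.1 ∈ Icc (0 : ℝ) 1)
    (h2 : p * z.im - d.1.2 ∈ Icc (0 : ℝ) 1) : ∃ y ∈ unitSq, cellMap d y = z := by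
  have h0 := base_pos (p := p)
  refine ⟨⟨p * z.re - d.1.1, p * z.im - d.1.2⟩, ⟨h1, h2⟩, ?_⟩
  apply Complex.ext
  · rw [cellMap_re]; field_simp; ring
  · rw [cellMap_im]; field_simp; ring

lemma cell_or_openMid {z : ℂ} (hz : z ∈ unitSq) :
    z ∈ openMid p ∨ ∃ d : Digit p, ∃ y ∈ unitSq, cellMap d y = z := by
  have hm := one_le_mid (p := p)
  have hm2 := two_mid_add_one (p := p)
  obtain ⟨i, j, hi, hj, hi', hj'⟩ := exists_grid_position (p := p) hz
  by_cases hij : i = mid p ∧ j = mid p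
  · obtain ⟨rfl, rfl⟩ := hij
    by_cases h : z ∈ openMid p
    · exact Or.inl h
    right
    have hm3 : ((mid p - 1 : ℕ) : ℝ) = mid p - 1 := by push_cast [hm]; ring
    have hmid := hi'
    have hmjd := hj'
    rw [mem_Icc] at hi' hj'
    have hcases : p * z.re = mid p ∨ p * z.re = mid p + 1 ∨ p * z.im = mid p
        ∨ p * z.im = mid p + 1 := by
      by_contra hne
      push Not at hne
      obtain ⟨a, b, c, e⟩ := hne
      apply h
      exact ⟨⟨lt_of_le_of_ne (by linarith) a.symm, lt_of_le_of_ne (by linarith) b⟩,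
        lt_of_le_of_ne (by linarith) c.symm, lt_of_le_of_ne (by linarith) e⟩
    rcases hcases with h | h | h | h
    · exact ⟨⟨(mid p - 1, mid p), by simp; omega⟩, eq_cellMap_of_position _
        (by simp only [hm3, mem_Icc]; constructor <;> linarith) hmjd⟩
    · exact ⟨⟨(mid p + 1, mid p), by simp; omega⟩, eq_cellMap_of_position _
        (by simp only [Nat.cast_add, Nat.cast_one, mem_Icc]; constructor <;> linarith) hmjd⟩
    · exact ⟨⟨(mid p, mid p - 1), by simp; omega⟩, eq_cellMap_of_position _ hmid
        (by simp only [hm3, mem_Icc]; constructor <;> linarith)⟩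
    · exact ⟨⟨(mid p, mid p + 1), by simp; omega⟩, eq_cellMap_of_position _ hmid
        (by simp only [Nat.cast_add, Nat.cast_one, mem_Icc]; constructor <;> linarith)⟩
  · exact Or.inr ⟨⟨(i, j), hi, hj, hij⟩, eq_cellMap_of_position _ hi' hj'⟩

lemma carpet_eq : sierpinskiCarpet p = unitSq \ ⋃ w : Word p, hole w := by
  apply Subset.antisymm
  · intro z hz
    refine ⟨carpet_subset_unitSq hz, ?_⟩
    simp only [mem_iUnion, not_exists]
    exact carpet_not_hole hz
  · intro z hz
    refine mem_iInter.2 fun n => ?_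
    induction n generalizing z with
    | zero => exact hz.1
    | succ n ih =>
      have hz2 : ∀ w : Word p, z ∉ hole w := by simpa using hz.2
      rcases cell_or_openMid (p := p) hz.1 with h | ⟨d, y, hy, rfl⟩
      · exact absurd ⟨z, h, rfl⟩ (hz2 [])
      · refine mem_approx_succ.2 ⟨d, y, ih ⟨hy, ?_⟩, rfl⟩
        simp only [mem_iUnion, not_exists]
        intro w hw
        exact hz2 (d :: w) (by rw [hole_cons]; exact ⟨y, hw, rfl⟩)

lemma mem_carpet_of {z : ℂ} (hz : z ∈ unitSq) (h : ∀ w : Word p, z ∉ hole w) :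
    z ∈ sierpinskiCarpet p := by
  rw [carpet_eq]; exact ⟨hz, by simpa using h⟩

lemma isClosed_carpet : IsClosed (sierpinskiCarpet p) := by
  rw [carpet_eq, sdiff_eq]
  exact isClosed_unitSq.inter (isOpen_iUnion isOpen_hole).isClosed_compl

lemma isCompact_carpet : IsCompact (sierpinskiCarpet p) :=
  isCompact_unitSq.of_isClosed_subset isClosed_carpet carpet_subset_unitSq

lemma outer_subset_carpet : outerSquare ⊆ sierpinskiCarpet p := fun _ hz =>
  mem_carpet_of (mem_outer_iff.1 hz).1 fun w hw => (mem_outer_iff.1 hz).2 (hole_subset_openSq w hw)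

lemma wordMap_mem_carpet (w : Word p) {z : ℂ} (hz : z ∈ sierpinskiCarpet p) :
    wordMap w z ∈ sierpinskiCarpet p := by
  induction w with
  | nil => exact hz
  | cons d w ih => exact mem_carpet_iff.2 ⟨d, _, ih, rfl⟩

lemma solid_disjoint {v w : Word p} (hvw : v ≠ w) {z : ℂ} (hv : z ∈ solid v) : z ∉ solid w := by
  induction v generalizing w z with
  | nil =>
    cases w with
    | nil => exact absurd rfl hvw
    | cons d w =>
      rw [solid_cons]
      rintro ⟨x, hx, rfl⟩
      obtain ⟨y, hy, hyx⟩ := hv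
      exact cellMap_openSq_not_solidMid (d := d) (solid_subset_openSq w hx) (hyx ▸ hy)
  | cons e v ih =>
    rw [solid_cons] at hv
    obtain ⟨x, hx, rfl⟩ := hv
    cases w with
    | nil =>
      rintro ⟨y, hy, hyx⟩
      exact cellMap_openSq_not_solidMid (d := e) (solid_subset_openSq v hx) (hyx ▸ hy)
    | cons d w =>
      rw [solid_cons]
      rintro ⟨y, hy, hyx⟩
      obtain ⟨rfl, rfl⟩ := cellMap_eq_openSq (solid_subset_openSq w hy)
        (openSq_subset (solid_subset_openSq v hx)) hyx
      exact ih (fun h => hvw (by rw [h])) hx hy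

lemma circ_subset_carpet (c : Option (Word p)) : circ c ⊆ sierpinskiCarpet p := by
  cases c with
  | none => exact outer_subset_carpet
  | some w =>
    intro z hz
    have h := mem_circ_some_iff.1 hz
    refine mem_carpet_of (openSq_subset (solid_subset_openSq w h.1)) fun v hv => ?_
    by_cases hvw : w = v
    · subst hvw; exact h.2 hv
    · exact solid_disjoint hvw h.1 (hole_subset_solid v hv)

lemma circ_of_solid_carpet {w : Word p} {z : ℂ} (h1 : z ∈ solid w)
    (h2 : z ∈ sierpinskiCarpet p) : z ∈ circ (some w) :=
  mem_circ_some_iff.2 ⟨h1, carpet_not_hole h2 w⟩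

lemma circ_disjoint {c d : Option (Word p)} (hcd : c ≠ d) {z : ℂ} (hz : z ∈ circ c) :
    z ∉ circ d := by
  cases c with
  | none =>
    cases d with
    | none => exact absurd rfl hcd
    | some w =>
      exact fun h => (mem_outer_iff.1 hz).2 (solid_subset_openSq w (circ_some_subset_solid w h))
  | some v =>
    cases d with
    | none =>
      exact fun h => (mem_outer_iff.1 h).2 (solid_subset_openSq v (circ_some_subset_solid v hz))
    | some w =>
      exact fun h => solid_disjoint (fun e => hcd (by rw [e])) (circ_some_subset_solid v hz)
        (circ_some_subset_solid w h)

lemma openCell_not_solid {v w : Word p} (hvw : ¬ w <+: v) {y : ℂ} (hy : y ∈ openSq) :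
    wordMap w y ∉ solid v := by
  induction w generalizing v with
  | nil => exact absurd List.nil_prefix hvw
  | cons d w ih =>
    cases v with
    | nil =>
      rintro ⟨x, hx, hxy⟩
      refine cellMap_openSq_not_solidMid (d := d) (wordMap_mem_openSq w hy) ?_
      change wordMap (d :: w) y ∈ _
      rw [← hxy]
      exact hx
    | cons e v =>
      rw [solid_cons]
      rintro ⟨x, hx, hxy⟩
      obtain ⟨rfl, rfl⟩ := cellMap_eq_openSq (wordMap_mem_openSq w hy)
        (openSq_subset (solid_subset_openSq v hx)) hxy.symm
      exact ih (fun h => hvw (List.cons_prefix_cons.2 ⟨rfl, h⟩)) hx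

lemma word_eq_of_openSq {v w : Word p} (hvw : v.length = w.length) {y y' : ℂ} (hy : y ∈ openSq)
    (hy' : y' ∈ unitSq) (h : wordMap v y = wordMap w y') : v = w := by
  induction v generalizing w with
  | nil => exact (List.length_eq_zero_iff.1 hvw.symm).symm
  | cons d v ih =>
    cases w with
    | nil => simp at hvw
    | cons e w =>
      obtain ⟨rfl, h2⟩ := cellMap_eq_openSq (wordMap_mem_openSq v hy) (wordMap_mem_unitSq w hy') h
      rw [ih (by simpa using hvw) h2]

/-- The centre of the unit square. -/
def centre : ℂ := ⟨1 / 2, 1 / 2⟩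

lemma centre_mem_openSq : centre ∈ openSq := by
  constructor <;> constructor <;> norm_num [centre]

lemma word_eq_of_corner {v w : Word p} (hvw : v.length = w.length)
    (hx : cornerX v = cornerX w) (hy : cornerY v = cornerY w) : v = w := by
  refine word_eq_of_openSq hvw centre_mem_openSq (openSq_subset centre_mem_openSq) ?_
  apply Complex.ext
  · rw [wordMap_re, wordMap_re, hvw, hx]
  · rw [wordMap_im, wordMap_im, hvw, hy]

lemma unitSq_covering {z : ℂ} (hz : z ∈ unitSq) (n : ℕ) :
    (∃ v : Word p, v.length < n ∧ z ∈ solid v) ∨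
      ∃ w : Word p, w.length = n ∧ ∃ y ∈ unitSq, wordMap w y = z := by
  induction n generalizing z with
  | zero => exact Or.inr ⟨[], rfl, z, hz, rfl⟩
  | succ n ih =>
    rcases cell_or_openMid (p := p) hz with h | ⟨d, y, hy, rfl⟩
    · exact Or.inl ⟨[], by simp, z, openMid_subset_solidMid h, rfl⟩
    · rcases ih hy with ⟨v, hv, hyv⟩ | ⟨w, hw, x, hx, rfl⟩
      · exact Or.inl ⟨d :: v, by simpa using hv, by rw [solid_cons]; exact ⟨y, hyv, rfl⟩⟩
      · exact Or.inr ⟨d :: w, by simpa using hw, x, hx, rfl⟩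

lemma exists_word {z : ℂ} (hz : z ∈ sierpinskiCarpet p) (n : ℕ) :
    ∃ w : Word p, w.length = n ∧ ∃ y ∈ sierpinskiCarpet p, wordMap w y = z := by
  induction n generalizing z with
  | zero => exact ⟨[], rfl, z, hz, rfl⟩
  | succ n ih =>
    obtain ⟨d, y, hy, rfl⟩ := mem_carpet_iff.1 hz
    obtain ⟨w, hw, x, hx, rfl⟩ := ih hy
    exact ⟨d :: w, by simpa using hw, x, hx, rfl⟩

lemma solid_inter_cell {v w : Word p} (hvw : v.length < w.length) {y : ℂ} (hy : y ∈ unitSq)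
    (h : wordMap w y ∈ solid v) : wordMap w y ∈ sierpinskiCarpet p := by
  apply wordMap_mem_carpet
  apply outer_subset_carpet
  refine mem_outer_iff.2 ⟨hy, fun hy' => openCell_not_solid ?_ hy' h⟩
  intro hpre
  exact absurd hpre.length_le (by omega)

lemma cell_inter_cell {v w : Word p} (hvw : v.length = w.length) (hne : v ≠ w) {y y' : ℂ}
    (hy : y ∈ unitSq) (hy' : y' ∈ unitSq) (h : wordMap v y = wordMap w y') :
    wordMap v y ∈ sierpinskiCarpet p := by
  apply wordMap_mem_carpet
  apply outer_subset_carpet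
  exact mem_outer_iff.2 ⟨hy, fun ho => hne (word_eq_of_openSq hvw ho hy' h)⟩

lemma mem_carpet_of_wordMap (w : Word p) {y : ℂ} (hy : y ∈ unitSq)
    (h : wordMap w y ∈ sierpinskiCarpet p) : y ∈ sierpinskiCarpet p := by
  refine mem_carpet_of hy fun v hv => carpet_not_hole h (w ++ v) ?_
  obtain ⟨x, hx, rfl⟩ := hv
  exact ⟨x, hx, wordMap_append w v x⟩

lemma isCompact_circ (c : Option (Word p)) : IsCompact (circ c) := by
  have hsq : ∀ (a : ℂ) (l : ℝ), IsClosed (squareBoundary a l) := fun a l =>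
    isClosed_eq (by fun_prop) continuous_const
  refine isCompact_carpet.of_isClosed_subset ?_ (circ_subset_carpet c)
  cases c with
  | none => exact hsq _ _
  | some w => rw [circ, image_eq_preimage]; exact (hsq _ _).preimage (continuous_wordInv w)

end

noncomputable section

open MeasureTheory Real in
lemma lintegral_inv_norm_ball_le {r : ℝ} (hr : 0 ≤ r) :
    ∫⁻ w in ball (0 : ℂ) r, ‖w⁻¹‖ₑ ≤ ENNReal.ofReal (2 * π * r) := by
  rw [← lintegral_indicator measurableSet_ball, ← Complex.lintegral_comp_polarCoord_symm]
  have hmono : ∀ q ∈ polarCoord.target, ENNReal.ofReal q.1 •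
      (ball (0 : ℂ) r).indicator (fun w => ‖w⁻¹‖ₑ) (Complex.polarCoord.symm q)
      ≤ (Ioo 0 r ×ˢ Ioo (-π) π).indicator (fun _ => (1 : ENNReal)) q := by
    rintro ⟨ρ, θ⟩ ⟨h1, h2⟩
    have h1 : 0 < ρ := h1
    have hn : ‖Complex.polarCoord.symm (ρ, θ)‖ = ρ := by
      rw [Complex.norm_polarCoord_symm, abs_of_pos h1]
    by_cases hρ : ρ < r
    · rw [indicator_of_mem (by rw [mem_ball, dist_zero_right, hn]; exact hρ),
        indicator_of_mem (show (ρ, θ) ∈ Ioo 0 r ×ˢ Ioo (-π) π from ⟨⟨h1, hρ⟩, h2⟩)]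
      rw [smul_eq_mul, ← ofReal_norm, ← ENNReal.ofReal_mul h1.le, norm_inv, hn,
        mul_inv_cancel₀ h1.ne', ENNReal.ofReal_one]
    · rw [indicator_of_notMem (by rw [mem_ball, dist_zero_right, hn]; exact hρ)]
      simp
  refine (setLIntegral_mono' polarCoord.open_target.measurableSet hmono).trans ?_
  refine (setLIntegral_le_lintegral _ _).trans ?_
  rw [lintegral_indicator (measurableSet_Ioo.prod measurableSet_Ioo), setLIntegral_one,
    Measure.volume_eq_prod, Measure.prod_prod, Real.volume_Ioo, Real.volume_Ioo,
    ← ENNReal.ofReal_mul (by linarith)]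
  apply ENNReal.ofReal_le_ofReal
  linarith

open MeasureTheory Real in
lemma lintegral_inv_norm_le {A : Set ℂ} (hA : MeasurableSet A) (z : ℂ) {r : ℝ} (hr : 0 < r) :
    ∫⁻ w in A, ‖(z - w)⁻¹‖ₑ ≤
      ENNReal.ofReal (2 * π * r) + ENNReal.ofReal r⁻¹ * volume A := by
  have h1 : ∫⁻ w in ball z r, ‖(z - w)⁻¹‖ₑ ≤ ENNReal.ofReal (2 * π * r) := by
    have := lintegral_sub_left_eq_self (μ := (volume : Measure ℂ))
      (fun w => (ball (0 : ℂ) r).indicator (fun w => ‖w⁻¹‖ₑ) w) z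
    rw [← lintegral_indicator measurableSet_ball]
    calc _ = ∫⁻ w, (ball (0 : ℂ) r).indicator (fun w => ‖w⁻¹‖ₑ) (z - w) := by
          congr 1
          funext w
          simp only [indicator, mem_ball, dist_eq_norm, norm_sub_rev w z, sub_zero]
      _ ≤ _ := by
          rw [this, lintegral_indicator measurableSet_ball]
          exact lintegral_inv_norm_ball_le hr.le
  calc ∫⁻ w in A, ‖(z - w)⁻¹‖ₑ
      ≤ ∫⁻ w in ball z r ∪ (A \ ball z r), ‖(z - w)⁻¹‖ₑ := by
        apply lintegral_mono_set
        intro w hw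
        by_cases h : w ∈ ball z r
        · exact Or.inl h
        · exact Or.inr ⟨hw, h⟩
    _ ≤ _ := lintegral_union_le _ _ _
    _ ≤ ENNReal.ofReal (2 * π * r) + ∫⁻ w in A \ ball z r, ENNReal.ofReal r⁻¹ := by
        gcongr ?_ + ?_
        refine setLIntegral_mono' (hA.diff measurableSet_ball) fun w hw => ?_
        rw [← ofReal_norm]
        apply ENNReal.ofReal_le_ofReal
        rw [norm_inv]
        have : r ≤ ‖z - w‖ := by
          have := hw.2
          rw [mem_ball, not_lt, dist_comm, dist_eq_norm] at this
          exact this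
        exact inv_anti₀ hr this
    _ ≤ _ := by
        rw [setLIntegral_const]
        gcongr
        exact sdiff_subset

open MeasureTheory Real in
lemma integrableOn_inv_sub {A : Set ℂ} (hA : MeasurableSet A) (hA' : volume A ≠ ⊤) (z : ℂ) :
    IntegrableOn (fun w => (z - w)⁻¹) A := by
  refine ⟨(by fun_prop : Measurable fun w : ℂ => (z - w)⁻¹).aestronglyMeasurable, ?_⟩
  refine lt_of_le_of_lt (lintegral_inv_norm_le hA z one_pos) ?_
  simp only [inv_one, ENNReal.ofReal_one, one_mul]
  exact ENNReal.add_lt_top.2 ⟨ENNReal.ofReal_lt_top, hA'.lt_top⟩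

open Real in
lemma circleAverage_inv_sub_of_lt {z : ℂ} {r : ℝ} (hr : 0 < r) (h : r < ‖z‖) :
    circleAverage (fun w => (z - w)⁻¹) 0 r = z⁻¹ := by
  have : DiffContOnCl ℂ (fun w : ℂ => (z - w)⁻¹) (ball 0 |r|) := by
    apply DifferentiableOn.diffContOnCl
    rw [closure_ball _ (by positivity)]
    intro w hw
    rw [mem_closedBall, dist_zero_right, abs_of_pos hr] at hw
    have : z - w ≠ 0 := by
      intro h0
      rw [sub_eq_zero] at h0
      rw [h0] at h; linarith
    exact (DifferentiableAt.inv (by fun_prop) this).differentiableWithinAt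
  simpa using this.circleAverage

open Real ComplexConjugate in
lemma circleAverage_inv_sub_of_gt {z : ℂ} {r : ℝ} (hr : 0 < r) (h : ‖z‖ < r) :
    circleAverage (fun w => (z - w)⁻¹) 0 r = 0 := by
  set g : ℂ → ℂ := fun w => - w / (r ^ 2 - conj z * w)
  have hne : ∀ w : ℂ, ‖w‖ ≤ r → (r : ℂ) ^ 2 - conj z * w ≠ 0 := by
    intro w hw h0
    rw [sub_eq_zero] at h0
    have := congrArg norm h0
    rw [norm_mul, norm_pow, Complex.norm_real, Complex.norm_conj, Real.norm_eq_abs,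
      abs_of_pos hr] at this
    nlinarith [norm_nonneg z]
  have hg : DiffContOnCl ℂ g (ball 0 |r|) := by
    apply DifferentiableOn.diffContOnCl
    rw [closure_ball _ (by positivity)]
    intro w hw
    rw [mem_closedBall, dist_zero_right, abs_of_pos hr] at hw
    have hd : DifferentiableAt ℂ (fun w : ℂ => (r : ℂ) ^ 2 - conj z * w) w := by fun_prop
    exact (DifferentiableAt.div (by fun_prop) hd (hne w hw)).differentiableWithinAt
  have h1 : circleAverage g 0 r = 0 := by rw [hg.circleAverage]; simp [g]
  have h2 : EqOn (fun w => (z - w)⁻¹) (fun w => conj (g w)) (sphere 0 |r|) := by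
    intro w hw
    rw [mem_sphere, dist_zero_right, abs_of_pos hr] at hw
    have hw0 : w ≠ 0 := by intro h0; rw [h0, norm_zero] at hw; linarith
    have hw2 : w * conj w = r ^ 2 := by
      rw [Complex.mul_conj, Complex.normSq_eq_norm_sq, hw]; push_cast; ring
    have hzw : z - w ≠ 0 := by
      intro h0; rw [sub_eq_zero] at h0; rw [h0] at h; linarith
    have hcw : conj w ≠ 0 := by simpa using hw0
    simp only [g, map_div₀, map_neg, map_sub, map_pow, map_mul, Complex.conj_ofReal,
      Complex.conj_conj]
    rw [← hw2, show w * conj w - z * conj w = -(z - w) * conj w by ring]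
    field_simp
  rw [circleAverage_congr_sphere h2, circleAverage_def]
  rw [circleAverage_def] at h1
  have h3 : ∫ θ in (0 : ℝ)..2 * π, g (circleMap 0 r θ) = 0 := by
    have : ((2 * π)⁻¹ : ℝ) ≠ 0 := by positivity
    simpa [this, pi_ne_zero] using h1
  have h4 : ∫ θ in (0 : ℝ)..2 * π, conj (g (circleMap 0 r θ)) = 0 := by
    rw [intervalIntegral.integral_of_le (by positivity)] at h3 ⊢
    rw [integral_conj, h3, map_zero]
  rw [h4, smul_zero]

open MeasureTheory Real ComplexConjugate in
lemma integral_inv_sub_ball {z : ℂ} {R : ℝ} (hz : ‖z‖ < R) :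
    ∫ w in ball (0 : ℂ) R, (z - w)⁻¹ = π * conj z := by
  set f : ℂ → ℂ := (ball (0 : ℂ) R).indicator (fun w => (z - w)⁻¹)
  have hf : Measurable f :=
    (by fun_prop : Measurable fun w : ℂ => (z - w)⁻¹).indicator measurableSet_ball
  have hfint : Integrable f := by
    rw [integrable_indicator_iff measurableSet_ball]
    exact integrableOn_inv_sub measurableSet_ball measure_ball_lt_top.ne z
  rw [← integral_indicator measurableSet_ball, ← Complex.integral_comp_polarCoord_symm]
  have hsymm : Measurable fun q : ℝ × ℝ => Complex.polarCoord.symm q := by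
    simp only [Complex.polarCoord_symm_apply]; fun_prop
  have hfint2 : IntegrableOn (fun q : ℝ × ℝ => q.1 • f (Complex.polarCoord.symm q))
      polarCoord.target := by
    refine ⟨(measurable_fst.smul (hf.comp hsymm)).aestronglyMeasurable, ?_⟩
    have h1 : ∫⁻ q in polarCoord.target, ‖q.1 • f (Complex.polarCoord.symm q)‖ₑ
        = ∫⁻ w, ‖f w‖ₑ := by
      rw [← Complex.lintegral_comp_polarCoord_symm]
      refine setLIntegral_congr_fun polarCoord.open_target.measurableSet fun q hq => ?_
      have hq : 0 < q.1 := hq.1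
      simp only [enorm_smul, smul_eq_mul]
      congr 1
      rw [← ofReal_norm, Real.norm_eq_abs, abs_of_pos hq]
    exact h1.trans_lt hfint.2
  change ∫ q in Ioi (0 : ℝ) ×ˢ Ioo (-π) π, q.1 • f (Complex.polarCoord.symm q) = _
  change IntegrableOn _ (Ioi (0 : ℝ) ×ˢ Ioo (-π) π) at hfint2
  rw [Measure.volume_eq_prod] at hfint2 ⊢
  rw [setIntegral_prod _ hfint2]
  have hinner : ∀ r ∈ Ioi (0 : ℝ), r ≠ ‖z‖ →
      (∫ θ in Ioo (-π) π, r • f (Complex.polarCoord.symm (r, θ)))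
        = (Ioo 0 ‖z‖).indicator (fun r => ((2 * π * r : ℝ) : ℂ) * z⁻¹) r := by
    intro r hr hrz
    have hr : 0 < r := hr
    rw [integral_smul]
    have hcm : ∀ θ, Complex.polarCoord.symm (r, θ) = circleMap 0 r θ := by
      intro θ
      rw [Complex.polarCoord_symm_apply, circleMap, Complex.exp_mul_I]; simp
    have hcirc : ∫ θ in Ioo (-π) π, (z - circleMap 0 r θ)⁻¹
        = ((2 * π : ℝ) : ℂ) * circleAverage (fun w => (z - w)⁻¹) 0 r := by
      rw [circleAverage_eq_integral_add (-π)]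
      rw [intervalIntegral.integral_comp_add_right (fun θ => (z - circleMap 0 r θ)⁻¹),
        show (0 : ℝ) + -π = -π by ring, show 2 * π + -π = π by ring,
        intervalIntegral.integral_of_le (by linarith [pi_pos]), integral_Ioc_eq_integral_Ioo]
      rw [← Complex.real_smul, smul_smul, mul_inv_cancel₀ (by positivity), one_smul]
    rcases lt_or_gt_of_ne hrz with h | h
    · have hfe : ∀ θ, f (Complex.polarCoord.symm (r, θ)) = (z - circleMap 0 r θ)⁻¹ := by
        intro θ
        simp only [f, hcm]
        rw [indicator_of_mem]
        simp [abs_of_pos hr]; linarith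
      simp only [hfe]
      rw [hcirc, circleAverage_inv_sub_of_lt hr h, indicator_of_mem (show r ∈ Ioo 0 ‖z‖ from ⟨hr,
        h⟩),
        Complex.real_smul]
      push_cast; ring
    · rw [indicator_of_notMem (fun h' => by linarith [h'.2])]
      by_cases hrR : r < R
      · have hfe : ∀ θ, f (Complex.polarCoord.symm (r, θ)) = (z - circleMap 0 r θ)⁻¹ := by
          intro θ
          simp only [f, hcm]
          rw [indicator_of_mem]
          simp [abs_of_pos hr]; linarith
        simp only [hfe]
        rw [hcirc, circleAverage_inv_sub_of_gt hr h, mul_zero, smul_zero]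
      · have hfe : ∀ θ, f (Complex.polarCoord.symm (r, θ)) = 0 := by
          intro θ
          simp only [f, hcm]
          rw [indicator_of_notMem]
          simp [abs_of_pos hr]; linarith
        simp only [hfe, integral_zero, smul_zero]
  have hae : (fun r => ∫ θ in Ioo (-π) π, r • f (Complex.polarCoord.symm (r, θ)))
      =ᵐ[volume.restrict (Ioi 0)]
      (Ioo 0 ‖z‖).indicator (fun r => ((2 * π * r : ℝ) : ℂ) * z⁻¹) := by
    have h1 : ∀ᵐ r ∂(volume : Measure ℝ), r ≠ ‖z‖ := by
      simp [ae_iff]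
    filter_upwards [ae_restrict_of_ae h1, ae_restrict_mem measurableSet_Ioi] with r hr hr'
    exact hinner r hr' hr
  rw [integral_congr_ae hae, setIntegral_indicator measurableSet_Ioo,
    inter_eq_right.2 (fun x hx => hx.1), integral_mul_const,
    ← integral_Ioc_eq_integral_Ioo, ← intervalIntegral.integral_of_le (norm_nonneg z),
    intervalIntegral.integral_ofReal]
  rw [intervalIntegral.integral_const_mul, integral_id]
  by_cases hz0 : z = 0
  · simp [hz0]
  · have : z * conj z = (‖z‖ : ℂ) ^ 2 := by
      rw [Complex.mul_conj, Complex.normSq_eq_norm_sq]; push_cast; ring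
    field_simp
    push_cast
    linear_combination (-π : ℂ) * this

end

noncomputable section

/-- Restrictions to `K` of rational functions without poles on `K`. -/
def rationalFunctions (K : Set ℂ) : Subalgebra ℂ C(K, ℂ) where
  carrier := {h | ∃ P Q : Polynomial ℂ, ∀ z : K, Q.eval (z : ℂ) ≠ 0 ∧
    h z = P.eval (z : ℂ) / Q.eval (z : ℂ)}
  mul_mem' := by
    rintro f g ⟨P, Q, h⟩ ⟨P', Q', h'⟩
    refine ⟨P * P', Q * Q', fun z => ⟨?_, ?_⟩⟩
    · rw [Polynomial.eval_mul]; exact mul_ne_zero (h z).1 (h' z).1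
    · rw [ContinuousMap.mul_apply, (h z).2, (h' z).2, Polynomial.eval_mul, Polynomial.eval_mul,
        div_mul_div_comm]
  add_mem' := by
    rintro f g ⟨P, Q, h⟩ ⟨P', Q', h'⟩
    refine ⟨P * Q' + Q * P', Q * Q', fun z => ⟨?_, ?_⟩⟩
    · rw [Polynomial.eval_mul]; exact mul_ne_zero (h z).1 (h' z).1
    · rw [ContinuousMap.add_apply, (h z).2, (h' z).2, Polynomial.eval_add, Polynomial.eval_mul,
        Polynomial.eval_mul, Polynomial.eval_mul, div_add_div _ _ (h z).1 (h' z).1]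
  algebraMap_mem' r := ⟨Polynomial.C r, 1, fun z => by simp⟩

variable {K : Set ℂ}

/-- The Cauchy kernel `z ↦ (z - w)⁻¹` on `K`, for `w` away from `K`. -/
def cauchyKernel (K : Set ℂ) (w : ℂ) (hw : w ∉ K) : C(K, ℂ) where
  toFun z := ((z : ℂ) - w)⁻¹
  continuous_toFun := by
    refine Continuous.inv₀ (by fun_prop) fun z h => hw ?_
    rw [← sub_eq_zero.1 h]; exact z.2

lemma cauchyKernel_mem (w : ℂ) (hw : w ∉ K) : cauchyKernel K w hw ∈ rationalFunctions K := by
  refine ⟨1, Polynomial.X - Polynomial.C w, fun z => ⟨?_, ?_⟩⟩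
  · simp only [Polynomial.eval_sub, Polynomial.eval_X, Polynomial.eval_C]
    intro h
    rw [sub_eq_zero] at h
    exact hw (h ▸ z.2)
  · simp [cauchyKernel]

open Classical in
/-- The Cauchy kernel, extended by zero. -/
def cauchyKernel₀ (K : Set ℂ) (w : ℂ) : C(K, ℂ) :=
  if hw : w ∈ K then 0 else cauchyKernel K w hw

lemma cauchyKernel₀_mem (w : ℂ) : cauchyKernel₀ K w ∈ rationalFunctions K := by
  unfold cauchyKernel₀
  split_ifs with h
  · exact Subalgebra.zero_mem _
  · exact cauchyKernel_mem w h

lemma cauchyKernel₀_apply {w : ℂ} (hw : w ∉ K) (z : K) :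
    cauchyKernel₀ K w z = ((z : ℂ) - w)⁻¹ := by
  unfold cauchyKernel₀
  rw [dif_neg hw]; rfl

lemma le_norm_sub_of_notMem_thickening {δ : ℝ} {w : ℂ} (hw : w ∉ thickening δ K) (z : K) :
    δ ≤ ‖(z : ℂ) - w‖ := by
  by_contra h
  push Not at h
  refine hw (mem_thickening_iff.2 ⟨z, z.2, ?_⟩)
  rwa [dist_comm, dist_eq_norm]

variable [CompactSpace K]

lemma continuousOn_cauchyKernel₀ {δ : ℝ} (hδ : 0 < δ) :
    ContinuousOn (cauchyKernel₀ K) (thickening δ K)ᶜ := by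
  have hlip : ∀ w ∈ (thickening δ K)ᶜ, ∀ w' ∈ (thickening δ K)ᶜ,
      dist (cauchyKernel₀ K w) (cauchyKernel₀ K w') ≤ δ⁻¹ * δ⁻¹ * dist w w' := by
    intro w hw w' hw'
    have hwK : w ∉ K := fun h => hw (self_subset_thickening hδ K h)
    have hwK' : w' ∉ K := fun h => hw' (self_subset_thickening hδ K h)
    rw [ContinuousMap.dist_le (by positivity)]
    intro z
    rw [cauchyKernel₀_apply hwK, cauchyKernel₀_apply hwK']
    have h1 := le_norm_sub_of_notMem_thickening hw z
    have h2 := le_norm_sub_of_notMem_thickening hw' z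
    have n1 : (z : ℂ) - w ≠ 0 := norm_pos_iff.1 (by linarith)
    have n2 : (z : ℂ) - w' ≠ 0 := norm_pos_iff.1 (by linarith)
    rw [dist_eq_norm, inv_sub_inv n1 n2, norm_div, norm_mul, dist_eq_norm,
      show (z : ℂ) - w' - (z - w) = w - w' by ring, div_eq_mul_inv, mul_comm, mul_inv]
    gcongr
  have : LipschitzOnWith (Real.toNNReal (δ⁻¹ * δ⁻¹)) (cauchyKernel₀ K) (thickening δ K)ᶜ := by
    refine LipschitzOnWith.of_dist_le_mul fun w hw w' hw' => ?_
    rw [Real.coe_toNNReal _ (by positivity)]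
    exact hlip w hw w' hw'
  exact this.continuousOn

lemma norm_cauchyKernel₀_le {δ : ℝ} (hδ : 0 < δ) {w : ℂ} (hw : w ∉ thickening δ K) :
    ‖cauchyKernel₀ K w‖ ≤ δ⁻¹ := by
  rw [ContinuousMap.norm_le _ (by positivity)]
  intro z
  rw [cauchyKernel₀_apply (fun h => hw (self_subset_thickening hδ K h)), norm_inv]
  exact inv_anti₀ hδ (le_norm_sub_of_notMem_thickening hw z)

open MeasureTheory in
lemma integral_mem_of_isClosed {E : Type*} [NormedAddCommGroup E] [NormedSpace ℂ E]
    [CompleteSpace E] (S : Submodule ℂ E) (hS : IsClosed (S : Set E)) {α : Type*}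
    [MeasurableSpace α] {μ : Measure α} {f : α → E} (hf : Integrable f μ) (h : ∀ x, f x ∈ S) :
    ∫ x, f x ∂μ ∈ S := by
  have : IsClosed (S : Set E) := hS
  have h1 := ContinuousLinearMap.integral_comp_comm S.mkQL hf
  have h2 : ∀ x, S.mkQL (f x) = 0 := fun x => by
    rw [Submodule.mkQL_apply]; exact (Submodule.Quotient.mk_eq_zero S).2 (h x)
  simp only [h2, integral_zero] at h1
  rw [Submodule.mkQL_apply] at h1
  exact (Submodule.Quotient.mk_eq_zero S).1 h1.symm

open MeasureTheory Real in
lemma conj_mem_closure (h0 : volume K = 0) :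
    star (ContinuousMap.restrict K (.id ℂ)) ∈ (rationalFunctions K).topologicalClosure := by
  have hK : IsCompact K := isCompact_iff_compactSpace.2 inferInstance
  obtain ⟨R, hR⟩ := hK.isBounded.subset_ball 0
  suffices h : (π : ℂ) • star (ContinuousMap.restrict K (.id ℂ))
      ∈ (rationalFunctions K).topologicalClosure by
    have := Subalgebra.smul_mem _ h (π : ℂ)⁻¹
    rwa [smul_smul, inv_mul_cancel₀ (by exact_mod_cast pi_ne_zero), one_smul] at this
  rw [← SetLike.mem_coe]
  refine (Subalgebra.isClosed_topologicalClosure _).closure_subset_iff.2 subset_rfl ?_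
  rw [Metric.mem_closure_iff]
  intro ε hε
  set r : ℝ := ε / (8 * π)
  have hr : 0 < r := by positivity
  have hlim := tendsto_measure_thickening_of_isClosed (μ := (volume : Measure ℂ)) (s := K)
    ⟨1, one_pos, (hK.isBounded.thickening).measure_lt_top.ne⟩ hK.isClosed
  rw [h0] at hlim
  have hev := hlim.eventually (gt_mem_nhds (show (0 : ENNReal) < ENNReal.ofReal (r * (ε / 4)) by
    rw [ENNReal.ofReal_pos]; positivity))
  obtain ⟨δ, hδ1, hδ⟩ := (hev.and self_mem_nhdsWithin).exists
  have hδ : 0 < δ := hδ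
  set T := thickening δ K
  have hTm : MeasurableSet T := isOpen_thickening.measurableSet
  set E := ball (0 : ℂ) R \ T
  have hEm : MeasurableSet E := measurableSet_ball.diff hTm
  have hEfin : volume E < ⊤ := (measure_mono sdiff_subset).trans_lt measure_ball_lt_top
  have hfint : IntegrableOn (cauchyKernel₀ K) E := by
    have : IsFiniteMeasure (volume.restrict E) := ⟨by simpa using hEfin⟩
    have hcont : ContinuousOn (cauchyKernel₀ K) E :=
      (continuousOn_cauchyKernel₀ hδ).mono fun w hw => hw.2
    refine Integrable.of_bound (hcont.aestronglyMeasurable hEm) δ⁻¹ ?_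
    filter_upwards [ae_restrict_mem hEm] with w hw
    exact norm_cauchyKernel₀_le hδ hw.2
  refine ⟨∫ w in E, cauchyKernel₀ K w, ?_, ?_⟩
  · exact integral_mem_of_isClosed
      (Subalgebra.toSubmodule (rationalFunctions K).topologicalClosure)
      (Subalgebra.isClosed_topologicalClosure _) hfint
      fun w => Subalgebra.le_topologicalClosure _ (cauchyKernel₀_mem w)
  · refine lt_of_le_of_lt ?_ (half_lt_self hε)
    rw [ContinuousMap.dist_le (by positivity)]
    intro z
    have hzR : ‖(z : ℂ)‖ < R := by simpa using hR z.2
    have h1 : (∫ w in E, cauchyKernel₀ K w) z = ∫ w in E, ((z : ℂ) - w)⁻¹ := by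
      rw [ContinuousMap.integral_apply hfint]
      refine setIntegral_congr_fun hEm fun w hw => ?_
      exact cauchyKernel₀_apply (fun h => hw.2 (self_subset_thickening hδ K h)) z
    have h2 : ((π : ℂ) • star (ContinuousMap.restrict K (.id ℂ))) z
        = ∫ w in ball (0 : ℂ) R, ((z : ℂ) - w)⁻¹ := by
      rw [integral_inv_sub_ball hzR]; rfl
    have hbint := integrableOn_inv_sub (measurableSet_ball (x := (0 : ℂ)) (ε := R))
      measure_ball_lt_top.ne z
    have h3 := setIntegral_union (disjoint_sdiff_left.mono_right inter_subset_right :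
      Disjoint E (ball (0 : ℂ) R ∩ T)) (measurableSet_ball.inter hTm)
      (hbint.mono_set sdiff_subset) (hbint.mono_set inter_subset_left)
    rw [sdiff_union_inter] at h3
    rw [h1, h2, h3, dist_eq_norm, add_sub_cancel_left]
    have h4 : ENNReal.ofReal ‖∫ w in ball (0 : ℂ) R ∩ T, ((z : ℂ) - w)⁻¹‖
        ≤ ENNReal.ofReal (ε / 2) := by
      rw [ofReal_norm]
      refine (enorm_integral_le_lintegral_enorm _).trans ?_
      refine (lintegral_inv_norm_le (measurableSet_ball.inter hTm) z hr).trans ?_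
      calc _ ≤ ENNReal.ofReal (2 * π * r)
            + ENNReal.ofReal r⁻¹ * ENNReal.ofReal (r * (ε / 4)) := by
            gcongr
            exact (measure_mono inter_subset_right).trans hδ1.le
        _ = _ := by
            rw [← ENNReal.ofReal_mul (by positivity),
              ← ENNReal.ofReal_add (by positivity) (by positivity)]
            congr 1
            have : r * π = ε / 8 := by simp only [r]; field_simp
            field_simp
            linarith
    exact (ENNReal.ofReal_le_ofReal_iff (by positivity)).1 h4

/-- **Hartogs–Rosenthal**: rational functions are dense on compact sets of measure zero. -/
theorem mem_closure_rationalFunctions (h0 : MeasureTheory.volume K = 0) (f : C(K, ℂ)) :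
    f ∈ (rationalFunctions K).topologicalClosure := by
  induction f using ContinuousMap.induction_on_of_compact with
  | const r => exact Subalgebra.algebraMap_mem _ r
  | id =>
    exact Subalgebra.le_topologicalClosure _ ⟨Polynomial.X, 1, fun z => by simp⟩
  | star_id => exact conj_mem_closure h0
  | add f g hf hg => exact Subalgebra.add_mem _ hf hg
  | mul f g hf hg => exact Subalgebra.mul_mem _ hf hg
  | frequently f hf =>
    exact (Subalgebra.isClosed_topologicalClosure _).closure_subset_iff.2 subset_rfl
      (mem_closure_iff_frequently.2 hf)

/-- A function on `K` has a continuous logarithm. -/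
def HasLog (g : K → ℂ) : Prop := ∃ l : K → ℂ, Continuous l ∧ ∀ z, Complex.exp (l z) = g z

lemma HasLog.mul {g h : K → ℂ} : HasLog g → HasLog h → HasLog (fun z => g z * h z) := by
  rintro ⟨l, hl, hl'⟩ ⟨m, hm, hm'⟩
  exact ⟨fun z => l z + m z, hl.add hm, fun z => by rw [Complex.exp_add, hl', hm']⟩

lemma HasLog.inv {g : K → ℂ} : HasLog g → HasLog (fun z => (g z)⁻¹) := by
  rintro ⟨l, hl, hl'⟩
  exact ⟨fun z => - l z, hl.neg, fun z => by rw [Complex.exp_neg, hl']⟩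

lemma hasLog_const {c : ℂ} (hc : c ≠ 0) : HasLog (fun _ : K => c) :=
  ⟨fun _ => Complex.log c, continuous_const, fun _ => Complex.exp_log hc⟩

lemma hasLog_of_near_one {g : K → ℂ} (hg : Continuous g) (h : ∀ z, ‖g z - 1‖ < 1) :
    HasLog g := by
  have hs : ∀ z, g z ∈ Complex.slitPlane := fun z => by
    apply Complex.ball_one_subset_slitPlane
    rw [mem_ball, dist_eq_norm]; exact h z
  exact ⟨fun z => Complex.log (g z), hg.clog hs,
    fun z => Complex.exp_log (Complex.slitPlane_ne_zero (hs z))⟩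

lemma HasLog.perturb {g h : K → ℂ} (hl : HasLog h) (hg : Continuous g) (hh : Continuous h)
    (hh0 : ∀ z, h z ≠ 0) (hgh : ∀ z, ‖g z - h z‖ < ‖h z‖) : HasLog g := by
  have h1 : HasLog (fun z => g z / h z) := by
    refine hasLog_of_near_one (hg.div hh hh0) fun z => ?_
    rw [div_sub_one (hh0 z), norm_div, div_lt_one (norm_pos_iff.2 (hh0 z))]
    exact hgh z
  obtain ⟨l, hl1, hl2⟩ := h1.mul hl
  exact ⟨l, hl1, fun z => by rw [hl2]; exact div_mul_cancel₀ _ (hh0 z)⟩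

lemma hasLog_sub_const (hc : IsPreconnected Kᶜ) {b : ℂ} (hb : b ∉ K) :
    HasLog (fun z : K => (z : ℂ) - b) := by
  have hK : IsCompact K := isCompact_iff_compactSpace.2 inferInstance
  set A : Set ℂ := {b | b ∉ K ∧ HasLog (fun z : K => (z : ℂ) - b)}
  have hne : ∀ b, b ∉ K → ∀ z : K, (z : ℂ) - b ≠ 0 := by
    intro b hb z h
    rw [sub_eq_zero] at h
    exact hb (h ▸ z.2)
  have step : ∀ b b' : ℂ, b ∉ K → b' ∉ K → (∀ z : K, ‖b - b'‖ < ‖(z : ℂ) - b‖) → b ∈ A →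
      b' ∈ A := by
    intro b b' hb hb' h hA
    refine ⟨hb', hA.2.perturb (by fun_prop) (by fun_prop) (hne b hb) fun z => ?_⟩
    rw [show (z : ℂ) - b' - (z - b) = b - b' by ring]
    exact h z
  have hfar : ∀ b, b ∉ K → ∃ δ > 0, ∀ z : K, δ ≤ ‖(z : ℂ) - b‖ := by
    intro b hb
    obtain ⟨δ, hδ, h⟩ := Metric.isOpen_iff.1 hK.isClosed.isOpen_compl b hb
    refine ⟨δ, hδ, fun z => ?_⟩
    by_contra hlt
    push Not at hlt
    exact h (show (z : ℂ) ∈ ball b δ by rwa [mem_ball, dist_eq_norm]) z.2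
  have hAo : IsOpen A := by
    rw [Metric.isOpen_iff]
    intro b hb
    obtain ⟨δ, hδ, h⟩ := hfar b hb.1
    refine ⟨δ, hδ, fun b' hb' => ?_⟩
    rw [mem_ball, dist_eq_norm] at hb'
    refine step b b' hb.1 ?_ (fun z => ?_) hb
    · intro hK'
      have := h ⟨b', hK'⟩
      simp only at this
      linarith
    · rw [norm_sub_rev]; exact hb'.trans_le (h z)
  have hBo : IsOpen (Kᶜ \ A) := by
    rw [Metric.isOpen_iff]
    intro b hb
    obtain ⟨δ, hδ, h⟩ := hfar b hb.1
    refine ⟨δ / 2, by positivity, fun b' hb' => ?_⟩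
    rw [mem_ball, dist_eq_norm] at hb'
    have hfar' : ∀ z : K, δ / 2 ≤ ‖(z : ℂ) - b'‖ := fun z => by
      have h1 := h z
      have h2 : ‖(z : ℂ) - b‖ ≤ ‖(z : ℂ) - b'‖ + ‖b' - b‖ := norm_sub_le_norm_sub_add_norm_sub ..
      linarith
    have hb'K : b' ∉ K := fun hK' => by
      have := hfar' ⟨b', hK'⟩
      simp only [sub_self, norm_zero] at this
      linarith
    exact ⟨hb'K, fun hA => hb.2 (step b' b hb'K hb.1 (fun z => hb'.trans_le (hfar' z)) hA)⟩
  have hAne : ∃ b, b ∈ A := by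
    obtain ⟨R, hR⟩ := hK.isBounded.subset_ball 0
    set b : ℂ := ((|R| + 1 : ℝ) : ℂ)
    have hbn : ‖b‖ = |R| + 1 := by
      rw [Complex.norm_real, Real.norm_eq_abs, abs_of_pos (by positivity)]
    have hzb : ∀ z : K, ‖(z : ℂ)‖ < ‖b‖ := fun z => by
      have : ‖(z : ℂ)‖ < R := by simpa using hR z.2
      rw [hbn]; linarith [le_abs_self R]
    have hb0 : b ≠ 0 := norm_pos_iff.1 (by rw [hbn]; positivity)
    refine ⟨b, fun hbK => lt_irrefl _ (hzb ⟨b, hbK⟩), ?_⟩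
    refine (hasLog_const (neg_ne_zero.2 hb0)).perturb (by fun_prop) (by fun_prop)
      (fun _ => neg_ne_zero.2 hb0) fun z => ?_
    rw [sub_neg_eq_add, sub_add_cancel, norm_neg]
    exact hzb z
  by_contra hcon
  obtain ⟨x, hx, hx2⟩ := hc A (Kᶜ \ A) hAo hBo
    (fun x hx => by by_cases h : x ∈ A <;> [exact Or.inl h; exact Or.inr ⟨hx, h⟩])
    (by obtain ⟨a, ha⟩ := hAne; exact ⟨a, ha.1, ha⟩) ⟨b, hb, hb, fun h => hcon h.2⟩
  exact hx2.2.2 hx2.1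

lemma hasLog_polynomial (hc : IsPreconnected Kᶜ) (P : Polynomial ℂ) (hP0 : P ≠ 0)
    (hP : ∀ z : K, P.eval (z : ℂ) ≠ 0) : HasLog (fun z : K => P.eval (z : ℂ)) := by
  have hs := IsAlgClosed.splits P
  have hroot : ∀ b ∈ P.roots, b ∉ K := fun b hb hbK =>
    hP ⟨b, hbK⟩ ((Polynomial.mem_roots hP0).1 hb)
  have hprod : ∀ s : Multiset ℂ, (∀ b ∈ s, b ∉ K) →
      HasLog (fun z : K => (s.map fun b => (z : ℂ) - b).prod) := by
    intro s
    induction s using Multiset.induction with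
    | empty => intro _; simpa using hasLog_const (K := K) one_ne_zero
    | cons b s ih =>
      intro hb
      simp only [Multiset.map_cons, Multiset.prod_cons]
      exact (hasLog_sub_const hc (hb b (Multiset.mem_cons_self b s))).mul
        (ih fun c hcs => hb c (Multiset.mem_cons_of_mem hcs))
  obtain ⟨l, hl, hl'⟩ := (hasLog_const (K := K) (Polynomial.leadingCoeff_ne_zero.2 hP0)).mul
    (hprod P.roots hroot)
  refine ⟨l, hl, fun z => ?_⟩
  rw [hl']; exact (hs.eval_eq_prod_roots _).symm

/-- On a compact plane set of measure zero with connected complement, every nowhere vanishing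
continuous function has a continuous logarithm. -/
theorem hasLog_of_isPreconnected_compl (h0 : MeasureTheory.volume K = 0)
    (hc : IsPreconnected Kᶜ) (g : C(K, ℂ)) (hg : ∀ z, g z ≠ 0) : HasLog g := by
  rcases isEmpty_or_nonempty K with hK | hK
  · exact ⟨fun _ => 0, continuous_const, fun z => hK.elim z⟩
  obtain ⟨x, -, hx⟩ := isCompact_univ.exists_isMinOn univ_nonempty
    (f := fun z : K => ‖g z‖) (by fun_prop)
  set m := ‖g x‖
  have hm : 0 < m := norm_pos_iff.2 (hg x)
  have hmin : ∀ z, m ≤ ‖g z‖ := fun z => hx (mem_univ z)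
  have hcl := mem_closure_rationalFunctions h0 g
  rw [← SetLike.mem_coe, Subalgebra.topologicalClosure_coe, Metric.mem_closure_iff] at hcl
  obtain ⟨r, ⟨P, Q, hPQ⟩, hr⟩ := hcl (m / 2) (by positivity)
  have hgr : ∀ z, ‖g z - r z‖ < m / 2 := fun z => by
    rw [← dist_eq_norm]; exact (ContinuousMap.dist_apply_le_dist z).trans_lt hr
  have hrm : ∀ z, m / 2 < ‖r z‖ := fun z => by
    have := hmin z
    have h1 := hgr z
    have h2 : ‖g z‖ ≤ ‖g z - r z‖ + ‖r z‖ := by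
      simpa using norm_add_le (g z - r z) (r z)
    linarith
  have hr0 : ∀ z, r z ≠ 0 := fun z => norm_pos_iff.1 (by linarith [hrm z])
  have hP : ∀ z : K, P.eval (z : ℂ) ≠ 0 := fun z h => by
    apply hr0 z; rw [(hPQ z).2, h, zero_div]
  have hP0 : P ≠ 0 := by
    rintro rfl
    obtain ⟨z⟩ := hK
    exact hP z (by simp)
  have hQ0 : Q ≠ 0 := by
    rintro rfl
    obtain ⟨z⟩ := hK
    exact (hPQ z).1 (by simp)
  have hlog : HasLog r := by
    obtain ⟨l, hl, hl'⟩ := (hasLog_polynomial hc P hP0 hP).mul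
      (hasLog_polynomial hc Q hQ0 fun z => (hPQ z).1).inv
    exact ⟨l, hl, fun z => by rw [hl', (hPQ z).2, div_eq_mul_inv]⟩
  exact hlog.perturb g.continuous r.continuous hr0 fun z => (hgr z).trans (hrm z)

end

noncomputable section

/-- Two points lie in a common preconnected subset of `X`. -/
def Link (X : Set ℂ) (a b : ℂ) : Prop := ∃ t ⊆ X, a ∈ t ∧ b ∈ t ∧ IsPreconnected t

lemma Link.symm {X : Set ℂ} {a b : ℂ} (h : Link X a b) : Link X b a := by
  obtain ⟨t, h1, h2, h3, h4⟩ := h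
  exact ⟨t, h1, h3, h2, h4⟩

lemma Link.trans {X : Set ℂ} {a b c : ℂ} (h : Link X a b) (h' : Link X b c) : Link X a c := by
  obtain ⟨t, h1, h2, h3, h4⟩ := h
  obtain ⟨s, k1, k2, k3, k4⟩ := h'
  exact ⟨t ∪ s, union_subset h1 k1, Or.inl h2, Or.inr k3, h4.union b h3 k2 k4⟩

lemma Link.mono {X Y : Set ℂ} {a b : ℂ} (h : Link X a b) (hXY : X ⊆ Y) : Link Y a b := by
  obtain ⟨t, h1, h2⟩ := h
  exact ⟨t, h1.trans hXY, h2⟩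

lemma Link.image {X Y : Set ℂ} {a b : ℂ} {g : ℂ → ℂ} (h : Link X a b) (hg : Continuous g)
    (hXY : MapsTo g X Y) : Link Y (g a) (g b) := by
  obtain ⟨t, h1, h2, h3, h4⟩ := h
  exact ⟨g '' t, by rintro _ ⟨x, hx, rfl⟩; exact hXY (h1 hx), mem_image_of_mem g h2,
    mem_image_of_mem g h3, h4.image g hg.continuousOn⟩

lemma Link.of_preconnected {X : Set ℂ} (h : IsPreconnected X) {a b : ℂ} (ha : a ∈ X)
    (hb : b ∈ X) : Link X a b := ⟨X, Subset.rfl, ha, hb, h⟩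

lemma isPreconnected_of_link {X : Set ℂ} {x : ℂ} (h : ∀ y ∈ X, Link X x y) : IsPreconnected X := by
  refine isPreconnected_of_forall x fun y hy => ?_
  obtain ⟨t, h1, h2, h3, h4⟩ := h y hy
  exact ⟨t, h1, h2, h3, h4⟩

lemma Link.horizontal {X : Set ℂ} {a b : ℂ} (him : a.im = b.im)
    (h : ∀ z : ℂ, z.im = a.im → z.re ∈ uIcc a.re b.re → z ∈ X) : Link X a b := by
  refine ⟨{z | z.im = a.im ∧ z.re ∈ uIcc a.re b.re}, fun z hz => h z hz.1 hz.2,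
    ⟨rfl, left_mem_uIcc⟩, ⟨him.symm, right_mem_uIcc⟩, Convex.isPreconnected ?_⟩
  have h1 : Convex ℝ {z : ℂ | z.im = a.im} := by
    have := (convex_singleton (𝕜 := ℝ) a.im).is_linear_preimage Complex.imLm.isLinear
    simpa [preimage] using this
  exact h1.inter ((convex_uIcc a.re b.re).is_linear_preimage Complex.reLm.isLinear)

lemma Link.vertical {X : Set ℂ} {a b : ℂ} (hre : a.re = b.re)
    (h : ∀ z : ℂ, z.re = a.re → z.im ∈ uIcc a.im b.im → z ∈ X) : Link X a b := by
  refine ⟨{z | z.re = a.re ∧ z.im ∈ uIcc a.im b.im}, fun z hz => h z hz.1 hz.2,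
    ⟨rfl, left_mem_uIcc⟩, ⟨hre.symm, right_mem_uIcc⟩, Convex.isPreconnected ?_⟩
  have h1 : Convex ℝ {z : ℂ | z.re = a.re} := by
    have := (convex_singleton (𝕜 := ℝ) a.re).is_linear_preimage Complex.reLm.isLinear
    simpa [preimage] using this
  exact h1.inter ((convex_uIcc a.im b.im).is_linear_preimage Complex.imLm.isLinear)

variable {p : ℕ} 

/-- The lines of the first subdivision. -/
def grid (p : ℕ) : Set ℂ :=
  {z | (∃ k : ℤ, p * z.re = k) ∨ ∃ k : ℤ, p * z.im = k}

variable [hp : OddBase p]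

lemma int_not_mem_Ioo {x : ℝ} {m : ℕ} (h : ∃ k : ℤ, x = k) : x ∉ Ioo (m : ℝ) (m + 1) := by
  obtain ⟨k, rfl⟩ := h
  rintro ⟨h1, h2⟩
  have h1' : (m : ℤ) < k := by exact_mod_cast h1
  have h2' : k < (m : ℤ) + 1 := by exact_mod_cast h2
  omega

lemma grid_not_openCell (d : Digit p) {y : ℂ} (hy : y ∈ openSq) : cellMap d y ∉ grid p := by
  have h0 := base_pos (p := p)
  rintro (h | h)
  · refine int_not_mem_Ioo (m := d.1.1) h ?_
    rw [cellMap_re, mul_div_cancel₀ _ h0.ne']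
    exact ⟨by linarith [hy.1.1], by linarith [hy.1.2]⟩
  · refine int_not_mem_Ioo (m := d.1.2) h ?_
    rw [cellMap_im, mul_div_cancel₀ _ h0.ne']
    exact ⟨by linarith [hy.2.1], by linarith [hy.2.2]⟩

lemma grid_not_openMid {z : ℂ} (hz : z ∈ grid p) : z ∉ openMid p := by
  rintro ⟨h1, h2⟩
  rcases hz with h | h
  · exact int_not_mem_Ioo h h1
  · exact int_not_mem_Ioo h h2

lemma grid_mem_carpet {z : ℂ} (hz : z ∈ unitSq) (hg : z ∈ grid p) : z ∈ sierpinskiCarpet p := by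
  refine mem_carpet_of hz fun w hw => ?_
  cases w with
  | nil =>
    obtain ⟨y, hy, rfl⟩ := hw
    exact grid_not_openMid hg hy
  | cons d w =>
    rw [hole_cons] at hw
    obtain ⟨y, hy, rfl⟩ := hw
    exact grid_not_openCell d (hole_subset_openSq w hy) hg

/-- A crossing of grid lines. -/
def crossing (p : ℕ) : ℂ := ⟨1 / p, 1 / p⟩

lemma inv_base_mem : (1 / p : ℝ) ∈ Ioo (0 : ℝ) 1 := by
  have h0 := three_le_cast (p := p)
  exact ⟨by positivity, by rw [div_lt_one (by linarith)]; linarith⟩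

lemma base_mul_inv : (p : ℝ) * (1 / p) = ((1 : ℤ) : ℝ) := by
  have h0 := base_pos (p := p)
  field_simp; simp

lemma mem_uIcc_Ioo {a b x l u : ℝ} (ha : a ∈ Ioo l u) (hb : b ∈ Ioo l u) (hx : x ∈ uIcc a b) :
    x ∈ Ioo l u := by
  rcases le_total a b with h | h
  · rw [uIcc_of_le h] at hx; exact ⟨ha.1.trans_le hx.1, hx.2.trans_lt hb.2⟩
  · rw [uIcc_of_ge h] at hx; exact ⟨hb.1.trans_le hx.1, hx.2.trans_lt ha.2⟩

lemma mem_uIcc_Icc {a b x l u : ℝ} (ha : a ∈ Icc l u) (hb : b ∈ Icc l u) (hx : x ∈ uIcc a b) :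
    x ∈ Icc l u := uIcc_subset_Icc ha hb hx

lemma link_openGrid {z : ℂ} (hz : z ∈ openSq) (hg : z ∈ grid p) :
    Link (openSq ∩ grid p) z (crossing p) := by
  have h1 := inv_base_mem (p := p)
  rcases hg with h | h
  · refine Link.trans (b := ⟨z.re, 1 / p⟩) ?_ ?_
    · refine Link.vertical rfl fun y hy hy' => ⟨⟨?_, mem_uIcc_Ioo hz.2 h1 hy'⟩, Or.inl ?_⟩
      · rw [hy]; exact hz.1
      · rw [hy]; exact h
    · refine Link.horizontal rfl fun y hy hy' => ⟨⟨mem_uIcc_Ioo hz.1 h1 hy', ?_⟩, Or.inr ⟨1, ?_⟩⟩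
      · rw [hy]; exact h1
      · rw [hy]; exact base_mul_inv
  · refine Link.trans (b := ⟨1 / p, z.im⟩) ?_ ?_
    · refine Link.horizontal rfl fun y hy hy' => ⟨⟨mem_uIcc_Ioo hz.1 h1 hy', ?_⟩, Or.inr ?_⟩
      · rw [hy]; exact hz.2
      · rw [hy]; exact h
    · refine Link.vertical rfl fun y hy hy' => ⟨⟨?_, mem_uIcc_Ioo hz.2 h1 hy'⟩, Or.inl ⟨1, ?_⟩⟩
      · rw [hy]; exact h1
      · rw [hy]; exact base_mul_inv

lemma crossing_mem_openSq : crossing p ∈ openSq := ⟨inv_base_mem, inv_base_mem⟩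

lemma cellMap_mem_openSq (d : Digit p) {z : ℂ} (hz : z ∈ openSq) : cellMap d z ∈ openSq :=
  wordMap_mem_openSq [d] hz

lemma cellMap_mem_carpet (d : Digit p) {z : ℂ} (hz : z ∈ sierpinskiCarpet p) :
    cellMap d z ∈ sierpinskiCarpet p := wordMap_mem_carpet [d] hz

lemma continuous_cellMap (d : Digit p) : Continuous (cellMap d) := continuous_wordMap [d]

lemma link_cell_crossing (d : Digit p) :
    Link (openSq ∩ sierpinskiCarpet p) (cellMap d (crossing p)) (crossing p) := by
  have h0 := three_le_cast (p := p)
  have h1 := inv_base_mem (p := p)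
  have hd : (d.1.1 : ℝ) + 1 ≤ p := by exact_mod_cast d.2.1
  have hd' : (d.1.2 : ℝ) + 1 ≤ p := by exact_mod_cast d.2.2.1
  have hd0 : (0 : ℝ) ≤ d.1.1 := by positivity
  have hd0' : (0 : ℝ) ≤ d.1.2 := by positivity
  obtain ⟨e, he, he'⟩ : ∃ e : ℕ, e ≤ 1 ∧ (d.1.1 + e : ℝ) ∈ Ioo (0 : ℝ) p := by
    rcases Nat.eq_zero_or_pos d.1.1 with h | h
    · exact ⟨1, le_rfl, by rw [h]; constructor <;> push_cast <;> linarith⟩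
    · have : (1 : ℝ) ≤ d.1.1 := by exact_mod_cast h
      exact ⟨0, by simp, by push_cast; linarith, by push_cast; linarith⟩
  have heI : (e : ℝ) ∈ Icc (0 : ℝ) 1 := ⟨by positivity, by exact_mod_cast he⟩
  have key : Link (openSq ∩ sierpinskiCarpet p) (cellMap d (crossing p))
      (cellMap d ⟨e, 1 / p⟩) := by
    have hline : ∀ y : ℂ, y.im = 1 / p → y.re ∈ uIcc (1 / p : ℝ) e → y ∈ sierpinskiCarpet p :=
      fun y hy hy' => grid_mem_carpet ⟨mem_uIcc_Icc (Ioo_subset_Icc_self h1) heI hy',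
        by rw [hy]; exact Ioo_subset_Icc_self h1⟩ (Or.inr ⟨1, by rw [hy]; exact base_mul_inv⟩)
    have hl : Link {y : ℂ | y.im = 1 / p ∧ y.re ∈ uIcc (1 / p : ℝ) e} (crossing p) ⟨e, 1 / p⟩ :=
      Link.horizontal rfl fun z hz hz' => ⟨hz, hz'⟩
    refine hl.image (continuous_cellMap d) fun y hy => ⟨⟨?_, ?_⟩,
      cellMap_mem_carpet d (hline y hy.1 hy.2)⟩
    · rw [cellMap_re]
      have hmem : (d.1.1 + y.re : ℝ) ∈ Ioo (0 : ℝ) p := by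
        have hI : (d.1.1 + 1 / p : ℝ) ∈ Ioo (0 : ℝ) p :=
          ⟨by linarith [h1.1], by linarith [h1.2]⟩
        refine mem_uIcc_Ioo hI he' ?_
        rcases le_total (1 / p : ℝ) e with h | h
        · rw [uIcc_of_le h] at hy
          rw [uIcc_of_le (by linarith)]
          exact ⟨by linarith [hy.2.1], by linarith [hy.2.2]⟩
        · rw [uIcc_of_ge h] at hy
          rw [uIcc_of_ge (by linarith)]
          exact ⟨by linarith [hy.2.1], by linarith [hy.2.2]⟩
      exact ⟨div_pos hmem.1 (by linarith), (div_lt_one (by linarith)).2 hmem.2⟩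
    · rw [cellMap_im, hy.1]
      exact ⟨div_pos (by linarith [h1.1]) (by linarith),
        (div_lt_one (by linarith)).2 (by linarith [h1.2])⟩
  refine key.trans ((link_openGrid ?_ ?_).mono fun z hz => ⟨hz.1,
    grid_mem_carpet (openSq_subset hz.1) hz.2⟩)
  · refine ⟨?_, ?_⟩
    · rw [cellMap_re]; exact ⟨div_pos he'.1 (by linarith), (div_lt_one (by linarith)).2 he'.2⟩
    · rw [cellMap_im]
      exact ⟨div_pos (by linarith [h1.1]) (by linarith),
        (div_lt_one (by linarith)).2 (by simp only; linarith [h1.2])⟩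
  · refine Or.inl ⟨d.1.1 + e, ?_⟩
    rw [cellMap_re, mul_div_cancel₀ _ (by linarith)]
    push_cast; ring

lemma link_word_crossing (w : Word p) :
    Link (openSq ∩ sierpinskiCarpet p) (wordMap w (crossing p)) (crossing p) := by
  induction w with
  | nil =>
    exact (link_openGrid (p := p) crossing_mem_openSq (Or.inl ⟨1,
      base_mul_inv⟩)).mono fun z hz => ⟨hz.1, grid_mem_carpet (openSq_subset hz.1) hz.2⟩
  | cons d w ih =>
    refine (ih.image (continuous_cellMap d) fun z hz => ?_).trans (link_cell_crossing d)
    exact ⟨cellMap_mem_openSq d hz.1, cellMap_mem_carpet d hz.2⟩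

lemma dist_le_add (a b : ℂ) : dist a b ≤ |a.re - b.re| + |a.im - b.im| := by
  rw [Complex.dist_eq]
  simpa using Complex.norm_le_abs_re_add_abs_im (a - b)

lemma dist_wordMap_le (w : Word p) {x y : ℂ} (hx : x ∈ unitSq) (hy : y ∈ unitSq) :
    dist (wordMap w x) (wordMap w y) ≤ 2 * (1 / p : ℝ) ^ w.length := by
  have h0 := pow_base_pos (p := p) w.length
  refine (dist_le_add _ _).trans ?_
  rw [wordMap_re, wordMap_re, wordMap_im, wordMap_im, ← sub_div, ← sub_div, abs_div, abs_div,
    abs_of_pos h0, ← add_div, div_pow, one_pow, ← mul_div_assoc]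
  gcongr
  have h1 : |(cornerX w + x.re) - (cornerX w + y.re)| ≤ 1 := by
    rw [abs_le]; constructor <;> linarith [hx.1.1, hx.1.2, hy.1.1, hy.1.2]
  have h2 : |(cornerY w + x.im) - (cornerY w + y.im)| ≤ 1 := by
    rw [abs_le]; constructor <;> linarith [hx.2.1, hx.2.2, hy.2.1, hy.2.2]
  linarith

lemma exists_word_dist {z : ℂ} (hz : z ∈ sierpinskiCarpet p) {ε : ℝ} (hε : 0 < ε) :
    ∃ w : Word p, ∀ y ∈ unitSq, dist (wordMap w y) z < ε := by
  obtain ⟨n, hn⟩ := exists_pow_lt_of_lt_one (half_pos hε) (inv_base_mem (p := p)).2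
  obtain ⟨w, hw, x, hx, rfl⟩ := exists_word hz n
  refine ⟨w, fun y hy => (dist_wordMap_le w hy (carpet_subset_unitSq hx)).trans_lt ?_⟩
  rw [hw]; linarith

lemma isPreconnected_carpet_diff {E : Set ℂ} (hE : E ⊆ outerSquare) :
    IsPreconnected (sierpinskiCarpet p \ E) := by
  set T : Set ℂ := {z | Link (openSq ∩ sierpinskiCarpet p) z (crossing p)}
  have hT : T ⊆ openSq ∩ sierpinskiCarpet p := by
    rintro z ⟨t, h1, h2, -⟩; exact h1 h2
  have hTc : IsPreconnected T := by
    refine isPreconnected_of_link (x := crossing p) fun z hz => ?_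
    obtain ⟨t, h1, h2, h3, h4⟩ := hz
    exact ⟨t, fun y hy => ⟨t, h1, hy, h3, h4⟩, h3, h2, h4⟩
  refine hTc.subset_closure ?_ ?_
  · exact fun z hz => ⟨(hT hz).2, fun h => (mem_outer_iff.1 (hE h)).2 (hT hz).1⟩
  · intro z hz
    refine Metric.mem_closure_iff.2 fun ε hε => ?_
    obtain ⟨w, hw⟩ := exists_word_dist hz.1 hε
    refine ⟨wordMap w (crossing p), link_word_crossing w, ?_⟩
    rw [dist_comm]; exact hw _ (openSq_subset crossing_mem_openSq)

lemma isPreconnected_carpet : IsPreconnected (sierpinskiCarpet p) := by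
  simpa using isPreconnected_carpet_diff (p := p) (empty_subset _)

lemma zero_mem_unitSq : (0 : ℂ) ∈ unitSq := by simp [unitSq]

lemma zero_mem_outer : (0 : ℂ) ∈ outerSquare := mem_outer_iff.2 ⟨zero_mem_unitSq, by simp [openSq]⟩

lemma link_outer_zero {z : ℂ} (hz : z ∈ outerSquare) : Link outerSquare z 0 := by
  have hI0 : (0 : ℝ) ∈ Icc (0 : ℝ) 1 := by simp
  have hI1 : (1 : ℝ) ∈ Icc (0 : ℝ) 1 := by simp
  have hH : ∀ {a b : ℂ}, a ∈ unitSq → b ∈ unitSq → a.im = b.im → (a.im = 0 ∨ a.im = 1) →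
      Link outerSquare a b := fun ha hb hab h => Link.horizontal hab fun z h1 h2 =>
    mem_outer_iff.2 ⟨⟨mem_uIcc_Icc ha.1 hb.1 h2, by rw [h1]; exact ha.2⟩, fun ho => by
      have := ho.2; rw [h1] at this; rcases h with h | h <;> rw [h] at this <;> simp at this⟩
  have hV : ∀ {a b : ℂ}, a ∈ unitSq → b ∈ unitSq → a.re = b.re → (a.re = 0 ∨ a.re = 1) →
      Link outerSquare a b := fun ha hb hab h => Link.vertical hab fun z h1 h2 =>
    mem_outer_iff.2 ⟨⟨by rw [h1]; exact ha.1, mem_uIcc_Icc ha.2 hb.2 h2⟩, fun ho => by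
      have := ho.1; rw [h1] at this; rcases h with h | h <;> rw [h] at this <;> simp at this⟩
  have hzU := (mem_outer_iff.1 hz).1
  have hleft : ∀ y ∈ Icc (0 : ℝ) 1, Link outerSquare ⟨0, y⟩ 0 := fun y hy =>
    hV ⟨hI0, hy⟩ zero_mem_unitSq rfl (Or.inl rfl)
  have hcase : (z.re = 0 ∨ z.re = 1) ∨ (z.im = 0 ∨ z.im = 1) := by
    by_contra h
    push Not at h
    obtain ⟨⟨h1, h2⟩, h3, h4⟩ := h
    exact (mem_outer_iff.1 hz).2 ⟨⟨lt_of_le_of_ne hzU.1.1 (Ne.symm h1), lt_of_le_of_ne hzU.1.2 h2⟩,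
      lt_of_le_of_ne hzU.2.1 (Ne.symm h3), lt_of_le_of_ne hzU.2.2 h4⟩
  rcases hcase with h | h
  · refine (hV hzU (b := ⟨z.re, 0⟩) ⟨hzU.1, hI0⟩ rfl h).trans ?_
    exact hH ⟨hzU.1, hI0⟩ zero_mem_unitSq rfl (Or.inl rfl)
  · refine (hH hzU (b := ⟨0, z.im⟩) ⟨hI0, hzU.2⟩ rfl h).trans (hleft _ hzU.2)

lemma outer_disjoint_middle {z : ℂ} (hz : z ∈ outerSquare) : z ∉ middleSquare p := fun h =>
  (mem_outer_iff.1 hz).2 (solidMid_subset_openSq (middle_subset_solidMid h))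

/-- A grid point off the middle square slides along its grid line to the outer square. -/
lemma link_grid_outer {z : ℂ} (hz : z ∈ unitSq) (hg : z ∈ grid p) (hm : z ∉ middleSquare p) :
    Link (sierpinskiCarpet p \ middleSquare p) z 0 := by
  have hO : ∀ {b : ℂ}, b ∈ outerSquare → Link (sierpinskiCarpet p \ middleSquare p) b 0 := fun hb =>
    (link_outer_zero hb).mono fun y hy => ⟨outer_subset_carpet hy, outer_disjoint_middle hy⟩
  have hI0 : (0 : ℝ) ∈ Icc (0 : ℝ) 1 := by simp
  have hI1 : (1 : ℝ) ∈ Icc (0 : ℝ) 1 := by simp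
  have hc := cast_base (p := p)
  have h0 := base_pos (p := p)
  have hb : ∀ x y : ℝ, x ∈ Icc (0 : ℝ) 1 → (y = 0 ∨ y = 1) → (⟨x, y⟩ : ℂ) ∈ outerSquare := by
    intro x y hx hy
    refine mem_outer_iff.2 ⟨⟨hx, ?_⟩, fun h => ?_⟩
    · rcases hy with rfl | rfl <;> simp
    · have := h.2; rcases hy with rfl | rfl <;> simp at this
  have hb' : ∀ x y : ℝ, y ∈ Icc (0 : ℝ) 1 → (x = 0 ∨ x = 1) → (⟨x, y⟩ : ℂ) ∈ outerSquare := by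
    intro x y hx hy
    refine mem_outer_iff.2 ⟨⟨?_, hx⟩, fun h => ?_⟩
    · rcases hy with rfl | rfl <;> simp
    · have := h.1; rcases hy with rfl | rfl <;> simp at this
  have aux : ∀ x : ℝ, x ∈ Icc (0 : ℝ) 1 → ∃ e : ℝ, (e = 0 ∨ e = 1) ∧ ∀ t ∈ uIcc x e,
      p * t ∈ Icc (mid p : ℝ) (mid p + 1) → p * x ∈ Icc (mid p : ℝ) (mid p + 1) := by
    intro x hx
    rcases le_total x (1 / 2) with h | h
    · refine ⟨0, Or.inl rfl, fun t ht ht' => ?_⟩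
      rw [uIcc_of_ge hx.1] at ht
      exact ⟨by nlinarith [ht.2, ht'.1], by nlinarith [one_le_mid_cast (p := p)]⟩
    · refine ⟨1, Or.inr rfl, fun t ht ht' => ?_⟩
      rw [uIcc_of_le hx.2] at ht
      exact ⟨by nlinarith [one_le_mid_cast (p := p)], by nlinarith [ht.1, ht'.2]⟩
  rcases hg with hg | hg
  · obtain ⟨e, he, he'⟩ := aux z.im hz.2
    refine Link.trans (b := ⟨z.re, e⟩) (Link.vertical rfl fun y h1 h2 => ⟨?_, fun hy => hm ?_⟩)
      (hO (hb _ _ hz.1 he))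
    · refine grid_mem_carpet ⟨by rw [h1]; exact hz.1, mem_uIcc_Icc hz.2 ?_ h2⟩
        (Or.inl (by rw [h1]; exact hg))
      rcases he with rfl | rfl <;> simp
    · have hy' := middle_subset_solidMid hy
      exact mem_middle_iff.2 ⟨⟨by rw [← h1]; exact hy'.1, he' _ h2 hy'.2⟩,
        grid_not_openMid (Or.inl hg)⟩
  · obtain ⟨e, he, he'⟩ := aux z.re hz.1
    refine Link.trans (b := ⟨e, z.im⟩) (Link.horizontal rfl fun y h1 h2 => ⟨?_, fun hy => hm ?_⟩)
      (hO (hb' _ _ hz.2 he))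
    · refine grid_mem_carpet ⟨mem_uIcc_Icc hz.1 ?_ h2, by rw [h1]; exact hz.2⟩
        (Or.inr (by rw [h1]; exact hg))
      rcases he with rfl | rfl <;> simp
    · have hy' := middle_subset_solidMid hy
      exact mem_middle_iff.2 ⟨⟨he' _ h2 hy'.1, by rw [← h1]; exact hy'.2⟩,
        grid_not_openMid (Or.inr hg)⟩

lemma link_grid_zero {z : ℂ} (hz : z ∈ unitSq) (hg : z ∈ grid p) : Link (unitSq ∩ grid p) z 0 := by
  have hI0 : (0 : ℝ) ∈ Icc (0 : ℝ) 1 := by simp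
  rcases hg with h | h
  · refine Link.trans (b := ⟨z.re, 0⟩) ?_ ?_
    · refine Link.vertical rfl fun y hy hy' => ⟨⟨?_, mem_uIcc_Icc hz.2 hI0 hy'⟩, Or.inl ?_⟩
      · rw [hy]; exact hz.1
      · rw [hy]; exact h
    · refine Link.horizontal rfl fun y hy hy' => ⟨⟨mem_uIcc_Icc hz.1 hI0 hy', ?_⟩, Or.inr ⟨0, ?_⟩⟩
      · rw [hy]; exact hI0
      · rw [hy]; simp
  · refine Link.trans (b := ⟨0, z.im⟩) ?_ ?_
    · refine Link.horizontal rfl fun y hy hy' => ⟨⟨mem_uIcc_Icc hz.1 hI0 hy', ?_⟩, Or.inr ?_⟩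
      · rw [hy]; exact hz.2
      · rw [hy]; exact h
    · refine Link.vertical rfl fun y hy hy' => ⟨⟨?_, mem_uIcc_Icc hz.2 hI0 hy'⟩, Or.inl ⟨0, ?_⟩⟩
      · rw [hy]; exact hI0
      · rw [hy]; simp

lemma cellMap_corner_mem_grid (d : Digit p) {y : ℂ} (h : y.re = 0 ∨ y.re = 1) :
    cellMap d y ∈ grid p := by
  have h0 := base_pos (p := p)
  refine Or.inl ?_
  rw [cellMap_re, mul_div_cancel₀ _ h0.ne']
  rcases h with h | h
  · exact ⟨d.1.1, by rw [h]; simp⟩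
  · exact ⟨d.1.1 + 1, by rw [h]; simp⟩

lemma exists_corner_not_middle (d : Digit p) : ∃ y ∈ outerSquare, cellMap d y ∈ grid p ∧
    cellMap d y ∉ middleSquare p := by
  have h0 := base_pos (p := p)
  have key : ∀ e : ℕ → ℕ, (∀ i, e i = 0 ∨ e i = 1) →
      (d.1.1 + e 0 < mid p ∨ mid p + 1 < d.1.1 + e 0 ∨ d.1.2 + e 1 < mid p ∨
        mid p + 1 < d.1.2 + e 1) → ∃ y ∈ outerSquare, cellMap d y ∈ grid p ∧
    cellMap d y ∉ middleSquare p := by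
    intro e he h
    have hI : ∀ i, (e i : ℝ) ∈ Icc (0 : ℝ) 1 := fun i => by rcases he i with h | h <;> rw [h] <;>
      simp
    refine ⟨⟨e 0, e 1⟩, mem_outer_iff.2 ⟨⟨hI 0, hI 1⟩, fun ho => ?_⟩,
      cellMap_corner_mem_grid d ?_, fun hm => ?_⟩
    · have := ho.1; rcases he 0 with h | h <;> simp [h] at this
    · rcases he 0 with h | h <;> simp [h]
    · have hm' := middle_subset_solidMid hm
      have h1 := hm'.1; have h2 := hm'.2
      rw [cellMap_re, mul_div_cancel₀ _ h0.ne'] at h1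
      simp only at h1
      rw [cellMap_im, mul_div_cancel₀ _ h0.ne'] at h2
      simp only at h2
      have a1 : mid p ≤ d.1.1 + e 0 := by exact_mod_cast h1.1
      have a2 : d.1.1 + e 0 ≤ mid p + 1 := by exact_mod_cast h1.2
      have a3 : mid p ≤ d.1.2 + e 1 := by exact_mod_cast h2.1
      have a4 : d.1.2 + e 1 ≤ mid p + 1 := by exact_mod_cast h2.2
      omega
  have hd := d.2.2.2
  by_cases h1 : d.1.1 < mid p
  · exact key (fun _ => 0) (by simp) (by omega)
  by_cases h2 : mid p < d.1.1
  · exact key (fun _ => 1) (by simp) (by omega)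
  by_cases h3 : d.1.2 < mid p
  · exact key (fun _ => 0) (by simp) (by omega)
  · exact key (fun _ => 1) (by simp) (by omega)

lemma isPreconnected_carpet_diff_circ (c : Option (Word p)) :
    IsPreconnected (sierpinskiCarpet p \ circ c) := by
  cases c with
  | none => exact isPreconnected_carpet_diff Subset.rfl
  | some w =>
    induction w with
    | nil =>
      have hc : circ (some ([] : Word p)) = middleSquare p := by simp [circ, wordMap]
      rw [hc]
      refine isPreconnected_of_link (x := 0) fun z hz => Link.symm ?_
      obtain ⟨d, y, hy, rfl⟩ := mem_carpet_iff.1 hz.1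
      obtain ⟨x, hx, hxg, hxm⟩ := exists_corner_not_middle d
      refine Link.trans (b := cellMap d x) ?_ (link_grid_outer
        (wordMap_mem_unitSq [d] (outer_subset_unitSq hx)) hxg hxm)
      set E : Set ℂ := outerSquare ∩ cellMap d ⁻¹' middleSquare p
      refine Link.image (X := sierpinskiCarpet p \ E) (Link.of_preconnected
        (isPreconnected_carpet_diff inter_subset_left) ⟨hy, fun h => hz.2 h.2⟩
        ⟨outer_subset_carpet hx, fun h => hxm h.2⟩) (continuous_cellMap d) ?_
      rintro t ⟨ht, htE⟩
      refine ⟨cellMap_mem_carpet d ht, fun hm => htE ⟨?_, hm⟩⟩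
      exact mem_outer_iff.2 ⟨carpet_subset_unitSq ht, fun ho =>
        cellMap_openSq_not_solidMid ho (middle_subset_solidMid hm)⟩
    | cons d w ih =>
      have hsub : circ (some (d :: w)) ⊆ cellMap d '' openSq := by
        rw [circ_cons]
        exact image_mono ((circ_some_subset_solid w).trans (solid_subset_openSq w))
      refine isPreconnected_of_link (x := 0) fun z hz => Link.symm ?_
      obtain ⟨e, y, hy, rfl⟩ := mem_carpet_iff.1 hz.1
      refine Link.trans (b := cellMap e 0) ?_ ((link_grid_zero (wordMap_mem_unitSq [e]
        zero_mem_unitSq)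
        (cellMap_corner_mem_grid e (Or.inl rfl))).mono ?_)
      · by_cases hed : e = d
        · subst hed
          have h2 : y ∉ circ (some w) := fun h => hz.2 (by rw [circ_cons]; exact ⟨y, h, rfl⟩)
          have h3 : (0 : ℂ) ∉ circ (some w) := circ_disjoint (c := none) (by simp) zero_mem_outer
          refine (Link.of_preconnected ih ⟨hy, h2⟩ ⟨outer_subset_carpet zero_mem_outer, h3⟩).image
            (continuous_cellMap e) ?_
          rintro t ⟨ht, ht'⟩
          refine ⟨cellMap_mem_carpet e ht, fun h => ht' ?_⟩
          rw [circ_cons] at h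
          obtain ⟨s, hs, hst⟩ := h
          rwa [← cellMap_injective e hst]
        · refine (Link.of_preconnected isPreconnected_carpet hy
            (outer_subset_carpet zero_mem_outer)).image (continuous_cellMap e) ?_
          intro t ht
          refine ⟨cellMap_mem_carpet e ht, fun h => hed ?_⟩
          obtain ⟨s, hs, hst⟩ := hsub h
          exact (cellMap_eq_openSq hs (carpet_subset_unitSq ht) hst).1.symm
      · rintro t ⟨ht, htg⟩
        refine ⟨grid_mem_carpet ht htg, fun h => ?_⟩
        obtain ⟨s, hs, rfl⟩ := hsub h
        exact grid_not_openCell d hs htg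

end

noncomputable section

/-- The supremum norm on the plane. -/
def supNorm (z : ℂ) : ℝ := max |z.re| |z.im|

lemma continuous_supNorm : Continuous supNorm := by unfold supNorm; fun_prop

lemma supNorm_nonneg (z : ℂ) : 0 ≤ supNorm z := (abs_nonneg _).trans (le_max_left _ _)

lemma supNorm_smul {s : ℝ} (hs : 0 ≤ s) (z : ℂ) : supNorm (s * z) = s * supNorm z := by
  simp [supNorm, abs_mul, abs_of_nonneg hs, mul_max_of_nonneg _ _ hs]

lemma supNorm_eq_zero {z : ℂ} : supNorm z = 0 ↔ z = 0 := by
  constructor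
  · intro h
    have h1 : |z.re| ≤ 0 := h ▸ le_max_left _ _
    have h2 : |z.im| ≤ 0 := h ▸ le_max_right _ _
    exact Complex.ext (abs_nonpos_iff.1 h1) (abs_nonpos_iff.1 h2)
  · rintro rfl; simp [supNorm]

/-- The point of the unit sphere of the supremum norm in the direction `θ`. -/
def squarePt (θ : ℝ) : ℂ :=
  ((supNorm (Complex.exp (θ * Complex.I)))⁻¹ : ℝ) * Complex.exp (θ * Complex.I)

lemma supNorm_exp_pos (θ : ℝ) : 0 < supNorm (Complex.exp (θ * Complex.I)) :=
  lt_of_le_of_ne (supNorm_nonneg _) fun h => Complex.exp_ne_zero _ (supNorm_eq_zero.1 h.symm)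

lemma supNorm_squarePt (θ : ℝ) : supNorm (squarePt θ) = 1 := by
  have := supNorm_exp_pos θ
  rw [squarePt, supNorm_smul (by positivity), inv_mul_cancel₀ this.ne']

lemma continuous_squarePt : Continuous squarePt := by
  unfold squarePt
  have h : Continuous fun θ : ℝ => Complex.exp (θ * Complex.I) := by fun_prop
  have h2 : Continuous fun θ : ℝ => (supNorm (Complex.exp (θ * Complex.I)))⁻¹ :=
    (continuous_supNorm.comp h).inv₀ fun θ => (supNorm_exp_pos θ).ne'
  exact (Complex.continuous_ofReal.comp h2).mul h

lemma eq_squarePt (z : ℂ) : z = supNorm z * squarePt z.arg := by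
  by_cases hz : z = 0
  · subst hz; simp [supNorm_eq_zero.2]
  have h := Complex.norm_mul_exp_arg_mul_I z
  have hN : supNorm z = ‖z‖ * supNorm (Complex.exp (z.arg * Complex.I)) := by
    conv_lhs => rw [← h]
    exact supNorm_smul (norm_nonneg _) _
  have h3 := (supNorm_exp_pos z.arg).ne'
  rw [squarePt, hN]
  push_cast
  have h4 : (supNorm (Complex.exp (z.arg * Complex.I)) : ℂ) ≠ 0 := by exact_mod_cast h3
  conv_lhs => rw [← h]
  field_simp

lemma isPreconnected_supNorm_mem (a : ℂ) {T : Set ℝ} (hT : IsPreconnected T) (h0 : T ⊆ Ici 0) :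
    IsPreconnected {z | supNorm (z - a) ∈ T} := by
  have : {z | supNorm (z - a) ∈ T} =
      (fun x : ℝ × ℝ => a + x.1 * squarePt x.2) '' (T ×ˢ univ) := by
    ext z
    constructor
    · intro hz
      refine ⟨(supNorm (z - a), (z - a).arg), ⟨hz, mem_univ _⟩, ?_⟩
      simp only
      rw [← eq_squarePt]; ring
    · rintro ⟨⟨s, θ⟩, ⟨hs, -⟩, rfl⟩
      simp only [mem_ofPred_eq, add_sub_cancel_left]
      rw [supNorm_smul (h0 hs), supNorm_squarePt, mul_one]; exact hs
  rw [this]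
  refine (hT.prod isPreconnected_univ).image _ (Continuous.continuousOn ?_)
  have := continuous_squarePt
  fun_prop

lemma mem_closure_supNorm (a : ℂ) {T : Set ℝ} (h0 : T ⊆ Ici 0) {r : ℝ} (hr : r ∈ closure T) {z : ℂ}
    (hz : supNorm (z - a) = r) : z ∈ closure {z | supNorm (z - a) ∈ T} := by
  have hc : Continuous fun s : ℝ => a + s * squarePt (z - a).arg := by fun_prop
  have h := map_mem_closure hc hr (t := {z | supNorm (z - a) ∈ T}) fun s hs => by
    simp only [mem_ofPred_eq, add_sub_cancel_left]
    rw [supNorm_smul (h0 hs), supNorm_squarePt, mul_one]; exact hs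
  have h2 : a + (r : ℂ) * squarePt (z - a).arg = z := by
    rw [← hz, ← eq_squarePt]; ring
  rwa [h2] at h

/-- There is no continuous logarithm along a loop winding once around the origin. -/
lemma no_log_loop {L : ℝ → ℂ} (hL : Continuous L) (hp : L (2 * Real.pi) = L 0) {ρ : ℝ → ℝ}
    (hρ : ∀ θ, 0 < ρ θ) (h : ∀ θ : ℝ, Complex.exp (L θ) = ρ θ * Complex.exp (θ * Complex.I)) :
    False := by
  set g : ℝ → ℝ := fun θ => (L θ).im - θ
  have hg : Continuous g := by fun_prop
  have key : ∀ θ : ℝ, Complex.exp (g θ * Complex.I) = 1 := by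
    intro θ
    have h1 : Complex.exp (L θ) = Real.exp (L θ).re * Complex.exp ((L θ).im * Complex.I) := by
      rw [Complex.ofReal_exp, ← Complex.exp_add, Complex.re_add_im]
    have h2 : (Real.exp (L θ).re : ℂ) = ρ θ := by
      have h3 : ‖Complex.exp (L θ)‖ = ‖(ρ θ : ℂ) * Complex.exp (θ * Complex.I)‖ := by rw [h]
      rw [Complex.norm_exp, norm_mul, Complex.norm_exp_ofReal_mul_I, mul_one,
        Complex.norm_real, Real.norm_of_nonneg (hρ θ).le] at h3
      exact_mod_cast h3
    have h4 : Complex.exp ((L θ).im * Complex.I) = Complex.exp (θ * Complex.I) := by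
      have h5 := h θ
      rw [h1, h2] at h5
      exact mul_left_cancel₀ (by exact_mod_cast (hρ θ).ne') h5
    simp only [g]
    push_cast
    rw [sub_mul, Complex.exp_sub, h4, div_self (Complex.exp_ne_zero _)]
  have h0 : g 0 - Real.pi ∈ Icc (g (2 * Real.pi)) (g 0) := by
    simp only [g, hp]
    constructor <;> linarith [Real.pi_pos]
  obtain ⟨θ, -, hθ⟩ := intermediate_value_Icc' (by positivity) hg.continuousOn h0
  have h1 := key θ
  rw [hθ] at h1
  push_cast at h1
  rw [sub_mul, Complex.exp_sub, key 0, Complex.exp_pi_mul_I] at h1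
  norm_num at h1

variable {p : ℕ} [hp : OddBase p]

lemma wordMap_sub (w : Word p) (x y : ℂ) :
    wordMap w x - wordMap w y = ((1 / p ^ w.length : ℝ) : ℂ) * (x - y) := by
  apply Complex.ext
  · rw [Complex.re_ofReal_mul, Complex.sub_re, Complex.sub_re, wordMap_re, wordMap_re]; ring
  · rw [Complex.im_ofReal_mul, Complex.sub_im, Complex.sub_im, wordMap_im, wordMap_im]; ring

lemma supNorm_centre_le_iff {z : ℂ} : supNorm (z - centre) ≤ 1 / 2 ↔ z ∈ unitSq := by
  simp only [supNorm, centre, unitSq, Complex.sub_re, Complex.sub_im, max_le_iff, abs_le,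
    mem_ofPred_eq, mem_Icc]
  constructor
  · rintro ⟨⟨h1, h2⟩, h3, h4⟩; refine ⟨⟨?_, ?_⟩, ?_, ?_⟩ <;> linarith
  · rintro ⟨⟨h1, h2⟩, h3, h4⟩; refine ⟨⟨?_, ?_⟩, ?_, ?_⟩ <;> linarith

lemma supNorm_centre_lt_iff {z : ℂ} : supNorm (z - centre) < 1 / 2 ↔ z ∈ openSq := by
  simp only [supNorm, centre, openSq, Complex.sub_re, Complex.sub_im, max_lt_iff, abs_lt,
    mem_ofPred_eq, mem_Ioo]
  constructor
  · rintro ⟨⟨h1, h2⟩, h3, h4⟩; refine ⟨⟨?_, ?_⟩, ?_, ?_⟩ <;> linarith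
  · rintro ⟨⟨h1, h2⟩, h3, h4⟩; refine ⟨⟨?_, ?_⟩, ?_, ?_⟩ <;> linarith

lemma supNorm_centre_le_iff' {z : ℂ} : supNorm (z - centre) ≤ 1 / (2 * p) ↔ z ∈ solidMid p := by
  have h0 := base_pos (p := p)
  have hc := cast_base (p := p)
  have e : ∀ x : ℝ, |x - 1 / 2| ≤ 1 / (2 * p) ↔ p * x ∈ Icc (mid p : ℝ) (mid p + 1) := by
    intro x
    rw [le_div_iff₀ (by positivity), ← abs_of_pos (show (0 : ℝ) < 2 * p by positivity), ← abs_mul,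
      abs_le, mem_Icc]
    constructor <;> rintro ⟨h1, h2⟩ <;> constructor <;> nlinarith
  simp only [supNorm, centre, solidMid, Complex.sub_re, Complex.sub_im, max_le_iff, e,
    mem_ofPred_eq]

lemma supNorm_centre_lt_iff' {z : ℂ} : supNorm (z - centre) < 1 / (2 * p) ↔ z ∈ openMid p := by
  have h0 := base_pos (p := p)
  have hc := cast_base (p := p)
  have e : ∀ x : ℝ, |x - 1 / 2| < 1 / (2 * p) ↔ p * x ∈ Ioo (mid p : ℝ) (mid p + 1) := by
    intro x
    rw [lt_div_iff₀ (by positivity), ← abs_of_pos (show (0 : ℝ) < 2 * p by positivity), ← abs_mul,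
      abs_lt, mem_Ioo]
    constructor <;> rintro ⟨h1, h2⟩ <;> constructor <;> nlinarith
  simp only [supNorm, centre, openMid, Complex.sub_re, Complex.sub_im, max_lt_iff, e,
    mem_ofPred_eq]

/-- The centre of a peripheral square. -/
def circCentre : Option (Word p) → ℂ
  | none => centre
  | some w => wordMap w centre

/-- Half of the side length of a peripheral square. -/
def circRadius : Option (Word p) → ℝ
  | none => 1 / 2
  | some w => 1 / (2 * p) / p ^ w.length

/-- The complementary component of the carpet bounded by a peripheral square. -/
def gap : Option (Word p) → Set ℂ
  | none => unitSqᶜ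
  | some w => hole w

lemma circRadius_pos (c : Option (Word p)) : 0 < circRadius c := by
  have h0 := base_pos (p := p)
  cases c with
  | none => norm_num [circRadius]
  | some w => simp only [circRadius]; positivity

lemma supNorm_sub_wordMap (w : Word p) (z : ℂ) :
    supNorm (z - wordMap w centre) = supNorm (wordInv w z - centre) / p ^ w.length := by
  have h0 := pow_base_pos (p := p) w.length
  conv_lhs => rw [← wordMap_wordInv w z]
  rw [wordMap_sub, supNorm_smul (by positivity)]; ring

lemma mem_hole_iff {w : Word p} {z : ℂ} :
    z ∈ hole w ↔ supNorm (z - wordMap w centre) < circRadius (some w) := by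
  have h0 := pow_base_pos (p := p) w.length
  rw [hole, mem_wordMap_image, supNorm_sub_wordMap, circRadius, div_lt_div_iff_of_pos_right h0,
    supNorm_centre_lt_iff']

lemma mem_solid_iff {w : Word p} {z : ℂ} :
    z ∈ solid w ↔ supNorm (z - wordMap w centre) ≤ circRadius (some w) := by
  have h0 := pow_base_pos (p := p) w.length
  rw [solid, mem_wordMap_image, supNorm_sub_wordMap, circRadius, div_le_div_iff_of_pos_right h0,
    supNorm_centre_le_iff']

lemma mem_circ_iff {c : Option (Word p)} {z : ℂ} :
    z ∈ circ c ↔ supNorm (z - circCentre c) = circRadius c := by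
  cases c with
  | none =>
    simp only [circ, circCentre, circRadius]
    rw [mem_outer_iff, ← supNorm_centre_le_iff, ← supNorm_centre_lt_iff, not_lt]
    exact ⟨fun h => le_antisymm h.1 h.2, fun h => ⟨h.le, h.ge⟩⟩
  | some w =>
    simp only [circCentre]
    rw [mem_circ_some_iff, mem_solid_iff, mem_hole_iff, not_lt]
    exact ⟨fun h => le_antisymm h.1 h.2, fun h => ⟨h.le, h.ge⟩⟩

lemma gap_eq (c : Option (Word p)) : ∃ T : Set ℝ, IsPreconnected T ∧ T ⊆ Ici 0 ∧
    circRadius c ∈ closure T ∧ gap c = {z | supNorm (z - circCentre c) ∈ T} := by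
  cases c with
  | none =>
    refine ⟨Ioi (1 / 2), isPreconnected_Ioi, fun x hx => ?_, ?_, ?_⟩
    · rw [mem_Ioi] at hx; rw [mem_Ici]; linarith
    · rw [closure_Ioi]; simp [circRadius]
    · ext z
      simp only [gap, circCentre, mem_compl_iff, mem_ofPred_eq, mem_Ioi]
      rw [← supNorm_centre_le_iff, not_le]
  | some w =>
    refine ⟨Ico 0 (circRadius (some w)), isPreconnected_Ico, fun x hx => hx.1, ?_, ?_⟩
    · rw [closure_Ico (circRadius_pos _).ne]
      exact ⟨(circRadius_pos _).le, le_rfl⟩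
    · ext z
      simp only [gap, circCentre, mem_ofPred_eq, mem_Ico, supNorm_nonneg, true_and]
      rw [mem_hole_iff]

lemma isPreconnected_gap (c : Option (Word p)) : IsPreconnected (gap c) := by
  obtain ⟨T, h1, h2, -, h4⟩ := gap_eq c
  rw [h4]; exact isPreconnected_supNorm_mem _ h1 h2

lemma circ_subset_closure_gap (c : Option (Word p)) : circ c ⊆ closure (gap c) := by
  obtain ⟨T, h1, h2, h3, h4⟩ := gap_eq c
  intro z hz
  rw [h4]; exact mem_closure_supNorm _ h2 h3 (mem_circ_iff.1 hz)

lemma gap_disjoint_carpet (c : Option (Word p)) {z : ℂ} (hz : z ∈ gap c) :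
    z ∉ sierpinskiCarpet p := by
  cases c with
  | none => exact fun h => hz (carpet_subset_unitSq h)
  | some w => exact fun h => carpet_not_hole h w hz

lemma exists_gap {z : ℂ} (hz : z ∉ sierpinskiCarpet p) : ∃ c : Option (Word p), z ∈ gap c := by
  by_cases hU : z ∈ unitSq
  · by_contra h
    push Not at h
    exact hz (mem_carpet_of hU fun w => h (some w))
  · exact ⟨none, hU⟩

lemma circ_nonempty (c : Option (Word p)) : (circ c).Nonempty := by
  refine ⟨circCentre c + circRadius c * squarePt 0, mem_circ_iff.2 ?_⟩
  rw [add_sub_cancel_left, supNorm_smul (circRadius_pos c).le, supNorm_squarePt, mul_one]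

lemma no_log_circ (c : Option (Word p)) :
    ¬ HasLog (fun z : circ c => (z : ℂ) - circCentre c) := by
  rintro ⟨l, hl, hl'⟩
  have hmem : ∀ θ, circCentre c + circRadius c * squarePt θ ∈ circ c := fun θ => by
    rw [mem_circ_iff, add_sub_cancel_left, supNorm_smul (circRadius_pos c).le, supNorm_squarePt,
      mul_one]
  have hcont : Continuous fun θ : ℝ => (⟨_, hmem θ⟩ : circ c) := by
    have := continuous_squarePt
    exact Continuous.subtype_mk (by fun_prop) _
  refine no_log_loop (hl.comp hcont) ?_
    (ρ := fun θ => circRadius c * (supNorm (Complex.exp (θ * Complex.I)))⁻¹)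
    (fun θ => mul_pos (circRadius_pos c) (inv_pos.2 (supNorm_exp_pos θ))) fun θ => ?_
  · simp only [Function.comp]
    congr 3
    simp [squarePt]
  · simp only [Function.comp]
    rw [hl']
    simp only [add_sub_cancel_left, squarePt]
    push_cast
    ring

lemma volume_cellMap_image (d : Digit p) (A : Set ℂ) :
    MeasureTheory.volume (cellMap d '' A) =
      ENNReal.ofReal ((1 / p) ^ 2) * MeasureTheory.volume A := by
  have h0 := base_pos (p := p)
  have : cellMap d = AffineMap.homothety (k := ℝ)
      (((d.1.1 : ℂ) + d.1.2 * Complex.I) / (p - 1)) (1 / p : ℝ) := by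
    funext z
    have h1 : (p : ℂ) - 1 ≠ 0 := by
      have := three_le_cast (p := p)
      have h2 : ((p : ℝ) - 1) ≠ 0 := by linarith
      exact_mod_cast h2
    have h2 : (p : ℂ) ≠ 0 := by exact_mod_cast h0.ne'
    simp only [cellMap, AffineMap.homothety_apply, vsub_eq_sub, vadd_eq_add, Complex.real_smul]
    push_cast
    field_simp
    ring
  rw [this, MeasureTheory.Measure.addHaar_image_homothety, Complex.finrank_real_complex,
    abs_of_nonneg (by positivity)]

lemma card_digit [Fintype (Digit p)] : Fintype.card (Digit p) < p ^ 2 := by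
  have hm := two_mid_add_one (p := p)
  let e : Digit p → Fin p × Fin p := fun d => (⟨d.1.1, d.2.1⟩, ⟨d.1.2, d.2.2.1⟩)
  have he : Function.Injective e := by
    intro a b h
    simp only [e, Prod.mk.injEq, Fin.mk.injEq] at h
    exact Subtype.ext (Prod.ext h.1 h.2)
  have hs : ¬ Function.Surjective e := by
    intro h
    obtain ⟨d, hd⟩ := h (⟨mid p, by omega⟩, ⟨mid p, by omega⟩)
    simp only [e, Prod.mk.injEq, Fin.mk.injEq] at hd
    exact d.2.2.2 hd
  have := Fintype.card_lt_of_injective_not_surjective e he hs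
  simpa [pow_two] using this

lemma volume_carpet : MeasureTheory.volume (sierpinskiCarpet p) = 0 := by
  classical
  have : Fintype (Digit p) := Fintype.ofFinite _
  have h0 := base_pos (p := p)
  have hS : sierpinskiCarpet p = ⋃ d : Digit p, cellMap d '' sierpinskiCarpet p := by
    ext z; rw [mem_carpet_iff]; simp
  have hfin : MeasureTheory.volume (sierpinskiCarpet p) ≠ ⊤ := isCompact_carpet.measure_ne_top
  have hle : MeasureTheory.volume (sierpinskiCarpet p) ≤ Fintype.card (Digit p) *
      (ENNReal.ofReal ((1 / p) ^ 2) * MeasureTheory.volume (sierpinskiCarpet p)) := by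
    conv_lhs => rw [hS]
    refine (MeasureTheory.measure_iUnion_le _).trans ?_
    rw [tsum_fintype]
    simp [volume_cellMap_image]
  set m := (MeasureTheory.volume (sierpinskiCarpet p)).toReal
  have hm : m ≤ Fintype.card (Digit p) * ((1 / p) ^ 2 * m) := by
    have := ENNReal.toReal_mono (by finiteness) hle
    rwa [ENNReal.toReal_mul, ENNReal.toReal_mul, ENNReal.toReal_ofReal (by positivity),
      ENNReal.toReal_natCast] at this
  have hc : (Fintype.card (Digit p) : ℝ) < p ^ 2 := by exact_mod_cast card_digit (p := p)
  have hm0 : 0 ≤ m := ENNReal.toReal_nonneg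
  have : m = 0 := by
    by_contra h
    have hpos : 0 < m := lt_of_le_of_ne hm0 (Ne.symm h)
    have : m < m := by
      calc m ≤ Fintype.card (Digit p) * ((1 / p) ^ 2 * m) := hm
        _ < p ^ 2 * ((1 / p) ^ 2 * m) := by gcongr
        _ = m := by field_simp
    exact lt_irrefl _ this
  exact (ENNReal.toReal_eq_zero_iff _).1 this |>.resolve_right hfin

/-- The image of a subset of the carpet under a self-map of the carpet, as a plane set. -/
def push (f : sierpinskiCarpet p → sierpinskiCarpet p) (A : Set ℂ) : Set ℂ :=
  (fun x => (f x : ℂ)) '' (Subtype.val ⁻¹' A)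

lemma exists_circ_subset (f : sierpinskiCarpet p ≃ₜ sierpinskiCarpet p) (c : Option (Word p)) :
    ∃ c' : Option (Word p), circ c' ⊆ push f (circ c) := by
  set J : Set ℂ := push f (circ c)
  have hJS : J ⊆ sierpinskiCarpet p := by rintro _ ⟨x, -, rfl⟩; exact (f x).2
  have hJ : IsCompact J := by
    have : CompactSpace (sierpinskiCarpet p) := isCompact_iff_compactSpace.1 isCompact_carpet
    have h1 : IsClosed (Subtype.val ⁻¹' circ c : Set (sierpinskiCarpet p)) :=
      (isCompact_circ c).isClosed.preimage continuous_subtype_val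
    exact h1.isCompact.image (continuous_subtype_val.comp f.continuous)
  have hsep : ¬ IsPreconnected Jᶜ := by
    intro hpre
    have : CompactSpace J := isCompact_iff_compactSpace.1 hJ
    let g : J → ℂ := fun z => (f.symm ⟨z, hJS z.2⟩ : ℂ) - circCentre c
    have hg : Continuous g := by
      have : Continuous fun z : J => (⟨z, hJS z.2⟩ : sierpinskiCarpet p) :=
        Continuous.subtype_mk continuous_subtype_val _
      exact (continuous_subtype_val.comp (f.symm.continuous.comp this)).sub continuous_const
    have hmem : ∀ z : J, (f.symm ⟨z, hJS z.2⟩ : ℂ) ∈ circ c := by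
      rintro ⟨_, x, hx, rfl⟩
      simpa using hx
    obtain ⟨l, hl, hl'⟩ := hasLog_of_isPreconnected_compl
      (MeasureTheory.measure_mono_null hJS volume_carpet) hpre ⟨g, hg⟩ fun z hz => by
        have h1 := mem_circ_iff.1 (hmem z)
        have h2 : (f.symm ⟨z, hJS z.2⟩ : ℂ) - circCentre c = 0 := hz
        rw [h2, supNorm_eq_zero.2 rfl] at h1
        exact (circRadius_pos c).ne h1
    have hF : ∀ z : circ c, (f ⟨z, circ_subset_carpet c z.2⟩ : ℂ) ∈ J := fun z =>
      ⟨⟨z, circ_subset_carpet c z.2⟩, z.2, rfl⟩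
    refine no_log_circ c ⟨fun z => l ⟨f ⟨z, circ_subset_carpet c z.2⟩, hF z⟩, ?_, fun z => ?_⟩
    · refine hl.comp (Continuous.subtype_mk ?_ _)
      exact continuous_subtype_val.comp (f.continuous.comp
        (Continuous.subtype_mk continuous_subtype_val _))
    · rw [hl']
      simp [g]
  have hSJ : IsPreconnected (sierpinskiCarpet p \ J) := by
    have h1 : IsPreconnected (Subtype.val ⁻¹' (sierpinskiCarpet p \ circ c) :
        Set (sierpinskiCarpet p)) := by
      rw [Topology.IsInducing.subtypeVal.isPreconnected_image.symm]
      rw [Subtype.image_preimage_coe]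
      simpa [inter_eq_right.2 sdiff_subset] using isPreconnected_carpet_diff_circ c
    have h2 := h1.image (fun x => (f x : ℂ))
      (continuous_subtype_val.comp f.continuous).continuousOn
    convert h2 using 1
    ext z
    constructor
    · rintro ⟨hz, hzJ⟩
      refine ⟨f.symm ⟨z, hz⟩, ⟨(f.symm ⟨z, hz⟩).2, fun h => hzJ ⟨_, h, by simp⟩⟩, by simp⟩
    · rintro ⟨x, hx, rfl⟩
      refine ⟨(f x).2, ?_⟩
      rintro ⟨y, hy, hyx⟩
      have := f.injective (Subtype.ext hyx)
      subst this
      exact hx.2 hy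
  rw [IsPreconnected] at hsep
  push Not at hsep
  obtain ⟨u, v, hu, hv, huv, hnu, hnv, hdis⟩ := hsep
  have main : ∀ u v : Set ℂ, IsOpen u → IsOpen v → Jᶜ ⊆ u ∪ v → (Jᶜ ∩ v).Nonempty →
      Jᶜ ∩ (u ∩ v) = ∅ → sierpinskiCarpet p \ J ⊆ u →
      ∃ c' : Option (Word p), circ c' ⊆ J := by
    intro u v hu hv huv hnv hdis hsub
    obtain ⟨z, hzJ, hzv⟩ := hnv
    have hzS : z ∉ sierpinskiCarpet p := fun h => by
      have : z ∈ Jᶜ ∩ (u ∩ v) := ⟨hzJ, hsub ⟨h, hzJ⟩, hzv⟩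
      rw [hdis] at this; exact this
    obtain ⟨c', hc'⟩ := exists_gap hzS
    refine ⟨c', fun x hx => ?_⟩
    by_contra hxJ
    have hxu : x ∈ u := hsub ⟨circ_subset_carpet c' hx, hxJ⟩
    have hgJ : gap c' ⊆ Jᶜ := fun y hy hyJ => gap_disjoint_carpet c' hy (hJS hyJ)
    obtain ⟨y, hyu, hy⟩ := mem_closure_iff.1 (circ_subset_closure_gap c' hx) u hu hxu
    obtain ⟨t, ht, ht'⟩ := isPreconnected_gap c' u v hu hv (hgJ.trans huv) ⟨y, hy, hyu⟩
      ⟨z, hc', hzv⟩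
    have : t ∈ Jᶜ ∩ (u ∩ v) := ⟨hgJ ht, ht'⟩
    rw [hdis] at this; exact this
  have hsub : sierpinskiCarpet p \ J ⊆ u ∨ sierpinskiCarpet p \ J ⊆ v := by
    have hJc : sierpinskiCarpet p \ J ⊆ Jᶜ := fun z hz => hz.2
    by_contra h
    rw [not_or, not_subset, not_subset] at h
    obtain ⟨⟨x, hx, hxu⟩, y, hy, hyv⟩ := h
    obtain ⟨t, ht, ht'⟩ := hSJ u v hu hv (hJc.trans huv)
      ⟨y, hy, (huv (hJc hy)).resolve_right hyv⟩ ⟨x, hx, (huv (hJc hx)).resolve_left hxu⟩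
    have : t ∈ Jᶜ ∩ (u ∩ v) := ⟨hJc ht, ht'⟩
    rw [hdis] at this; exact this
  rcases hsub with h | h
  · exact main u v hu hv huv hnv hdis h
  · exact main v u hv hu (by rwa [union_comm]) hnu (by rwa [inter_comm v u]) h

lemma push_push (f g : sierpinskiCarpet p → sierpinskiCarpet p) (A : Set ℂ) :
    push f (push g A) = push (f ∘ g) A := by
  ext z
  constructor
  · rintro ⟨x, ⟨y, hy, hyx⟩, rfl⟩
    exact ⟨y, hy, by simp only [Function.comp]; rw [Subtype.ext hyx]⟩
  · rintro ⟨y, hy, rfl⟩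
    exact ⟨g y, ⟨y, hy, rfl⟩, rfl⟩

lemma push_id {A : Set ℂ} (hA : A ⊆ sierpinskiCarpet p) : push (p := p) id A = A := by
  ext z
  constructor
  · rintro ⟨x, hx, rfl⟩; exact hx
  · intro hz; exact ⟨⟨z, hA hz⟩, hz, rfl⟩

lemma push_mono (f : sierpinskiCarpet p → sierpinskiCarpet p) {A B : Set ℂ} (h : A ⊆ B) :
    push f A ⊆ push f B := image_mono (preimage_mono h)

lemma push_symm_push (f : sierpinskiCarpet p ≃ₜ sierpinskiCarpet p) {A : Set ℂ}
    (hA : A ⊆ sierpinskiCarpet p) : push f.symm (push f A) = A := by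
  rw [push_push]
  have : (f.symm ∘ f : sierpinskiCarpet p → sierpinskiCarpet p) = id := by funext x; simp
  rw [this, push_id hA]

lemma push_push_symm (f : sierpinskiCarpet p ≃ₜ sierpinskiCarpet p) {A : Set ℂ}
    (hA : A ⊆ sierpinskiCarpet p) : push f (push f.symm A) = A :=
  push_symm_push f.symm hA

/-- Homeomorphisms of the carpet permute the peripheral squares. -/
theorem exists_circ_eq (f : sierpinskiCarpet p ≃ₜ sierpinskiCarpet p) (c : Option (Word p)) :
    ∃ c' : Option (Word p), push f (circ c) = circ c' := by
  obtain ⟨c', hc'⟩ := exists_circ_subset f c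
  obtain ⟨c'', hc''⟩ := exists_circ_subset f.symm c'
  have h1 : circ c'' ⊆ circ c := hc''.trans (by
    have := push_mono f.symm hc'
    rwa [push_symm_push f (circ_subset_carpet c)] at this)
  obtain ⟨z, hz⟩ := circ_nonempty c''
  have h2 : c'' = c := by
    by_contra h
    exact circ_disjoint h hz (h1 hz)
  subst h2
  refine ⟨c', Subset.antisymm ?_ hc'⟩
  have := push_mono f hc''
  rwa [push_push_symm f (circ_subset_carpet c')] at this

/-- The permutation of the peripheral squares induced by a homeomorphism. -/
def circPerm (f : sierpinskiCarpet p ≃ₜ sierpinskiCarpet p) (c : Option (Word p)) :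
    Option (Word p) := (exists_circ_eq f c).choose

lemma push_circ (f : sierpinskiCarpet p ≃ₜ sierpinskiCarpet p) (c : Option (Word p)) :
    push f (circ c) = circ (circPerm f c) := (exists_circ_eq f c).choose_spec

lemma circ_injective {c d : Option (Word p)} (h : circ c = circ d) : c = d := by
  by_contra hcd
  obtain ⟨z, hz⟩ := circ_nonempty c
  exact circ_disjoint hcd hz (h ▸ hz)

lemma circPerm_injective (f : sierpinskiCarpet p ≃ₜ sierpinskiCarpet p) :
    Function.Injective (circPerm f) := by
  intro c d h
  apply circ_injective
  rw [← push_symm_push f (circ_subset_carpet c), push_circ, h, ← push_circ,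
    push_symm_push f (circ_subset_carpet d)]

end

noncomputable section

/-- The oscillation of a function on a set. -/
def osc (u : ℂ → ℝ) (A : Set ℂ) : ℝ := Metric.diam (u '' A)

lemma osc_nonneg (u : ℂ → ℝ) (A : Set ℂ) : 0 ≤ osc u A := Metric.diam_nonneg

lemma osc_le {u : ℂ → ℝ} {A : Set ℂ} {C : ℝ} (hC : 0 ≤ C)
    (h : ∀ x ∈ A, ∀ y ∈ A, |u x - u y| ≤ C) : osc u A ≤ C := by
  refine Metric.diam_le_of_forall_dist_le hC ?_
  rintro _ ⟨x, hx, rfl⟩ _ ⟨y, hy, rfl⟩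
  exact h x hx y hy

lemma osc_eq_zero {u : ℂ → ℝ} {A : Set ℂ} {a : ℝ} (h : ∀ x ∈ A, u x = a) : osc u A = 0 :=
  le_antisymm (osc_le le_rfl fun x hx y hy => by rw [h x hx, h y hy]; simp) (osc_nonneg u A)

lemma osc_congr {u v : ℂ → ℝ} {A : Set ℂ} (h : ∀ x ∈ A, u x = v x) : osc u A = osc v A := by
  rw [osc, osc, image_congr h]

variable {p : ℕ} [hp : OddBase p]

lemma isBounded_image {u : ℂ → ℝ} (hu : ContinuousOn u (sierpinskiCarpet p)) {A : Set ℂ}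
    (hA : A ⊆ sierpinskiCarpet p) : Bornology.IsBounded (u '' A) :=
  (isCompact_carpet.image_of_continuousOn hu).isBounded.subset (image_mono hA)

lemma le_osc {u : ℂ → ℝ} (hu : ContinuousOn u (sierpinskiCarpet p)) {A : Set ℂ}
    (hA : A ⊆ sierpinskiCarpet p) {x y : ℂ} (hx : x ∈ A) (hy : y ∈ A) :
    |u x - u y| ≤ osc u A :=
  Metric.dist_le_diam_of_mem (isBounded_image hu hA) (mem_image_of_mem u hx)
    (mem_image_of_mem u hy)

lemma osc_mono {u : ℂ → ℝ} (hu : ContinuousOn u (sierpinskiCarpet p)) {A B : Set ℂ}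
    (hAB : A ⊆ B) (hB : B ⊆ sierpinskiCarpet p) : osc u A ≤ osc u B :=
  osc_le (osc_nonneg u B) fun _ hx _ hy => le_osc hu hB (hAB hx) (hAB hy)

/-- The part of the carpet within `l` cells of the lower left corner of the cell `w`. -/
def near (l : ℕ) (w : Word p) : Set ℂ :=
  {z | z ∈ sierpinskiCarpet p ∧ |p ^ w.length * z.re - cornerX w| ≤ l ∧
    |p ^ w.length * z.im - cornerY w| ≤ l}

lemma near_subset (l : ℕ) (w : Word p) : near l w ⊆ sierpinskiCarpet p := fun _ hz => hz.1

lemma near_mono {l m : ℕ} (h : l ≤ m) (w : Word p) : near l w ⊆ near m w := fun _ hz =>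
  ⟨hz.1, hz.2.1.trans (by exact_mod_cast h), hz.2.2.trans (by exact_mod_cast h)⟩

lemma wordMap_mem_near {w : Word p} {y : ℂ} (hy : y ∈ unitSq)
    (h : wordMap w y ∈ sierpinskiCarpet p) : wordMap w y ∈ near 1 w := by
  refine ⟨h, ?_, ?_⟩
  · rw [scaled_wordMap_re, add_sub_cancel_left, abs_of_nonneg hy.1.1]; exact_mod_cast hy.1.2
  · rw [scaled_wordMap_im, add_sub_cancel_left, abs_of_nonneg hy.2.1]; exact_mod_cast hy.2.2

lemma circ_subset_near (w : Word p) : circ (some w) ⊆ near 1 w := by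
  intro z hz
  have hS := circ_subset_carpet _ hz
  obtain ⟨y, hy, rfl⟩ := circ_some_subset_solid w hz
  exact wordMap_mem_near (openSq_subset (solidMid_subset_openSq hy)) hS

/-- Continuous functions on the carpet whose oscillations on the cells are square summable. -/
def Adm (p : ℕ) [OddBase p] (u : ℂ → ℝ) : Prop :=
  ContinuousOn u (sierpinskiCarpet p) ∧
    ∀ l : ℕ, Summable fun w : Word p => osc u (near l w) ^ 2

lemma Adm.of_le {u v w : ℂ → ℝ} (hu : Adm p u) (hv : Adm p v)
    (hw : ContinuousOn w (sierpinskiCarpet p))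
    (h : ∀ x ∈ sierpinskiCarpet p, ∀ y ∈ sierpinskiCarpet p,
      |w x - w y| ≤ |u x - u y| + |v x - v y|) : Adm p w := by
  refine ⟨hw, fun l => ?_⟩
  refine Summable.of_nonneg_of_le (fun _ => sq_nonneg _) (fun s => ?_)
    (((hu.2 l).mul_left 2).add ((hv.2 l).mul_left 2))
  have h1 : osc w (near l s) ≤ osc u (near l s) + osc v (near l s) := by
    refine osc_le (add_nonneg (osc_nonneg _ _) (osc_nonneg _ _)) fun x hx y hy => ?_
    exact (h x hx.1 y hy.1).trans (add_le_add (le_osc hu.1 (near_subset l s) hx hy)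
      (le_osc hv.1 (near_subset l s) hx hy))
  have h2 := osc_nonneg w (near l s)
  have h3 := osc_nonneg u (near l s)
  have h4 := osc_nonneg v (near l s)
  nlinarith [sq_nonneg (osc u (near l s) - osc v (near l s))]

lemma Adm.min {u v : ℂ → ℝ} (hu : Adm p u) (hv : Adm p v) : Adm p fun z => min (u z) (v z) := by
  refine hu.of_le hv (ContinuousOn.inf hu.1 hv.1) fun x _ y _ => ?_
  exact (abs_min_sub_min_le_max _ _ _ _).trans (max_le_add_of_nonneg (abs_nonneg _) (abs_nonneg _))

lemma Adm.max {u v : ℂ → ℝ} (hu : Adm p u) (hv : Adm p v) : Adm p fun z => max (u z) (v z) := by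
  refine hu.of_le hv (ContinuousOn.sup hu.1 hv.1) fun x _ y _ => ?_
  exact (abs_max_sub_max_le_max _ _ _ _).trans (max_le_add_of_nonneg (abs_nonneg _) (abs_nonneg _))

lemma Adm.one_sub {u : ℂ → ℝ} (hu : Adm p u) : Adm p fun z => 1 - u z := by
  refine hu.of_le hu (continuousOn_const.sub hu.1) fun x _ y _ => ?_
  have : (1 - u x) - (1 - u y) = -(u x - u y) := by ring
  rw [this, abs_neg]
  linarith [abs_nonneg (u x - u y)]

lemma summable_word_pow : Summable fun w : Word p => ((1 / p : ℝ) ^ w.length) ^ 2 := by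
  classical
  have : Fintype (Digit p) := Fintype.ofFinite _
  have h0 := base_pos (p := p)
  have hfin : ∀ n : ℕ, Finite {w : Word p // w.length = n} := fun n =>
    inferInstanceAs (Finite (List.Vector (Digit p) n))
  rw [← (Equiv.sigmaFiberEquiv (fun w : Word p => w.length)).summable_iff]
  refine (summable_sigma_of_nonneg fun _ => sq_nonneg _).2 ⟨fun n => ?_, ?_⟩
  · exact Summable.of_finite
  · have hval : ∀ n : ℕ, ∑' w : {w : Word p // w.length = n},
        ((1 / p : ℝ) ^ (w : Word p).length) ^ 2 =
        ((Fintype.card (Digit p) : ℝ) * (1 / p) ^ 2) ^ n := by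
      intro n
      have h1 : ∀ w : {w : Word p // w.length = n},
        ((1 / p : ℝ) ^ (w : Word p).length) ^ 2 = ((1 / p : ℝ) ^ n) ^ 2 := fun w => by rw [w.2]
      rw [tsum_congr h1]
      rw [tsum_const]
      have : Nat.card {w : Word p // w.length = n} = Fintype.card (Digit p) ^ n := by
        rw [← card_vector (α := Digit p) n, ← Nat.card_eq_fintype_card]; rfl
      rw [this]
      simp only [nsmul_eq_mul, Nat.cast_pow, mul_pow, ← pow_mul]
      rw [mul_comm n 2]
    have : (fun n : ℕ => ∑' w : {w : Word p // w.length = n},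
        ((1 / p : ℝ) ^ (w : Word p).length) ^ 2) = _ := funext hval
    change Summable (fun n : ℕ => ∑' w : {w : Word p // w.length = n},
        ((1 / p : ℝ) ^ (w : Word p).length) ^ 2)
    rw [this]
    refine summable_geometric_of_lt_one (by positivity) ?_
    have hc : (Fintype.card (Digit p) : ℝ) < p ^ 2 := by exact_mod_cast card_digit (p := p)
    rw [div_pow, one_pow, mul_one_div, div_lt_one (by positivity)]
    exact hc

lemma abs_sub_le_of_near {l : ℕ} {w : Word p} {x y : ℂ} (hx : x ∈ near l w) (hy : y ∈ near l w) :
    |x.re - y.re| ≤ 2 * l * (1 / p : ℝ) ^ w.length ∧ |x.im - y.im| ≤ 2 * l * (1 / p : ℝ)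
      ^ w.length := by
  have h0 := pow_base_pos (p := p) w.length
  have aux : ∀ a b c : ℝ, |p ^ w.length * a - c| ≤ l → |p ^ w.length * b - c| ≤ l →
      |a - b| ≤ 2 * l * (1 / p : ℝ) ^ w.length := by
    intro a b c ha hb
    rw [div_pow, one_pow, mul_one_div, le_div_iff₀ h0]
    rw [abs_le] at ha hb
    rw [← abs_of_pos h0, ← abs_mul, abs_le]
    constructor <;> nlinarith
  exact ⟨aux _ _ _ hx.2.1 hy.2.1, aux _ _ _ hx.2.2 hy.2.2⟩

lemma adm_of_lipschitz {u : ℂ → ℝ} {L : ℝ} (hL : 0 ≤ L)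
    (h : ∀ x y, |u x - u y| ≤ L * dist x y) : Adm p u := by
  have hc : Continuous u := by
    refine (LipschitzWith.of_dist_le_mul (K := ⟨L, hL⟩) fun x y => ?_).continuous
    exact h x y
  refine ⟨hc.continuousOn, fun l => ?_⟩
  refine Summable.of_nonneg_of_le (fun _ => sq_nonneg _) (fun w => ?_)
    (summable_word_pow.mul_left ((L * (4 * l)) ^ 2))
  rw [← mul_pow]
  refine pow_le_pow_left₀ (osc_nonneg _ _) (osc_le ?_ fun x hx y hy => (h x y).trans ?_) 2
  · have := base_pos (p := p); positivity
  · obtain ⟨h1, h2⟩ := abs_sub_le_of_near hx hy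
    rw [mul_assoc]
    gcongr
    linarith [dist_le_add x y]

lemma summable_of_near {H K : Word p → ℝ} (hH : ∀ w, 0 ≤ H w) (hK0 : ∀ w, 0 ≤ K w)
    (hK : Summable K) (n₀ m : ℕ) (s : Set (Word p)) (g : Word p → Word p)
    (h0 : ∀ w, n₀ ≤ w.length → w ∉ s → H w = 0)
    (hle : ∀ w ∈ s, n₀ ≤ w.length → H w ≤ K (g w))
    (hg : ∀ v ∈ s, ∀ w ∈ s, g v = g w → v.length = w.length ∧
      |(cornerX v : ℤ) - cornerX w| ≤ m ∧ |(cornerY v : ℤ) - cornerY w| ≤ m) :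
    Summable H := by
  classical
  have hfin : {w : Word p | w.length < n₀}.Finite := List.finite_length_lt _ _
  set s' : Set (Word p) := {w | w ∈ s ∧ n₀ ≤ w.length}
  have h1 : Summable fun w : s' => H w := by
    let rep : Word p → Word p := fun v => if h : ∃ w ∈ s, g w = v then h.choose else []
    have hrep : ∀ w ∈ s, rep (g w) ∈ s ∧ g (rep (g w)) = g w := by
      intro w hw
      have h : ∃ w' ∈ s, g w' = g w := ⟨w, hw, rfl⟩
      simp only [rep, dif_pos h]
      exact h.choose_spec
    have hb : ∀ w : s', (cornerX w.1 : ℤ) - cornerX (rep (g w.1)) ∈ Finset.Icc (-(m : ℤ)) m ∧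
        (cornerY w.1 : ℤ) - cornerY (rep (g w.1)) ∈ Finset.Icc (-(m : ℤ)) m := by
      intro w
      have h := hg _ w.2.1 _ (hrep _ w.2.1).1 (hrep _ w.2.1).2.symm
      rw [abs_le, abs_le] at h
      exact ⟨Finset.mem_Icc.2 h.2.1, Finset.mem_Icc.2 h.2.2⟩
    let ι : s' → Word p × ((Finset.Icc (-(m : ℤ)) m) × (Finset.Icc (-(m : ℤ)) m)) :=
      fun w => (g w.1, ⟨_, (hb w).1⟩, ⟨_, (hb w).2⟩)
    have hι : Function.Injective ι := by
      intro v w h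
      simp only [ι, Prod.mk.injEq, Subtype.mk.injEq] at h
      obtain ⟨e1, e2, e3⟩ := h
      rw [e1] at e2 e3
      exact Subtype.ext (word_eq_of_corner (hg _ v.2.1 _ w.2.1 e1).1 (by omega) (by omega))
    have hprod : Summable fun x : Word p × ((Finset.Icc (-(m : ℤ)) m) × (Finset.Icc (-(m : ℤ))
      m)) =>
        K x.1 * (1 : ℝ) :=
      hK.mul_of_nonneg (g := fun _ => (1 : ℝ)) Summable.of_finite hK0 fun _ => zero_le_one
    refine Summable.of_nonneg_of_le (fun w => hH w) (fun w => ?_) (hprod.comp_injective hι)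
    simp only [Function.comp, ι, mul_one]
    exact hle _ w.2.1 w.2.2
  replace h1 := (summable_subtype_iff_indicator (f := H)).1 h1
  have h2 : Summable ({w : Word p | w.length < n₀}.indicator H) :=
    summable_of_hasFiniteSupport (hfin.subset support_indicator_subset)
  refine (h1.add h2).congr_cofinite (Filter.Eventually.of_forall fun w => ?_)
  change s'.indicator H w + {w : Word p | w.length < n₀}.indicator H w = H w
  by_cases hw : w.length < n₀
  · have hw' : w ∉ s' := fun h => absurd h.2 (by omega)
    rw [indicator_of_notMem hw', indicator_of_mem (show w ∈ {w : Word p | w.length < n₀} from hw),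
      zero_add]
  · rw [indicator_of_notMem (show w ∉ {w : Word p | w.length < n₀} from hw), add_zero]
    by_cases hs : w ∈ s
    · rw [indicator_of_mem (show w ∈ s' from ⟨hs, by omega⟩)]
    · rw [indicator_of_notMem (fun h => hs h.1), h0 w (by omega) hs]

/-- The energy of a function over a family of peripheral squares. -/
def energy (I : Set (Option (Word p))) (u : ℂ → ℝ) : ℝ :=
  ∑' c, I.indicator (fun c => osc u (circ c) ^ 2) c

lemma Adm.summable_circ {u : ℂ → ℝ} (hu : Adm p u) :
    Summable fun c : Option (Word p) => osc u (circ c) ^ 2 := by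
  have h : Summable fun w : Word p => osc u (circ (some w)) ^ 2 :=
    Summable.of_nonneg_of_le (fun _ => sq_nonneg _) (fun w => pow_le_pow_left₀ (osc_nonneg _ _)
      (osc_mono hu.1 (circ_subset_near w) (near_subset 1 w)) 2) (hu.2 1)
  have h2 : Function.Injective (some : Word p → Option (Word p)) := Option.some_injective _
  have h3 := h2.summable_iff (f := fun c : Option (Word p) =>
    ({none}ᶜ : Set (Option (Word p))).indicator (fun c => osc u (circ c) ^ 2) c) ?_
  · have h4 := h3.1 (h.congr fun w => by simp)
    refine h4.congr_cofinite ?_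
    refine (Set.finite_singleton none).subset fun c hc => ?_
    by_contra hc'
    exact hc (indicator_of_mem (show c ∈ ({none}ᶜ : Set (Option (Word p))) from hc') _)
  · intro c hc
    cases c with
    | none => simp
    | some w => exact absurd ⟨w, rfl⟩ hc

lemma Adm.summable_indicator {u : ℂ → ℝ} (hu : Adm p u) (I : Set (Option (Word p))) :
    Summable (I.indicator fun c : Option (Word p) => osc u (circ c) ^ 2) :=
  hu.summable_circ.indicator I

lemma energy_nonneg (I : Set (Option (Word p))) (u : ℂ → ℝ) : 0 ≤ energy I u :=
  tsum_nonneg fun _ => indicator_nonneg (fun _ _ => sq_nonneg _) _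

/-- Competitors for the capacity between `C` and `T`. -/
def Cls (p : ℕ) [OddBase p] (C T : Set ℂ) : Set (ℂ → ℝ) :=
  {u | Adm p u ∧ (∀ z ∈ sierpinskiCarpet p, u z ∈ Icc (0 : ℝ) 1) ∧ (∀ z ∈ C, u z = 0) ∧
    ∀ z ∈ T, u z = 1}

/-- The capacity between `C` and `T` relative to a family of peripheral squares. -/
def cap (I : Set (Option (Word p))) (C T : Set ℂ) : ℝ := sInf (energy I '' Cls p C T)

lemma cap_le {I : Set (Option (Word p))} {C T : Set ℂ} {u : ℂ → ℝ} (hu : u ∈ Cls p C T) :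
    cap I C T ≤ energy I u :=
  csInf_le ⟨0, by rintro _ ⟨v, -, rfl⟩; exact energy_nonneg I v⟩ (mem_image_of_mem _ hu)

lemma exists_lt_of_cap_lt {I : Set (Option (Word p))} {C T : Set ℂ} (hne : (Cls p C T).Nonempty)
    {b : ℝ} (hb : cap I C T < b) : ∃ u ∈ Cls p C T, energy I u < b := by
  obtain ⟨_, ⟨u, hu, rfl⟩, h⟩ := exists_lt_of_csInf_lt (hne.image _) hb
  exact ⟨u, hu, h⟩

lemma Cls.one_sub {C T : Set ℂ} {u : ℂ → ℝ} (hu : u ∈ Cls p C T) : (fun z => 1 - u z) ∈ Cls p T C :=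
  ⟨hu.1.one_sub, fun z hz => ⟨by linarith [(hu.2.1 z hz).2], by linarith [(hu.2.1 z hz).1]⟩,
    fun z hz => by simp [hu.2.2.2 z hz], fun z hz => by simp [hu.2.2.1 z hz]⟩

lemma osc_one_sub (u : ℂ → ℝ) (A : Set ℂ) : osc (fun z => 1 - u z) A = osc u A := by
  have : (fun z => 1 - u z) '' A = (fun t => 1 - t) '' (u '' A) := by rw [image_image]
  rw [osc, this]
  exact (Isometry.of_dist_eq fun a b => by
    rw [Real.dist_eq, Real.dist_eq, show (1 - a) - (1 - b) = -(a - b) by ring,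
      abs_neg]).diam_image _

lemma energy_one_sub (I : Set (Option (Word p))) (u : ℂ → ℝ) :
    energy I (fun z => 1 - u z) = energy I u := by
  simp only [energy, osc_one_sub]

lemma cap_symm (I : Set (Option (Word p))) (C T : Set ℂ) : cap I C T = cap I T C := by
  have key : ∀ C T : Set ℂ, energy I '' Cls p C T ⊆ energy I '' Cls p T C := by
    rintro C T _ ⟨u, hu, rfl⟩
    exact ⟨_, Cls.one_sub hu, energy_one_sub I u⟩
  rw [cap, cap, Subset.antisymm (key C T) (key T C)]

lemma infDist_circ_pos {c : Option (Word p)} {z : ℂ} (hz : z ∉ circ c) : 0 < infDist z (circ c) :=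
  ((isCompact_circ c).isClosed.notMem_iff_infDist_pos (circ_nonempty c)).1 hz

/-- A truncated distance to the circle `c`. -/
def truncDist (L : ℝ) (c : Option (Word p)) (z : ℂ) : ℝ := min 1 (L * infDist z (circ c))

lemma adm_truncDist {L : ℝ} (hL : 0 ≤ L) (c : Option (Word p)) : Adm p (truncDist L c) := by
  refine adm_of_lipschitz hL fun x y => ?_
  refine (abs_min_sub_min_le_max _ _ _ _).trans (max_le (by simpa using by positivity) ?_)
  rw [← mul_sub, abs_mul, abs_of_nonneg hL]
  gcongr
  have := (lipschitz_infDist_pt (circ c)).dist_le_mul x y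
  simpa [Real.dist_eq] using this

lemma truncDist_mem {L : ℝ} (hL : 0 ≤ L) (c : Option (Word p)) (z : ℂ) :
    truncDist L c z ∈ Icc (0 : ℝ) 1 :=
  ⟨le_min zero_le_one (mul_nonneg hL infDist_nonneg), min_le_left _ _⟩

lemma truncDist_eq_zero {L : ℝ} {c : Option (Word p)} {z : ℂ} (hz : z ∈ circ c) :
    truncDist L c z = 0 := by
  rw [truncDist, infDist_zero_of_mem hz]; simp

lemma exists_truncDist_eq_one {c : Option (Word p)} {A : Set ℂ} (hA : IsCompact A)
    (h : ∀ z ∈ A, z ∉ circ c) : ∃ L : ℝ, 0 ≤ L ∧ ∀ z ∈ A, truncDist L c z = 1 := by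
  rcases A.eq_empty_or_nonempty with rfl | hne
  · exact ⟨0, le_rfl, by simp⟩
  obtain ⟨x, hx, hmin⟩ := hA.exists_isMinOn hne (f := fun z => infDist z (circ c))
    (continuous_infDist_pt _).continuousOn
  have h0 := infDist_circ_pos (h x hx)
  refine ⟨(infDist x (circ c))⁻¹, by positivity, fun z hz => min_eq_left ?_⟩
  have h2 : infDist x (circ c) ≤ infDist z (circ c) := hmin hz
  rw [inv_mul_eq_div, le_div_iff₀ h0]; linarith

lemma cls_nonempty {c d : Option (Word p)} (hcd : c ≠ d) : (Cls p (circ c) (circ d)).Nonempty := by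
  obtain ⟨L, hL, h⟩ := exists_truncDist_eq_one (c := c) (isCompact_circ d)
    fun z hz => circ_disjoint hcd.symm hz
  exact ⟨truncDist L c, adm_truncDist hL c, fun z _ => truncDist_mem hL c z,
    fun z hz => truncDist_eq_zero hz, h⟩

/-- Comparison of energies along a partial injection of the index sets. -/
lemma energy_le_of_injOn {I I' : Set (Option (Word p))} {u v : ℂ → ℝ} (hu : Adm p u)
    (D : Set (Option (Word p))) (τ : Option (Word p) → Option (Word p)) (hτ : InjOn τ D)
    (hD : ∀ c ∈ I, c ∉ D → osc v (circ c) = 0) (hI : ∀ c ∈ I, c ∈ D → τ c ∈ I')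
    (hle : ∀ c ∈ I, c ∈ D → osc v (circ c) ≤ osc u (circ (τ c))) :
    energy I v ≤ energy I' u := by
  have hs := hu.summable_indicator I'
  have hinj : Function.Injective fun c : (I ∩ D : Set (Option (Word p))) => τ c := fun a b h =>
    Subtype.ext (hτ a.2.2 b.2.2 h)
  have h1 : energy I v = ∑' c : (I ∩ D : Set (Option (Word p))), osc v (circ c.1) ^ 2 := by
    rw [tsum_subtype (I ∩ D) fun c => osc v (circ c) ^ 2, energy]
    congr 1
    funext c
    by_cases hc : c ∈ I
    · by_cases hcD : c ∈ D
      · rw [indicator_of_mem hc, indicator_of_mem (show c ∈ I ∩ D from ⟨hc, hcD⟩)]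
      · rw [indicator_of_mem hc, indicator_of_notMem (fun h => hcD h.2), hD c hc hcD]; simp
    · rw [indicator_of_notMem hc, indicator_of_notMem (fun h => hc h.1)]
  rw [h1, energy]
  have hle' : ∀ c : (I ∩ D : Set (Option (Word p))), osc v (circ c.1) ^ 2 ≤
      I'.indicator (fun c => osc u (circ c) ^ 2) (τ c) := fun c => by
    rw [indicator_of_mem (hI c c.2.1 c.2.2)]
    exact pow_le_pow_left₀ (osc_nonneg _ _) (hle c c.2.1 c.2.2) 2
  have hs2 := hs.comp_injective hinj
  exact (Summable.of_nonneg_of_le (fun _ => sq_nonneg _) hle' hs2).tsum_le_tsum_of_inj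
    (fun c : (I ∩ D : Set (Option (Word p))) => τ c) hinj
    (fun c _ => indicator_nonneg (fun _ _ => sq_nonneg _) _) hle' hs

end

noncomputable section

variable {p : ℕ} [hp : OddBase p]

open Classical in
/-- The composition of a function with a self-homeomorphism of the carpet. -/
def pull (f : ↥(sierpinskiCarpet p) ≃ₜ ↥(sierpinskiCarpet p)) (u : ℂ → ℝ) (z : ℂ) : ℝ :=
  if h : z ∈ sierpinskiCarpet p then u (f ⟨z, h⟩) else 0

lemma pull_apply (f : ↥(sierpinskiCarpet p) ≃ₜ ↥(sierpinskiCarpet p)) (u : ℂ → ℝ) {z : ℂ}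
    (h : z ∈ sierpinskiCarpet p) : pull f u z = u (f ⟨z, h⟩) := dif_pos h

lemma continuousOn_pull (f : ↥(sierpinskiCarpet p) ≃ₜ ↥(sierpinskiCarpet p)) {u : ℂ → ℝ}
    (hu : ContinuousOn u (sierpinskiCarpet p)) : ContinuousOn (pull f u) (sierpinskiCarpet p) := by
  rw [continuousOn_iff_continuous_domRestrict] at hu ⊢
  have : (sierpinskiCarpet p).domRestrict (pull f u) = (sierpinskiCarpet p).domRestrict u ∘ f := by
    funext z
    exact pull_apply f u z.2
  rw [this]
  exact hu.comp f.continuous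

lemma apply_mem_circ (f : ↥(sierpinskiCarpet p) ≃ₜ ↥(sierpinskiCarpet p)) {c : Option (Word p)}
    {z : ℂ} (h : z ∈ sierpinskiCarpet p) (hz : z ∈ circ c) :
    (f ⟨z, h⟩ : ℂ) ∈ circ (circPerm f c) := by
  rw [← push_circ]
  exact ⟨⟨z, h⟩, hz, rfl⟩

lemma osc_pull_circ (f : ↥(sierpinskiCarpet p) ≃ₜ ↥(sierpinskiCarpet p)) (u : ℂ → ℝ)
    (c : Option (Word p)) : osc (pull f u) (circ c) = osc u (circ (circPerm f c)) := by
  rw [osc, osc, ← push_circ, push, image_image]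
  congr 1
  ext t
  constructor
  · rintro ⟨z, hz, rfl⟩
    exact ⟨⟨z, circ_subset_carpet c hz⟩, hz, (pull_apply f u _).symm⟩
  · rintro ⟨z, hz, rfl⟩
    exact ⟨z, hz, pull_apply f u z.2⟩

lemma abs_re_sub_le_dist (x y : ℂ) : |x.re - y.re| ≤ dist x y := by
  rw [Complex.dist_eq, ← Complex.sub_re]; exact Complex.abs_re_le_norm _

lemma abs_im_sub_le_dist (x y : ℂ) : |x.im - y.im| ≤ dist x y := by
  rw [Complex.dist_eq, ← Complex.sub_im]; exact Complex.abs_im_le_norm _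

lemma exists_far_pair (w : Word p) : ∃ q ∈ circ (some w), ∃ q' ∈ circ (some w),
    (1 / p : ℝ) ^ w.length / p ≤ dist q q' := by
  have hpp := base_pos (p := p)
  have hpw := pow_base_pos (p := p) w.length
  have hm := cast_base (p := p)
  refine ⟨_, ⟨⟨mid p / p, mid p / p⟩, mem_middle_iff.2 ⟨?_, ?_⟩, rfl⟩, _,
    ⟨⟨(mid p + 1) / p, mid p / p⟩, mem_middle_iff.2 ⟨?_, ?_⟩, rfl⟩, ?_⟩
  · simp only [solidMid, mem_ofPred_eq, mul_div_cancel₀ _ hpp.ne', mem_Icc]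
    norm_num
  · simp [openMid, mul_div_cancel₀ _ hpp.ne']
  · simp only [solidMid, mem_ofPred_eq, mul_div_cancel₀ _ hpp.ne', mem_Icc]
    norm_num
  · simp [openMid, mul_div_cancel₀ _ hpp.ne']
  · refine le_trans ?_ (abs_re_sub_le_dist _ _)
    rw [wordMap_re, wordMap_re, abs_sub_comm]
    refine le_trans (le_of_eq ?_) (le_abs_self _)
    rw [div_pow, one_pow]
    field_simp
    ring

lemma exists_near_image {f : ↥(sierpinskiCarpet p) ≃ₜ ↥(sierpinskiCarpet p)} (hf : IsQSMap f)
    (l : ℕ) : ∃ l' : ℕ, ∀ w w' : Word p, circPerm f (some w) = some w' →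
      ∀ z (hz : z ∈ near l w), (f ⟨z, hz.1⟩ : ℂ) ∈ near l' w' := by
  obtain ⟨η, ⟨-, hmono, hη0, -⟩, hη⟩ := hf
  have hpp := base_pos (p := p)
  set K : ℝ := 4 * (l + 1) * p with hK
  have hK0 : 0 ≤ K := by positivity
  have hηK : 0 ≤ η K := by
    rw [← hη0]; exact hmono.monotoneOn (mem_Ici.2 le_rfl) (mem_Ici.2 hK0) hK0
  refine ⟨⌈4 * η K⌉₊ + 1, fun w w' hw z hz => ?_⟩
  obtain ⟨q, hq, q', hq', hqq⟩ := exists_far_pair w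
  have hpw : (0 : ℝ) < (1 / p : ℝ) ^ w.length := by positivity
  have hpw' := pow_base_pos (p := p) w'.length
  have hqS := circ_subset_carpet _ hq
  have hqS' := circ_subset_carpet _ hq'
  have hd0 : 0 < dist q q' := lt_of_lt_of_le (by positivity) hqq
  have hne : (⟨q, hqS⟩ : sierpinskiCarpet p) ≠ ⟨q', hqS'⟩ := fun h => by
    rw [Subtype.mk.injEq] at h
    rw [h, dist_self] at hd0
    exact lt_irrefl _ hd0
  have h1 := hη ⟨q, hqS⟩ ⟨z, hz.1⟩ ⟨q', hqS'⟩ hne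
  have hqn : q ∈ near (l + 1) w := near_mono (by omega) w (circ_subset_near w hq)
  have hzn : z ∈ near (l + 1) w := near_mono (by omega) w hz
  have h2 : dist q z ≤ 4 * (l + 1) * (1 / p : ℝ) ^ w.length := by
    obtain ⟨h3, h4⟩ := abs_sub_le_of_near hqn hzn
    push_cast at h3 h4
    linarith [dist_le_add q z]
  have h3 : dist q z / dist q q' ≤ K := by
    rw [div_le_iff₀ hd0]
    refine h2.trans ?_
    calc 4 * (l + 1) * (1 / p : ℝ) ^ w.length = K * ((1 / p : ℝ) ^ w.length / p) := by
          rw [hK]; field_simp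
      _ ≤ _ := by gcongr
  have h4 : η (dist q z / dist q q') ≤ η K :=
    hmono.monotoneOn (mem_Ici.2 (by positivity)) (mem_Ici.2 hK0) h3
  have hFq : (f ⟨q, hqS⟩ : ℂ) ∈ near 1 w' := by
    refine circ_subset_near w' ?_
    rw [← hw]; exact apply_mem_circ f hqS hq
  have hFq' : (f ⟨q', hqS'⟩ : ℂ) ∈ near 1 w' := by
    refine circ_subset_near w' ?_
    rw [← hw]; exact apply_mem_circ f hqS' hq'
  have h5 : dist (f ⟨q, hqS⟩ : ℂ) (f ⟨q', hqS'⟩) ≤ 4 * (1 / p : ℝ) ^ w'.length := by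
    obtain ⟨h6, h7⟩ := abs_sub_le_of_near hFq hFq'
    push_cast at h6 h7
    linarith [dist_le_add (f ⟨q, hqS⟩ : ℂ) (f ⟨q', hqS'⟩)]
  have h6 : dist (f ⟨q, hqS⟩ : ℂ) (f ⟨z, hz.1⟩) ≤ η K * (4 * (1 / p : ℝ) ^ w'.length) := by
    refine le_trans h1 (mul_le_mul h4 h5 dist_nonneg hηK)
  have h7 : p ^ w'.length * dist (f ⟨q, hqS⟩ : ℂ) (f ⟨z, hz.1⟩) ≤ ⌈4 * η K⌉₊ := by
    refine le_trans ?_ (Nat.le_ceil _)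
    calc p ^ w'.length * dist (f ⟨q, hqS⟩ : ℂ) (f ⟨z, hz.1⟩)
        ≤ p ^ w'.length * (η K * (4 * (1 / p : ℝ) ^ w'.length)) := by gcongr
      _ = _ := by rw [div_pow, one_pow]; field_simp
  have aux : ∀ a b c : ℝ, |p ^ w'.length * a - c| ≤ (1 : ℕ) →
      |a - b| ≤ dist (f ⟨q, hqS⟩ : ℂ) (f ⟨z, hz.1⟩) →
      |p ^ w'.length * b - c| ≤ ((⌈4 * η K⌉₊ + 1 : ℕ) : ℝ) := by
    intro a b c h8 h9
    have h10 : |p ^ w'.length * a - p ^ w'.length * b| ≤ (⌈4 * η K⌉₊ : ℝ) := by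
      rw [← mul_sub, abs_mul, abs_of_pos hpw']
      exact le_trans (by gcongr) h7
    push_cast at h8 ⊢
    rw [abs_le] at h8 h10 ⊢
    constructor <;> linarith
  exact ⟨(f ⟨z, hz.1⟩).2, aux _ _ _ hFq.2.1 (abs_re_sub_le_dist _ _),
    aux _ _ _ hFq.2.2 (abs_im_sub_le_dist _ _)⟩

lemma Adm.pull {f : ↥(sierpinskiCarpet p) ≃ₜ ↥(sierpinskiCarpet p)} (hf : IsQSMap f) {u : ℂ → ℝ}
    (hu : Adm p u) : Adm p (pull f u) := by
  refine ⟨continuousOn_pull f hu.1, fun l => ?_⟩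
  obtain ⟨l', hl'⟩ := exists_near_image hf l
  have hn : ∃ n₀ : ℕ, ∀ w : Word p, n₀ ≤ w.length → circPerm f (some w) ≠ none := by
    by_cases h : ∃ w : Word p, circPerm f (some w) = none
    · obtain ⟨w₀, hw₀⟩ := h
      refine ⟨w₀.length + 1, fun w hw h => ?_⟩
      have := Option.some_injective _ (circPerm_injective f (h.trans hw₀.symm))
      rw [this] at hw
      omega
    · push Not at h
      exact ⟨0, fun w _ => h w⟩
  obtain ⟨n₀, hn₀⟩ := hn
  refine summable_of_near (fun _ => sq_nonneg _) (fun _ => sq_nonneg _) (hu.2 l') n₀ 0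
    {w | circPerm f (some w) ≠ none} (fun w => (circPerm f (some w)).getD [])
    (fun w h1 h2 => absurd (hn₀ w h1) h2) (fun w hw _ => ?_) fun v hv w hw h => ?_
  · obtain ⟨w', hw'⟩ := Option.ne_none_iff_exists'.1 hw
    simp only [hw', Option.getD_some]
    refine pow_le_pow_left₀ (osc_nonneg _ _) (osc_le (osc_nonneg _ _) fun x hx y hy => ?_) 2
    rw [pull_apply f u hx.1, pull_apply f u hy.1]
    exact le_osc hu.1 (near_subset l' w') (hl' w w' hw' x hx) (hl' w w' hw' y hy)
  · obtain ⟨v', hv'⟩ := Option.ne_none_iff_exists'.1 hv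
    obtain ⟨w', hw'⟩ := Option.ne_none_iff_exists'.1 hw
    simp only [hw', hv', Option.getD_some] at h
    rw [h, ← hw'] at hv'
    rw [Option.some_injective _ (circPerm_injective f hv')]
    simp

lemma pull_mem_cls {f : ↥(sierpinskiCarpet p) ≃ₜ ↥(sierpinskiCarpet p)} (hf : IsQSMap f)
    {c d : Option (Word p)} {u : ℂ → ℝ} (hu : u ∈ Cls p (circ (circPerm f c))
      (circ (circPerm f d))) :
    pull f u ∈ Cls p (circ c) (circ d) := by
  refine ⟨hu.1.pull hf, fun z hz => ?_, fun z hz => ?_, fun z hz => ?_⟩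
  · rw [pull_apply f u hz]; exact hu.2.1 _ (f ⟨z, hz⟩).2
  · rw [pull_apply f u (circ_subset_carpet c hz)]
    exact hu.2.2.1 _ (apply_mem_circ f _ hz)
  · rw [pull_apply f u (circ_subset_carpet d hz)]
    exact hu.2.2.2 _ (apply_mem_circ f _ hz)

lemma cap_le_cap_image {f : ↥(sierpinskiCarpet p) ≃ₜ ↥(sierpinskiCarpet p)} (hf : IsQSMap f)
    {c d : Option (Word p)} (hcd : c ≠ d) {I I' : Set (Option (Word p))}
    (hI : ∀ c ∈ I, circPerm f c ∈ I') :
    cap I (circ c) (circ d) ≤ cap I' (circ (circPerm f c)) (circ (circPerm f d)) := by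
  refine le_csInf ((cls_nonempty fun h => hcd (circPerm_injective f h)).image _) ?_
  rintro _ ⟨u, hu, rfl⟩
  refine (cap_le (pull_mem_cls hf hu)).trans ?_
  exact energy_le_of_injOn hu.1 univ (circPerm f) (circPerm_injective f).injOn
    (fun c _ h => absurd (mem_univ c) h) (fun c hc _ => hI c hc)
    fun c _ _ => (osc_pull_circ f u c).le

end

noncomputable section

/-- A chain of closed sets covering an interval, overlapping only inside `G`, controls the
increment of a function over the interval. -/
lemma chain_bound {ι : Type*} (s : Finset ι) {A : ι → Set ℝ} {G : Set ℝ} {g : ℝ → ℝ} {o : ι → ℝ}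
    {b : ℝ} (hA : ∀ i, IsClosed (A i)) (ho : ∀ i, 0 ≤ o i)
    (hG : ∀ i ∈ s, ∀ j ∈ s, i ≠ j → A i ∩ A j ⊆ G)
    (hosc : ∀ i ∈ s, ∀ x ∈ A i ∩ G, ∀ y ∈ A i ∩ G, |g x - g y| ≤ o i) (hb : b ∈ G) :
    ∀ a ∈ G, a ≤ b → (∀ x ∈ Icc a b, ∃ i ∈ s, x ∈ A i) → |g a - g b| ≤ ∑ i ∈ s, o i := by
  classical
  induction s using Finset.strongInduction with
  | H s ih =>
  intro a ha hab hcov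
  obtain ⟨i, hi, hai⟩ := hcov a ⟨le_rfl, hab⟩
  have hc : IsCompact (A i ∩ Icc a b) := isCompact_Icc.inter_left (hA i)
  obtain ⟨c, ⟨hci, hac, hcb⟩, hmax⟩ := hc.exists_isMaxOn ⟨a, hai, le_rfl, hab⟩
    (f := id) continuous_id.continuousOn
  have hmax' : ∀ x ∈ A i, x ∈ Icc a b → x ≤ c := fun x h1 h2 =>
    hmax (show x ∈ A i ∩ Icc a b from ⟨h1, h2⟩)
  rw [← Finset.add_sum_erase s o hi]
  have hnn : 0 ≤ ∑ j ∈ s.erase i, o j := Finset.sum_nonneg fun j _ => ho j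
  rcases hcb.eq_or_lt with rfl | hlt
  · linarith [hosc i hi a ⟨hai, ha⟩ c ⟨hci, hb⟩]
  have hcl : IsClosed (⋃ j ∈ s.erase i, A j) :=
    (s.erase i).finite_toSet.isClosed_biUnion fun j _ => hA j
  have hsub : Ioc c b ⊆ ⋃ j ∈ s.erase i, A j := by
    intro x hx
    obtain ⟨j, hj, hxj⟩ := hcov x ⟨hac.trans hx.1.le, hx.2⟩
    have : j ≠ i := by
      rintro rfl
      exact absurd (hmax' x hxj ⟨hac.trans hx.1.le, hx.2⟩) (not_le.2 hx.1)
    exact mem_biUnion (Finset.mem_erase.2 ⟨this, hj⟩) hxj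
  have hsub2 : Icc c b ⊆ ⋃ j ∈ s.erase i, A j := by
    rw [← closure_Ioc hlt.ne]
    exact closure_minimal hsub hcl
  have hcov2 : ∀ x ∈ Icc c b, ∃ j ∈ s.erase i, x ∈ A j := fun x hx => by
    simpa using hsub2 hx
  obtain ⟨j, hj, hcj⟩ := hcov2 c ⟨le_rfl, hcb⟩
  have hcG : c ∈ G := hG i hi j (Finset.mem_of_mem_erase hj)
    (Finset.ne_of_mem_erase hj).symm ⟨hci, hcj⟩
  have h1 := hosc i hi a ⟨hai, ha⟩ c ⟨hci, hcG⟩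
  have h2 := ih (s.erase i) (Finset.erase_ssubset hi)
    (fun i hi j hj => hG i (Finset.mem_of_mem_erase hi) j (Finset.mem_of_mem_erase hj))
    (fun i hi => hosc i (Finset.mem_of_mem_erase hi)) c hcG hcb hcov2
  calc |g a - g b| ≤ |g a - g c| + |g c - g b| := abs_sub_le _ _ _
    _ ≤ _ := add_le_add h1 h2

lemma sum_length_bound {ι : Type*} (s : Finset ι) {lo len o : ι → ℝ} (hlen : ∀ i, 0 ≤ len i)
    (ho : ∀ i, 0 ≤ o i) {y₁ y₂ t : ℝ} (hy : y₁ ≤ y₂)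
    (h : ∀ y ∈ Icc y₁ y₂, t ≤ ∑ i ∈ s, (Icc (lo i) (lo i + len i)).indicator (fun _ => o i) y) :
    (y₂ - y₁) * t ≤ ∑ i ∈ s, len i * o i := by
  open MeasureTheory in
  have hfint : ∀ i, Integrable ((Icc (lo i) (lo i + len i)).indicator fun _ => o i) :=
    fun i => (integrable_indicator_iff measurableSet_Icc).2 (integrableOn_const (by simp))
  have h1 : ∫ y in Icc y₁ y₂, t ≤ ∫ y in Icc y₁ y₂,
      ∑ i ∈ s, (Icc (lo i) (lo i + len i)).indicator (fun _ => o i) y := by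
    refine setIntegral_mono_on (integrableOn_const (by simp)) ?_ measurableSet_Icc h
    exact (integrable_finsetSum s fun i _ => hfint i).integrableOn
  rw [integral_finsetSum s fun i _ => (hfint i).integrableOn] at h1
  rw [setIntegral_const, Measure.real, Real.volume_Icc, ENNReal.toReal_ofReal (by linarith),
    smul_eq_mul] at h1
  refine h1.trans (Finset.sum_le_sum fun i _ => ?_)
  calc ∫ y in Icc y₁ y₂, (Icc (lo i) (lo i + len i)).indicator (fun _ => o i) y
      ≤ ∫ y, (Icc (lo i) (lo i + len i)).indicator (fun _ => o i) y :=
        setIntegral_le_integral (hfint i)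
          (Filter.Eventually.of_forall fun y => indicator_nonneg (fun _ _ => ho i) y)
    _ = len i * o i := by
        rw [integral_indicator measurableSet_Icc, setIntegral_const, Measure.real, Real.volume_Icc,
          ENNReal.toReal_ofReal (by linarith [hlen i]), smul_eq_mul, add_sub_cancel_left]

variable {p : ℕ} [hp : OddBase p]

/-- The side length of the removed square with address `w`. -/
def side (w : Word p) : ℝ := (1 / p : ℝ) ^ (w.length + 1)

lemma side_pos (w : Word p) : 0 < side w := by
  have := base_pos (p := p)
  unfold side; positivity

lemma summable_side_sq : Summable fun w : Word p => side w ^ 2 := by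
  refine (summable_word_pow.mul_left ((1 / p : ℝ) ^ 2)).congr fun w => ?_
  rw [side, ← mul_pow, ← pow_succ']

lemma solid_im {w : Word p} {z : ℂ} (hz : z ∈ solid w) :
    z.im ∈ Icc ((cornerY w + mid p / p) / p ^ w.length : ℝ)
      ((cornerY w + mid p / p) / p ^ w.length + side w) := by
  obtain ⟨y, hy, rfl⟩ := hz
  have h0 := base_pos (p := p)
  have h1 := pow_base_pos (p := p) w.length
  rw [wordMap_im]
  have h2 := hy.2.1
  have h3 := hy.2.2
  constructor
  · rw [div_le_div_iff_of_pos_right h1]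
    have : (mid p / p : ℝ) ≤ y.im := by rw [div_le_iff₀ h0]; linarith
    linarith
  · rw [side, pow_succ', div_pow, one_pow, mul_one_div, ← add_div, div_le_div_iff_of_pos_right h1,
      add_assoc, ← add_div]
    have : y.im ≤ (mid p + 1) / p := by rw [le_div_iff₀ h0]; linarith
    linarith

lemma cell_im {w : Word p} {y : ℂ} (hy : y ∈ unitSq) :
    (wordMap w y).im ∈ Icc (cornerY w / p ^ w.length : ℝ)
      (cornerY w / p ^ w.length + (1 / p : ℝ) ^ w.length) := by
  have h1 := pow_base_pos (p := p) w.length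
  rw [wordMap_im, div_pow, one_pow, ← add_div]
  exact ⟨by gcongr; linarith [hy.2.1], by gcongr; exact hy.2.2⟩

/-- The addresses of the removed squares meeting `P`. -/
def meeting (p : ℕ) (P : Set ℂ) : Set (Word p) := {v | (solid v ∩ P).Nonempty}

lemma exists_level_small {K : Word p → ℝ} (hK : Summable K) {ε : ℝ} (hε : 0 < ε) :
    ∃ n : ℕ, ∀ s : Finset (Word p), (∀ w ∈ s, w.length = n) → ∑ w ∈ s, K w < ε := by
  obtain ⟨s₀, hs₀⟩ := summable_iff_vanishing_norm.1 hK ε hε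
  refine ⟨s₀.sup List.length + 1, fun s hs => ?_⟩
  refine lt_of_le_of_lt (le_abs_self _) (hs₀ s ?_)
  rw [Finset.disjoint_left]
  intro w hw hw0
  have := Finset.le_sup (f := List.length) hw0
  have := hs w hw
  omega

lemma line_bound_level {u : ℂ → ℝ} (hu : ContinuousOn u (sierpinskiCarpet p)) {a b y₁ y₂ t : ℝ}
    (hab : a ≤ b) (hy : y₁ ≤ y₂) {P : Set ℂ} (hP : P = Icc a b ×ℂ Icc y₁ y₂) (hPU : P ⊆ unitSq)
    (h1 : ∀ y ∈ Icc y₁ y₂, (⟨a, y⟩ : ℂ) ∈ sierpinskiCarpet p)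
    (h2 : ∀ y ∈ Icc y₁ y₂, (⟨b, y⟩ : ℂ) ∈ sierpinskiCarpet p)
    (h3 : ∀ y ∈ Icc y₁ y₂, t ≤ |u ⟨a, y⟩ - u ⟨b, y⟩|) (n : ℕ) (sv sw : Finset (Word p))
    (hsv : ∀ v, v ∈ sv ↔ v.length < n ∧ v ∈ meeting p P) (hsw : ∀ w, w ∈ sw ↔ w.length = n) :
    (y₂ - y₁) * t ≤ ∑ v ∈ sv, side v * osc u (circ (some v)) +
      ∑ w ∈ sw, (1 / p : ℝ) ^ w.length * osc u (near 1 w) := by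
  classical
  have hpp := base_pos (p := p)
  let lo : Word p ⊕ Word p → ℝ := Sum.elim
    (fun v => (cornerY v + mid p / p) / p ^ v.length) (fun w => cornerY w / p ^ w.length)
  let len : Word p ⊕ Word p → ℝ := Sum.elim side (fun w => (1 / p : ℝ) ^ w.length)
  let o : Word p ⊕ Word p → ℝ := Sum.elim (fun v => osc u (circ (some v))) (fun w =>
    osc u (near 1 w))
  have hlen : ∀ i, 0 ≤ len i := by
    rintro (v | w)
    · exact (side_pos v).le
    · simp only [len, Sum.elim_inr]; positivity
  have ho : ∀ i, 0 ≤ o i := by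
    rintro (v | w) <;> exact osc_nonneg _ _
  have key := sum_length_bound (sv.disjSum sw) (lo := lo) hlen ho (t := t) hy ?_
  · rwa [Finset.sum_disjSum] at key
  intro y hyJ
  let X : Word p ⊕ Word p → Set ℂ := Sum.elim (fun v => solid v) (fun w => wordMap w '' unitSq)
  have hX : ∀ i, IsClosed (X i) := by
    rintro (v | w)
    · exact isClosed_solid v
    · simp only [X, Sum.elim_inr]
      rw [image_eq_preimage]
      exact isClosed_unitSq.preimage (continuous_wordInv w)
  have hline : Continuous fun x : ℝ => (⟨x, y⟩ : ℂ) := by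
    have : (fun x : ℝ => (⟨x, y⟩ : ℂ)) = fun x : ℝ => ((x : ℂ) + y * Complex.I) := by
      funext x; exact Complex.mk_eq_add_mul_I x y
    rw [this]; fun_prop
  let A : Word p ⊕ Word p → Set ℝ := fun i => Icc a b ∩ (fun x : ℝ => (⟨x, y⟩ : ℂ)) ⁻¹' X i
  have hA : ∀ i, IsClosed (A i) := fun i => isClosed_Icc.inter ((hX i).preimage hline)
  refine (h3 y hyJ).trans ?_
  have hmemP : ∀ x ∈ Icc a b, (⟨x, y⟩ : ℂ) ∈ P := fun x hx => by
    rw [hP]; exact ⟨hx, hyJ⟩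
  refine chain_bound (g := fun x => u ⟨x, y⟩) (sv.disjSum sw) (A := A)
    (G := {x | (⟨x, y⟩ : ℂ) ∈ sierpinskiCarpet p}) hA (fun i => indicator_nonneg (fun _ _ =>
      ho i) y)
    ?_ ?_ (h2 y hyJ) a (h1 y hyJ) hab ?_
  · rintro (v | v) hv (w | w) hw hne x ⟨⟨hx, hxv⟩, -, hxw⟩
    · exact absurd hxw (solid_disjoint (fun h => hne (by rw [h])) hxv)
    · rw [Finset.inl_mem_disjSum, hsv] at hv
      rw [Finset.inr_mem_disjSum, hsw] at hw
      obtain ⟨z, hz, e⟩ := hxw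
      change (⟨x, y⟩ : ℂ) ∈ sierpinskiCarpet p
      change (⟨x, y⟩ : ℂ) ∈ solid v at hxv
      change wordMap w z = (⟨x, y⟩ : ℂ) at e
      rw [← e] at hxv ⊢
      exact solid_inter_cell (by omega) hz hxv
    · rw [Finset.inl_mem_disjSum, hsv] at hw
      rw [Finset.inr_mem_disjSum, hsw] at hv
      obtain ⟨z, hz, e⟩ := hxv
      change (⟨x, y⟩ : ℂ) ∈ sierpinskiCarpet p
      change (⟨x, y⟩ : ℂ) ∈ solid w at hxw
      change wordMap v z = (⟨x, y⟩ : ℂ) at e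
      rw [← e] at hxw ⊢
      exact solid_inter_cell (by omega) hz hxw
    · rw [Finset.inr_mem_disjSum, hsw] at hv hw
      obtain ⟨z, hz, e⟩ := hxv
      obtain ⟨z', hz', e'⟩ := hxw
      change (⟨x, y⟩ : ℂ) ∈ sierpinskiCarpet p
      change wordMap v z = (⟨x, y⟩ : ℂ) at e
      change wordMap w z' = _ at e'
      rw [← e]
      exact cell_inter_cell (hv.trans hw.symm) (fun h => hne (by rw [h])) hz hz' (e.trans e'.symm)
  · rintro (v | w) hv x ⟨⟨hx, hxv⟩, hxS⟩ x' ⟨⟨hx', hxv'⟩, hxS'⟩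
    · change (⟨x, y⟩ : ℂ) ∈ solid v at hxv
      rw [indicator_of_mem (show y ∈ Icc (lo (Sum.inl v)) (lo (Sum.inl v) + len (Sum.inl v)) from
        solid_im hxv)]
      exact le_osc hu (circ_subset_carpet _) (circ_of_solid_carpet hxv hxS)
        (circ_of_solid_carpet hxv' hxS')
    · obtain ⟨z, hz, e⟩ := hxv
      obtain ⟨z', hz', e'⟩ := hxv'
      change wordMap w z = _ at e
      change wordMap w z' = _ at e'
      have him := cell_im (w := w) hz
      rw [e] at him
      rw [indicator_of_mem (show y ∈ Icc (lo (Sum.inr w)) (lo (Sum.inr w) + len (Sum.inr w))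
        from him)]
      have m1 := wordMap_mem_near hz (by rw [e]; exact hxS)
      have m2 := wordMap_mem_near hz' (by rw [e']; exact hxS')
      rw [e] at m1
      rw [e'] at m2
      exact le_osc hu (near_subset 1 w) m1 m2
  · intro x hx
    rcases unitSq_covering (p := p) (hPU (hmemP x hx)) n with ⟨v, hv, hxv⟩ | ⟨w, hw, z, hz, e⟩
    · refine ⟨Sum.inl v, Finset.inl_mem_disjSum.2 ((hsv v).2 ⟨hv, _, hxv, hmemP x hx⟩), hx, hxv⟩
    · exact ⟨Sum.inr w, Finset.inr_mem_disjSum.2 ((hsw w).2 hw), hx, z, hz, e⟩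

lemma Adm.summable_side_mul {u : ℂ → ℝ} (hu : Adm p u) :
    Summable fun v : Word p => side v * osc u (circ (some v)) := by
  have h := (hu.summable_circ).comp_injective (Option.some_injective (Word p))
  refine Summable.of_nonneg_of_le (fun v => mul_nonneg (side_pos v).le (osc_nonneg _ _))
    (fun v => ?_)
    (summable_side_sq.add h)
  simp only [Function.comp]
  nlinarith [sq_nonneg (side v - osc u (circ (some v))), sq_nonneg (side v),
    sq_nonneg (osc u (circ (some v)))]

/-- The length-area inequality for a family of horizontal segments. -/
lemma line_bound {u : ℂ → ℝ} (hu : Adm p u) {a b y₁ y₂ t : ℝ}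
    (hab : a ≤ b) (hy : y₁ ≤ y₂) {P : Set ℂ} (hP : P = Icc a b ×ℂ Icc y₁ y₂) (hPU : P ⊆ unitSq)
    (h1 : ∀ y ∈ Icc y₁ y₂, (⟨a, y⟩ : ℂ) ∈ sierpinskiCarpet p)
    (h2 : ∀ y ∈ Icc y₁ y₂, (⟨b, y⟩ : ℂ) ∈ sierpinskiCarpet p)
    (h3 : ∀ y ∈ Icc y₁ y₂, t ≤ |u ⟨a, y⟩ - u ⟨b, y⟩|) :
    (y₂ - y₁) * t ≤ ∑' v, (meeting p P).indicator (fun v => side v * osc u (circ (some v))) v := by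
  classical
  have hpp := base_pos (p := p)
  refine le_of_forall_pos_le_add fun ε hε => ?_
  have hsum : Summable fun w : Word p => ((1 / p : ℝ) ^ w.length) ^ 2 + osc u (near 1 w) ^ 2 :=
    summable_word_pow.add (hu.2 1)
  obtain ⟨n, hn⟩ := exists_level_small hsum hε
  have f1 : {v : Word p | v.length < n ∧ v ∈ meeting p P}.Finite :=
    (List.finite_length_lt _ n).subset fun v hv => hv.1
  have f2 : {v : Word p | v.length = n}.Finite := List.finite_length_eq _ n
  have key := line_bound_level hu.1 hab hy hP hPU h1 h2 h3 n f1.toFinset f2.toFinset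
    (by simp) (by simp)
  refine key.trans (add_le_add ?_ ?_)
  · have hs := hu.summable_side_mul.indicator (meeting p P)
    refine le_trans (le_of_eq ?_) (hs.sum_le_tsum f1.toFinset fun v _ =>
      indicator_nonneg (fun v _ => mul_nonneg (side_pos v).le (osc_nonneg _ _)) v)
    refine Finset.sum_congr rfl fun v hv => ?_
    rw [indicator_of_mem ((f1.mem_toFinset.1 hv).2)]
  · refine le_trans (Finset.sum_le_sum fun w _ => ?_) (hn f2.toFinset (by simp)).le
    nlinarith [sq_nonneg ((1 / p : ℝ) ^ w.length - osc u (near 1 w)),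
      sq_nonneg ((1 / p : ℝ) ^ w.length), sq_nonneg (osc u (near 1 w))]

end

noncomputable section

open Filter Topology

lemma exists_finset_tail {ι : Type*} (f : ι → ℝ) {δ : ℝ} (hδ : 0 < δ) :
    ∃ F : Finset ι, ∑' i, ((F : Set ι)ᶜ).indicator f i < δ := by
  obtain ⟨F, hF⟩ := ((tendsto_tsum_compl_atTop_zero f).eventually (gt_mem_nhds hδ)).exists
  refine ⟨F, ?_⟩
  rw [← tsum_subtype]
  exact hF

/-- A sequence of almost minimizers cannot have slopes that are controlled to second order. -/
lemma not_summable_slopes {ι : Type*} {ℓ : ι → ℝ} (hℓ0 : ∀ i, 0 ≤ ℓ i) (hℓ1 : ∀ i, ℓ i ≤ 1)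
    (hℓ : Summable fun i => ℓ i ^ 2) {ρ : ℕ → ι → ℝ} (hρ : ∀ n i, ρ n i ∈ Icc (0 : ℝ) 1)
    {r : ℝ → ℕ → ι → ℝ} (hr0 : ∀ t n i, 0 ≤ r t n i) (hrρ : ∀ t n i, r t n i ≤ ρ n i)
    {E J : ℝ} (hE : 0 ≤ E) (hJ : 0 < J)
    (hs : ∀ t ∈ Ioc (0 : ℝ) 1, ∀ n, Summable fun i => ρ n i * r t n i)
    (hle : ∀ t ∈ Ioc (0 : ℝ) 1, ∀ n : ℕ, ∑' i, ρ n i * r t n i ≤ t ^ 2 * E + 1 / ((n : ℝ) + 1))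
    (hline : ∀ t ∈ Ioc (0 : ℝ) 1, ∀ n, J * t ≤ ∑' i, ℓ i * r t n i) : False := by
  classical
  have hlim : ∀ i, ∃ x, Tendsto (fun n => ρ n i) (hyperfilter ℕ : Filter ℕ) (𝓝 x) := by
    intro i
    obtain ⟨x, -, hx⟩ := (isCompact_Icc (a := (0 : ℝ)) (b := 1)).ultrafilter_le_nhds
      ((hyperfilter ℕ).map fun n => ρ n i) (by
        rw [Ultrafilter.coe_map, le_principal_iff]
        exact mem_map.2 (Eventually.of_forall fun n => hρ n i))
    exact ⟨x, hx⟩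
  choose x hx using hlim
  set A : ℝ := 8 * (E + 1) / J with hA
  have hA0 : 0 < A := by positivity
  obtain ⟨F, hF⟩ := exists_finset_tail (fun i => ℓ i ^ 2) (δ := J / (8 * A)) (by positivity)
  have hβ : ∃ β : ℝ, 0 < β ∧ ∀ i ∈ F, 0 < x i → β < x i := by
    have h1 : ∀ᶠ β in 𝓝[>] (0 : ℝ), ∀ i ∈ F, 0 < x i → β < x i := by
      rw [eventually_all_finset]
      intro i _
      by_cases h : 0 < x i
      · exact (eventually_nhdsWithin_of_eventually_nhds (gt_mem_nhds h)).mono fun _ h _ => h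
      · exact Eventually.of_forall fun _ h' => absurd h' h
    obtain ⟨β, h2, h3⟩ := (h1.and self_mem_nhdsWithin).exists
    exact ⟨β, h3, h2⟩
  obtain ⟨β, hβ0, hβ⟩ := hβ
  set t : ℝ := min 1 (J * β / (4 * (E + 1))) with ht
  have ht0 : 0 < t := lt_min one_pos (by positivity)
  have htI : t ∈ Ioc (0 : ℝ) 1 := ⟨ht0, min_le_left _ _⟩
  set F₀ : Finset ι := F.filter fun i => ¬ 0 < x i with hF₀
  have hle_atTop : (hyperfilter ℕ : Filter ℕ) ≤ atTop := by
    rw [← Nat.cofinite_eq_atTop]; exact hyperfilter_le_cofinite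
  have e1 : ∀ᶠ n : ℕ in (hyperfilter ℕ : Filter ℕ), 1 / ((n : ℝ) + 1) < t ^ 2 :=
    (tendsto_one_div_add_atTop_nhds_zero_nat.eventually (gt_mem_nhds (by positivity))).filter_mono
      hle_atTop
  have e2 : ∀ᶠ n : ℕ in (hyperfilter ℕ : Filter ℕ), ∀ i ∈ F, 0 < x i → β < ρ n i := by
    rw [eventually_all_finset]
    intro i hi
    by_cases h : 0 < x i
    · exact ((hx i).eventually (lt_mem_nhds (hβ i hi h))).mono fun _ h _ => h
    · exact Eventually.of_forall fun _ h' => absurd h' h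
  have e3 : ∀ᶠ n : ℕ in (hyperfilter ℕ : Filter ℕ), ∑ i ∈ F₀, ρ n i < J * t / 4 := by
    have h1 : Tendsto (fun n => ∑ i ∈ F₀, ρ n i) (hyperfilter ℕ : Filter ℕ) (𝓝 (∑ i ∈ F₀, x i)) :=
      tendsto_finsetSum _ fun i _ => hx i
    refine h1.eventually (gt_mem_nhds (lt_of_le_of_lt ?_ (by positivity)))
    exact Finset.sum_nonpos fun i hi => not_lt.1 (Finset.mem_filter.1 hi).2
  obtain ⟨n, h1, h2, h3⟩ := (e1.and (e2.and e3)).exists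
  have hsn := hs t htI n
  have hlen := hle t htI n
  have hterm : ∀ i, ℓ i * r t n i ≤ ((F : Set ι)ᶜ).indicator (fun i => A * t * ℓ i ^ 2) i +
      (1 / (A * t) + 1 / β) * (ρ n i * r t n i) + (F₀ : Set ι).indicator (ρ n) i := by
    intro i
    have a1 := hr0 t n i
    have a2 := hrρ t n i
    have a3 := hℓ0 i
    have a4 := hℓ1 i
    have a5 := (hρ n i).1
    have a6 : 0 ≤ ρ n i * r t n i := mul_nonneg a5 a1
    have a7 : 0 ≤ 1 / (A * t) := by positivity
    have a8 : 0 ≤ 1 / β := by positivity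
    have a9 : ℓ i * r t n i ≤ r t n i := by nlinarith
    by_cases hi : i ∈ F
    · rw [indicator_of_notMem (by simpa using hi), zero_add]
      by_cases hxi : 0 < x i
      · have hβi := h2 i hi hxi
        have h4 : r t n i ≤ 1 / β * (ρ n i * r t n i) := by
          rw [one_div, inv_mul_eq_div, le_div_iff₀ hβ0]
          nlinarith
        have h5 : 0 ≤ (F₀ : Set ι).indicator (ρ n) i := indicator_nonneg (fun j _ => (hρ n j).1) i
        nlinarith [mul_nonneg a7 a6]
      · rw [indicator_of_mem (show i ∈ (F₀ : Set ι) from Finset.mem_filter.2 ⟨hi, hxi⟩)]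
        nlinarith [mul_nonneg (add_nonneg a7 a8) a6]
    · rw [indicator_of_mem (show i ∈ (F : Set ι)ᶜ from hi)]
      have h5 : 0 ≤ (F₀ : Set ι).indicator (ρ n) i := indicator_nonneg (fun j _ => (hρ n j).1) i
      have hAt : 0 < A * t := by positivity
      have h6 : ℓ i * r t n i ≤ A * t * ℓ i ^ 2 + 1 / (A * t) * (r t n i) ^ 2 := by
        have h7 : 0 ≤ (A * t * ℓ i - r t n i) ^ 2 / (A * t) := by positivity
        have h8 : (A * t * ℓ i - r t n i) ^ 2 / (A * t) =
            A * t * ℓ i ^ 2 - 2 * (ℓ i * r t n i) + 1 / (A * t) * (r t n i) ^ 2 := by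
          field_simp
          ring
        have := mul_nonneg a3 a1
        linarith
      have h9 : 1 / (A * t) * (r t n i) ^ 2 ≤ 1 / (A * t) * (ρ n i * r t n i) := by
        refine mul_le_mul_of_nonneg_left ?_ a7
        nlinarith
      nlinarith [mul_nonneg a8 a6]
  have s1 : Summable (((F : Set ι)ᶜ).indicator fun i => A * t * ℓ i ^ 2) :=
    (hℓ.mul_left (A * t)).indicator _
  have s2 : Summable fun i => (1 / (A * t) + 1 / β) * (ρ n i * r t n i) := hsn.mul_left _
  have s3 : Summable ((F₀ : Set ι).indicator (ρ n)) :=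
    summable_of_hasFiniteSupport (F₀.finite_toSet.subset support_indicator_subset)
  have s0 : Summable fun i => ℓ i * r t n i :=
    Summable.of_nonneg_of_le (fun i => mul_nonneg (hℓ0 i) (hr0 t n i)) hterm ((s1.add s2).add s3)
  have hb := s0.tsum_le_tsum hterm ((s1.add s2).add s3)
  rw [(s1.add s2).tsum_add s3, s1.tsum_add s2, tsum_mul_left] at hb
  have b1 : ∑' i, ((F : Set ι)ᶜ).indicator (fun i => A * t * ℓ i ^ 2) i ≤ t * (J / 8) := by
    have h4 : (fun i => ((F : Set ι)ᶜ).indicator (fun i => A * t * ℓ i ^ 2) i) =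
        fun i => A * t * ((F : Set ι)ᶜ).indicator (fun i => ℓ i ^ 2) i := by
      funext i
      by_cases hi : i ∈ (F : Set ι)ᶜ
      · rw [indicator_of_mem hi, indicator_of_mem hi]
      · rw [indicator_of_notMem hi, indicator_of_notMem hi, mul_zero]
    rw [h4, tsum_mul_left]
    calc A * t * _ ≤ A * t * (J / (8 * A)) := by gcongr
      _ = t * (J / 8) := by field_simp
  have b3 : ∑' i, (F₀ : Set ι).indicator (ρ n) i < J * t / 4 := by
    rw [tsum_eq_sum (s := F₀) fun i hi => indicator_of_notMem (by simpa using hi) _]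
    refine lt_of_eq_of_lt (Finset.sum_congr rfl fun i hi => ?_) h3
    exact indicator_of_mem (by simpa using hi) _
  have hS : ∑' i, ρ n i * r t n i ≤ t ^ 2 * (E + 1) := by linarith
  have b2 : (1 / (A * t) + 1 / β) * ∑' i, ρ n i * r t n i ≤ J * t / 8 + J * t / 4 := by
    have c1 : (1 / (A * t) + 1 / β) * ∑' i, ρ n i * r t n i ≤
        (1 / (A * t) + 1 / β) * (t ^ 2 * (E + 1)) :=
      mul_le_mul_of_nonneg_left hS (by positivity)
    have c2 : 1 / (A * t) * (t ^ 2 * (E + 1)) = J * t / 8 := by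
      rw [hA]; field_simp
    have c3 : 1 / β * (t ^ 2 * (E + 1)) ≤ J * t / 4 := by
      have h5 : t ≤ J * β / (4 * (E + 1)) := min_le_right _ _
      rw [le_div_iff₀ (by positivity)] at h5
      rw [one_div, inv_mul_eq_div, div_le_iff₀ hβ0]
      nlinarith
    rw [add_mul] at c1
    linarith
  have := hline t htI n
  nlinarith [mul_pos hJ ht0]

variable {p : ℕ} [hp : OddBase p]

lemma exists_range {u : ℂ → ℝ} (hu : ContinuousOn u (sierpinskiCarpet p)) {A : Set ℂ}
    (hA : A ⊆ sierpinskiCarpet p) (hne : A.Nonempty) :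
    ∃ lo hi, lo ≤ hi ∧ osc u A = hi - lo ∧ ∀ x ∈ A, lo ≤ u x ∧ u x ≤ hi := by
  have hb := isBounded_image hu hA
  have hmem : ∀ x ∈ A, sInf (u '' A) ≤ u x ∧ u x ≤ sSup (u '' A) := fun x hx =>
    ⟨csInf_le hb.bddBelow (mem_image_of_mem u hx), le_csSup hb.bddAbove (mem_image_of_mem u hx)⟩
  obtain ⟨x, hx⟩ := hne
  exact ⟨_, _, (hmem x hx).1.trans (hmem x hx).2, Real.diam_eq hb, hmem⟩

lemma osc_le_of_range {u : ℂ → ℝ} {A : Set ℂ} {lo hi : ℝ} (h : lo ≤ hi)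
    (hu : ∀ x ∈ A, lo ≤ u x ∧ u x ≤ hi) : osc u A ≤ hi - lo :=
  osc_le (by linarith) fun x hx y hy => by
    rw [abs_le]; constructor <;> linarith [(hu x hx).1, (hu x hx).2, (hu y hy).1, (hu y hy).2]

lemma osc_min_max {u v : ℂ → ℝ} (hu : ContinuousOn u (sierpinskiCarpet p))
    (hv : ContinuousOn v (sierpinskiCarpet p)) {A : Set ℂ} (hA : A ⊆ sierpinskiCarpet p)
    (hne : A.Nonempty) :
    osc (fun z => min (u z) (v z)) A + osc (fun z => max (u z) (v z)) A ≤ osc u A + osc v A ∧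
    osc (fun z => min (u z) (v z)) A ^ 2 + osc (fun z => max (u z) (v z)) A ^ 2 ≤
      osc u A ^ 2 + osc v A ^ 2 := by
  obtain ⟨a, b, hab, e1, h1⟩ := exists_range hu hA hne
  obtain ⟨c, d, hcd, e2, h2⟩ := exists_range hv hA hne
  have m1 : osc (fun z => min (u z) (v z)) A ≤ min b d - min a c :=
    osc_le_of_range (min_le_min hab hcd) fun x hx =>
      ⟨min_le_min (h1 x hx).1 (h2 x hx).1, min_le_min (h1 x hx).2 (h2 x hx).2⟩
  have m2 : osc (fun z => max (u z) (v z)) A ≤ max b d - max a c :=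
    osc_le_of_range (max_le_max hab hcd) fun x hx =>
      ⟨max_le_max (h1 x hx).1 (h2 x hx).1, max_le_max (h1 x hx).2 (h2 x hx).2⟩
  rw [e1, e2]
  have n1 := osc_nonneg (fun z => min (u z) (v z)) A
  have n2 := osc_nonneg (fun z => max (u z) (v z)) A
  have q1 := pow_le_pow_left₀ n1 m1 2
  have q2 := pow_le_pow_left₀ n2 m2 2
  refine ⟨by linarith [min_add_max b d, min_add_max a c], (add_le_add q1 q2).trans ?_⟩
  rcases le_total a c with h3 | h3 <;> rcases le_total b d with h4 | h4 <;>
    simp only [min_eq_left h3, min_eq_left h4, max_eq_right h3, max_eq_right h4,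
      min_eq_right h3, min_eq_right h4, max_eq_left h3, max_eq_left h4] <;> nlinarith

lemma exists_truncDist_meeting {P : Set ℂ} (hP : IsCompact P) {c : Option (Word p)}
    (hPc : ∀ z ∈ P, z ∉ circ c) (hc : ∀ v ∈ meeting p P, some v ≠ c) :
    ∃ L : ℝ, 0 ≤ L ∧ ∀ v ∈ meeting p P, ∀ z ∈ circ (some v), truncDist L c z = 1 := by
  have hpp := base_pos (p := p)
  obtain ⟨δ, hδ, hdis⟩ := (disjoint_left.2 hPc).exists_cthickenings hP (isCompact_circ c).isClosed
  have hlim : Tendsto (fun n : ℕ => 2 * (1 / p : ℝ) ^ n) atTop (𝓝 0) := by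
    have := (tendsto_pow_atTop_nhds_zero_of_lt_one inv_base_mem.1.le
      (inv_base_mem (p := p)).2).const_mul 2
    rwa [mul_zero] at this
  obtain ⟨n, hn⟩ := eventually_atTop.1 (hlim.eventually (gt_mem_nhds hδ))
  have hfin : {v : Word p | v.length < n ∧ v ∈ meeting p P}.Finite :=
    (List.finite_length_lt _ n).subset fun v hv => hv.1
  have hcomp : IsCompact (cthickening δ P ∪ ⋃ v ∈ {v : Word p | v.length < n ∧ v ∈ meeting p P},
      circ (some v)) :=
    hP.cthickening.union (hfin.isCompact_biUnion fun v _ => isCompact_circ _)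
  obtain ⟨L, hL, h⟩ := exists_truncDist_eq_one (c := c) hcomp (by
    rintro z (hz | hz)
    · exact fun h => disjoint_left.1 hdis hz (self_subset_cthickening _ h)
    · simp only [mem_iUnion] at hz
      obtain ⟨v, hv, hzv⟩ := hz
      exact circ_disjoint (hc v hv.2) hzv)
  refine ⟨L, hL, fun v hv z hz => h z ?_⟩
  by_cases hvn : v.length < n
  · exact Or.inr (mem_biUnion (show v ∈ {v : Word p | v.length < n ∧ v ∈ meeting p P} from ⟨hvn,
      hv⟩) hz)
  · left
    obtain ⟨q, hq, hqP⟩ := hv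
    obtain ⟨y, hy, rfl⟩ := circ_some_subset_solid v hz
    obtain ⟨y', hy', rfl⟩ := hq
    refine mem_cthickening_of_dist_le _ _ _ _ hqP ((dist_wordMap_le v ?_ ?_).trans
      (hn _ (not_lt.1 hvn)).le)
    · exact openSq_subset (solidMid_subset_openSq hy)
    · exact openSq_subset (solidMid_subset_openSq hy')

lemma energy_add_le_of_min {I : Set (Option (Word p))} {u d : ℂ → ℝ} (hu : Adm p u) (hd : Adm p d)
    {B : Set (Word p)} (hB : ∀ v ∈ B, some v ∈ I) {t : ℝ} (ht : 0 ≤ t)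
    (hd1 : ∀ v ∈ B, ∀ z ∈ circ (some v), d z = 1) (hg : Adm p fun z => 1 - t * d z) :
    (Summable fun v => osc u (circ (some v)) *
      B.indicator (fun v => osc (fun z => max (u z) (1 - t)) (circ (some v))) v) ∧
    energy I (fun z => min (u z) (1 - t * d z)) + ∑' v, osc u (circ (some v)) *
      B.indicator (fun v => osc (fun z => max (u z) (1 - t)) (circ (some v))) v ≤
      energy I u + t ^ 2 * energy (univ : Set (Option (Word p))) d := by
  classical
  set r : Word p → ℝ := B.indicator (fun v => osc (fun z => max (u z) (1 - t)) (circ (some v)))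
    with hr
  set R : Option (Word p) → ℝ := fun c => c.elim 0 fun v => osc u (circ (some v)) * r v with hR
  have hcst : ContinuousOn (fun _ : ℂ => 1 - t) (sierpinskiCarpet p) := continuousOn_const
  have hosc0 : ∀ A : Set ℂ, osc (fun _ : ℂ => 1 - t) A = 0 := fun A => osc_eq_zero fun _ _ => rfl
  have hr0 : ∀ v, 0 ≤ r v := fun v => indicator_nonneg (fun _ _ => osc_nonneg _ _) v
  have hrle : ∀ v, r v ≤ osc u (circ (some v)) := by
    intro v
    by_cases hv : v ∈ B
    · rw [hr, indicator_of_mem hv]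
      have := (osc_min_max hu.1 hcst (circ_subset_carpet (some v)) (circ_nonempty _)).1
      rw [hosc0] at this
      linarith [osc_nonneg (fun z => min (u z) (1 - t)) (circ (some v))]
    · rw [hr, indicator_of_notMem hv]; exact osc_nonneg _ _
  have hR0 : ∀ c, 0 ≤ R c := by
    rintro (_ | v)
    · exact le_rfl
    · exact mul_nonneg (osc_nonneg _ _) (hr0 v)
  have hRs : Summable R := by
    refine Summable.of_nonneg_of_le hR0 (fun c => ?_) hu.summable_circ
    cases c with
    | none => exact sq_nonneg _
    | some v =>
      change osc u (circ (some v)) * r v ≤ _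
      nlinarith [hrle v, hr0 v]
  have hinj := Option.some_injective (Word p)
  refine ⟨hRs.comp_injective hinj, ?_⟩
  have hRt : ∑' v, osc u (circ (some v)) * r v = ∑' c, R c := by
    refine hinj.tsum_eq (f := R) fun c hc => ?_
    cases c with
    | none => exact absurd rfl hc
    | some v => exact ⟨v, rfl⟩
  rw [hRt, energy, energy, energy, ← tsum_mul_left]
  have hφ : Adm p fun z => min (u z) (1 - t * d z) := hu.min hg
  rw [← (hφ.summable_indicator I).tsum_add hRs,
    ← (hu.summable_indicator I).tsum_add ((hd.summable_indicator univ).mul_left _)]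
  refine ((hφ.summable_indicator I).add hRs).tsum_le_tsum (fun c => ?_)
    ((hu.summable_indicator I).add ((hd.summable_indicator univ).mul_left _))
  rw [indicator_of_mem (mem_univ c)]
  have hd2 : 0 ≤ t ^ 2 * osc d (circ c) ^ 2 := by positivity
  have hmm := osc_min_max hu.1 hg.1 (circ_subset_carpet c) (circ_nonempty c)
  have hgd : osc (fun z => 1 - t * d z) (circ c) ≤ t * osc d (circ c) := by
    refine osc_le (mul_nonneg ht (osc_nonneg _ _)) fun x hx y hy => ?_
    rw [show (1 - t * d x) - (1 - t * d y) = -(t * (d x - d y)) by ring, abs_neg, abs_mul,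
      abs_of_nonneg ht]
    exact mul_le_mul_of_nonneg_left (le_osc hd.1 (circ_subset_carpet c) hx hy) ht
  have hgd2 := pow_le_pow_left₀ (osc_nonneg _ _) hgd 2
  rw [mul_pow] at hgd2
  by_cases hcP : ∃ v ∈ B, c = some v
  · obtain ⟨v, hv, rfl⟩ := hcP
    rw [indicator_of_mem (hB v hv), indicator_of_mem (hB v hv)]
    change _ + osc u (circ (some v)) * r v ≤ _
    have hg0 : osc (fun z => 1 - t * d z) (circ (some v)) = 0 :=
      osc_eq_zero (a := 1 - t) fun z hz => by rw [hd1 v hv z hz, mul_one]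
    have hmx : osc (fun z => max (u z) (1 - t * d z)) (circ (some v)) = r v := by
      rw [hr, indicator_of_mem hv]
      exact osc_congr fun z hz => by rw [hd1 v hv z hz, mul_one]
    rw [hg0, hmx] at hmm
    have h1 := osc_nonneg (fun z => min (u z) (1 - t * d z)) (circ (some v))
    have h2 := hr0 v
    have h3 := hrle v
    have h4 := hmm.1
    nlinarith [pow_le_pow_left₀ h1 (show osc (fun z => min (u z) (1 - t * d z)) (circ (some v)) ≤
      osc u (circ (some v)) - r v by linarith) 2, mul_nonneg h2 (sub_nonneg.2 h3)]
  · have hRc : R c = 0 := by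
      cases c with
      | none => rfl
      | some v =>
        change osc u (circ (some v)) * r v = 0
        rw [hr, indicator_of_notMem fun h => hcP ⟨v, h, rfl⟩, mul_zero]
    rw [hRc, add_zero]
    by_cases hcI : c ∈ I
    · rw [indicator_of_mem hcI, indicator_of_mem hcI]
      linarith [hmm.2, sq_nonneg (osc (fun z => max (u z) (1 - t * d z)) (circ c))]
    · rw [indicator_of_notMem hcI, indicator_of_notMem hcI, zero_add]; exact hd2

/-- Almost minimizers that jump along a bundle of horizontal segments away from the circle `c`
can be improved, so that the capacity is strictly smaller than their limiting energy. -/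
lemma cap_lt_of_jump {I : Set (Option (Word p))} {C : Set ℂ} {c : Option (Word p)} {N : ℝ}
    (u : ℕ → ℂ → ℝ) (hu : ∀ n, u n ∈ Cls p C (circ c))
    (hN : ∀ n : ℕ, energy I (u n) ≤ N + 1 / ((n : ℝ) + 1)) {a b y₁ y₂ : ℝ}
    (hab : a ≤ b) (hy : y₁ < y₂) {P : Set ℂ} (hP : P = Icc a b ×ℂ Icc y₁ y₂) (hPU : P ⊆ unitSq)
    (h1 : ∀ y ∈ Icc y₁ y₂, (⟨a, y⟩ : ℂ) ∈ sierpinskiCarpet p)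
    (h2 : ∀ y ∈ Icc y₁ y₂, (⟨b, y⟩ : ℂ) ∈ sierpinskiCarpet p)
    (h3 : ∀ n, ∀ y ∈ Icc y₁ y₂, |u n ⟨a, y⟩ - u n ⟨b, y⟩| = 1)
    (hPc : ∀ z ∈ P, z ∉ circ c) (hc : ∀ v ∈ meeting p P, some v ≠ c)
    (hI : ∀ v ∈ meeting p P, some v ∈ I) : cap I C (circ c) < N := by
  by_contra hcap
  push Not at hcap
  have hPK : IsCompact P := by
    rw [hP]; exact isCompact_Icc.reProdIm isCompact_Icc
  obtain ⟨L, hL, hd1⟩ := exists_truncDist_meeting hPK hPc hc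
  set d := truncDist L c with hd
  have hdA : Adm p d := adm_truncDist hL c
  have hg : ∀ t ∈ Ioc (0 : ℝ) 1, Adm p fun z => 1 - t * d z := by
    intro t ht
    refine hdA.of_le hdA (continuousOn_const.sub (continuousOn_const.mul hdA.1)) fun x _ y _ => ?_
    rw [show (1 - t * d x) - (1 - t * d y) = -(t * (d x - d y)) by ring, abs_neg, abs_mul,
      abs_of_pos ht.1]
    nlinarith [abs_nonneg (d x - d y), ht.2]
  have hpp := inv_base_mem (p := p)
  have huI : ∀ n, ∀ v : Word p, osc (u n) (circ (some v)) ∈ Icc (0 : ℝ) 1 := fun n v =>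
    ⟨osc_nonneg _ _, (osc_le_of_range zero_le_one fun x hx =>
      (hu n).2.1 x (circ_subset_carpet _ hx)).trans (by norm_num)⟩
  have key := fun t ht n => energy_add_le_of_min (I := I) (hu n).1 hdA hI (le_of_lt (a :=
    (0 : ℝ)) (b := t) (And.left ht)) hd1
    (hg t ht)
  refine not_summable_slopes (ι := Word p) (ℓ := side) (fun v => (side_pos v).le)
    (fun v => pow_le_one₀ hpp.1.le hpp.2.le) summable_side_sq
    (ρ := fun n v => osc (u n) (circ (some v))) huI
    (r := fun t n => (meeting p P).indicator
      (fun v => osc (fun z => max (u n z) (1 - t)) (circ (some v))))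
    (fun t n v => indicator_nonneg (fun _ _ => osc_nonneg _ _) v) (fun t n v => ?_)
    (energy_nonneg (p := p) univ d) (sub_pos.2 hy) (fun t ht n => (key t ht n).1) (fun t ht n => ?_)
    (fun t ht n => ?_)
  · by_cases hv : v ∈ meeting p P
    · rw [indicator_of_mem hv]
      refine osc_le (osc_nonneg _ _) fun x hx y hy => ?_
      refine (abs_max_sub_max_le_max _ _ _ _).trans (max_le ?_ (by simpa using osc_nonneg _ _))
      exact le_osc (hu n).1.1 (circ_subset_carpet _) hx hy
    · rw [indicator_of_notMem hv]; exact osc_nonneg _ _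
  · have hmem : (fun z => min (u n z) (1 - t * d z)) ∈ Cls p C (circ c) := by
      have hdI := fun z => truncDist_mem (p := p) hL c z
      have htd : ∀ z, 0 ≤ t * d z ∧ t * d z ≤ 1 := fun z =>
        ⟨mul_nonneg ht.1.le (hdI z).1, mul_le_one₀ ht.2 (hdI z).1 (hdI z).2⟩
      refine ⟨(hu n).1.min (hg t ht), fun z hz => ⟨?_, ?_⟩, fun z hz => ?_, fun z hz => ?_⟩
      · exact le_min ((hu n).2.1 z hz).1 (by linarith [(htd z).2])
      · exact (min_le_left _ _).trans ((hu n).2.1 z hz).2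
      · simp only [(hu n).2.2.1 z hz]
        exact min_eq_left (by linarith [(htd z).2])
      · simp only [(hu n).2.2.2 z hz, hd, truncDist_eq_zero hz]
        norm_num
    have h4 := (key t ht n).2
    have h5 := cap_le (I := I) hmem
    have h6 := hN n
    linarith
  · have hA : Adm p fun z => max (u n z) (1 - t) := by
      refine (hu n).1.of_le (hu n).1 (ContinuousOn.sup (hu n).1.1 continuousOn_const)
        fun x _ y _ => ?_
      refine (abs_max_sub_max_le_max _ _ _ _).trans (max_le ?_ ?_)
      · linarith [abs_nonneg (u n x - u n y)]
      · simp only [sub_self, abs_zero]; positivity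
    refine (line_bound hA hab hy.le hP hPU h1 h2 (t := t) fun y hyJ => ?_).trans (le_of_eq ?_)
    · have h5 := h3 n y hyJ
      have h6 := (hu n).2.1 _ (h1 y hyJ)
      have h7 := (hu n).2.1 _ (h2 y hyJ)
      rcases le_total (u n ⟨b, y⟩) (u n ⟨a, y⟩) with h8 | h8
      · rw [abs_of_nonneg (by linarith)] at h5
        have e1 : u n ⟨a, y⟩ = 1 := by linarith [h6.2, h7.1]
        have e2 : u n ⟨b, y⟩ = 0 := by linarith [h6.2, h7.1]
        rw [e1, e2, max_eq_left (by linarith [ht.1]), max_eq_right (by linarith [ht.2])]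
        refine le_trans ?_ (le_abs_self _)
        linarith
      · rw [abs_of_nonpos (by linarith)] at h5
        have e1 : u n ⟨b, y⟩ = 1 := by linarith [h6.1, h7.2]
        have e2 : u n ⟨a, y⟩ = 0 := by linarith [h6.1, h7.2]
        rw [e1, e2, max_eq_left (a := (1 : ℝ)) (by linarith [ht.1]),
          max_eq_right (by linarith [ht.2]), abs_sub_comm]
        refine le_trans ?_ (le_abs_self _)
        linarith
    · refine tsum_congr fun v => ?_
      by_cases hv : v ∈ meeting p P
      · rw [indicator_of_mem hv, indicator_of_mem hv]
      · rw [indicator_of_notMem hv, indicator_of_notMem hv, mul_zero]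

end

noncomputable section

variable {p : ℕ} [hp : OddBase p]

lemma exists_outer_between {x y : ℂ} (hx : x ∈ unitSq) (hy : y ∉ unitSq) :
    ∃ b ∈ outerSquare, |x.re - b.re| ≤ |x.re - y.re| ∧ |x.im - b.im| ≤ |x.im - y.im| := by
  have key : ∀ s t : ℝ, s ∈ Icc (0 : ℝ) 1 → max 0 (min 1 t) ∈ Icc (0 : ℝ) 1 ∧
      |s - max 0 (min 1 t)| ≤ |s - t| ∧ (max 0 (min 1 t) ∈ Ioo (0 : ℝ) 1 → t ∈ Icc (0 : ℝ) 1) := by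
    intro s t hs
    refine ⟨⟨le_max_left _ _, max_le zero_le_one (min_le_left _ _)⟩, ?_, fun h => ?_⟩
    · have e : s = max 0 (min 1 s) := by rw [min_eq_right hs.2, max_eq_right hs.1]
      conv_lhs => rw [e]
      refine (abs_max_sub_max_le_max _ _ _ _).trans (max_le (by simp) ?_)
      exact (abs_min_sub_min_le_max _ _ _ _).trans (max_le (by simp) le_rfl)
    · constructor
      · by_contra h0
        push Not at h0
        rw [min_eq_right (by linarith), max_eq_left h0.le] at h
        exact lt_irrefl _ h.1
      · by_contra h0
        push Not at h0
        rw [min_eq_left h0.le, max_eq_right zero_le_one] at h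
        exact lt_irrefl _ h.2
  obtain ⟨a1, a2, a3⟩ := key x.re y.re hx.1
  obtain ⟨b1, b2, b3⟩ := key x.im y.im hx.2
  exact ⟨⟨_, _⟩, mem_outer_iff.2 ⟨⟨a1, b1⟩, fun h => hy ⟨a3 h.1, b3 h.2⟩⟩, a2, b2⟩

open Classical in
/-- The function `u ∘ τ`, continued by the constant `e` outside the preimage of the unit square. -/
def patch (τ : ℂ → ℂ) (e : ℝ) (u : ℂ → ℝ) (z : ℂ) : ℝ := if τ z ∈ unitSq then u (τ z) else e

lemma patch_of_mem {τ : ℂ → ℂ} {e : ℝ} {u : ℂ → ℝ} {z : ℂ} (h : τ z ∈ unitSq) :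
    patch τ e u z = u (τ z) := if_pos h

lemma patch_of_notMem {τ : ℂ → ℂ} {e : ℝ} {u : ℂ → ℝ} {z : ℂ} (h : τ z ∉ unitSq) :
    patch τ e u z = e := if_neg h

/-- Maps that enlarge differences of coordinates by the factor `p ^ k` and send points of the
carpet to the carpet or outside the unit square. -/
structure IsZoom (p : ℕ) (k : ℕ) (τ : ℂ → ℂ) : Prop where
  re : ∀ x y, |(τ x).re - (τ y).re| = p ^ k * |x.re - y.re|
  im : ∀ x y, |(τ x).im - (τ y).im| = p ^ k * |x.im - y.im|
  mem : ∀ z ∈ sierpinskiCarpet p, τ z ∈ unitSq → τ z ∈ sierpinskiCarpet p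

lemma patch_sub_le {k : ℕ} {τ : ℂ → ℂ} (hτ : IsZoom p k τ) {e : ℝ} {u : ℂ → ℝ}
    (hO : ∀ z ∈ outerSquare, u z = e) {x y : ℂ}
    (hy : y ∈ sierpinskiCarpet p) (hxu : τ x ∈ unitSq) :
    ∃ b ∈ sierpinskiCarpet p, u b = patch τ e u y ∧
      |(τ x).re - b.re| ≤ p ^ k * |x.re - y.re| ∧ |(τ x).im - b.im| ≤ p ^ k * |x.im - y.im| := by
  by_cases hyu : τ y ∈ unitSq
  · exact ⟨τ y, hτ.mem y hy hyu, (patch_of_mem hyu).symm, (hτ.re x y).le, (hτ.im x y).le⟩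
  · obtain ⟨b, hb, h1, h2⟩ := exists_outer_between hxu hyu
    refine ⟨b, outer_subset_carpet hb, ?_, h1.trans (hτ.re x y).le, h2.trans (hτ.im x y).le⟩
    rw [patch_of_notMem hyu, hO b hb]

lemma continuousOn_of_modulus {u v : ℂ → ℝ} (hu : ContinuousOn u (sierpinskiCarpet p)) {K : ℝ}
    (hK : 0 < K)
    (h : ∀ x ∈ sierpinskiCarpet p, ∀ y ∈ sierpinskiCarpet p, v x = v y ∨
      ∃ a ∈ sierpinskiCarpet p, ∃ b ∈ sierpinskiCarpet p, |v x - v y| = |u a - u b| ∧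
      |a.re - b.re| ≤ K * |x.re - y.re| ∧ |a.im - b.im| ≤ K * |x.im - y.im|) :
    ContinuousOn v (sierpinskiCarpet p) := by
  have huc := isCompact_carpet.uniformContinuousOn_of_continuous hu
  rw [Metric.uniformContinuousOn_iff] at huc
  rw [Metric.continuousOn_iff]
  intro y hy ε hε
  obtain ⟨δ, hδ, hd⟩ := huc ε hε
  refine ⟨δ / (2 * K), by positivity, fun x hx hxy => ?_⟩
  rcases h x hx y hy with h1 | ⟨a, ha, b, hb, h1, h2, h3⟩
  · rw [h1, dist_self]; exact hε
  · rw [Real.dist_eq, h1]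
    refine hd a ha b hb ?_
    have h4 := dist_le_add a b
    have h5 : K * |x.re - y.re| ≤ K * dist x y := by gcongr; exact abs_re_sub_le_dist x y
    have h6 : K * |x.im - y.im| ≤ K * dist x y := by gcongr; exact abs_im_sub_le_dist x y
    rw [lt_div_iff₀ (by positivity)] at hxy
    nlinarith

lemma continuousOn_patch {k : ℕ} {τ : ℂ → ℂ} (hτ : IsZoom p k τ) {e : ℝ} {u : ℂ → ℝ}
    (hO : ∀ z ∈ outerSquare, u z = e) (hu : ContinuousOn u (sierpinskiCarpet p)) :
    ContinuousOn (patch τ e u) (sierpinskiCarpet p) := by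
  refine continuousOn_of_modulus hu (pow_base_pos (p := p) k) fun x hx y hy => ?_
  by_cases hxu : τ x ∈ unitSq
  · obtain ⟨b, hb, h1, h2, h3⟩ := patch_sub_le hτ hO hy hxu
    exact Or.inr ⟨τ x, hτ.mem x hx hxu, b, hb, by rw [patch_of_mem hxu, h1], h2, h3⟩
  by_cases hyu : τ y ∈ unitSq
  · obtain ⟨b, hb, h1, h2, h3⟩ := patch_sub_le hτ hO hx hyu
    refine Or.inr ⟨τ y, hτ.mem y hy hyu, b, hb, ?_, ?_, ?_⟩
    · rw [patch_of_mem hyu, h1, abs_sub_comm]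
    · rwa [abs_sub_comm x.re]
    · rwa [abs_sub_comm x.im]
  · left; rw [patch_of_notMem hxu, patch_of_notMem hyu]

lemma Adm.patch {k : ℕ} {τ : ℂ → ℂ} (hτ : IsZoom p k τ) {e : ℝ} {u : ℂ → ℝ}
    (hO : ∀ z ∈ outerSquare, u z = e) (hu : Adm p u) : Adm p (patch τ e u) := by
  classical
  refine ⟨continuousOn_patch hτ hO hu.1, fun l => ?_⟩
  set s : Set (Word p) := {w | k ≤ w.length ∧ ∃ z ∈ near l w, τ z ∈ unitSq} with hs
  have hex : ∀ w : Word p, w ∈ s → ∃ z ∈ near l w, τ z ∈ unitSq ∧ ∃ w' : Word p,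
      w'.length + k = w.length ∧ τ z ∈ near 1 w' := by
    rintro w ⟨hk, z, hz, hzu⟩
    have hzS := hτ.mem z hz.1 hzu
    obtain ⟨w', hlen, y, hy, hyz⟩ := exists_word hzS (w.length - k)
    refine ⟨z, hz, hzu, w', by omega, ?_⟩
    rw [← hyz] at hzS ⊢
    exact wordMap_mem_near (carpet_subset_unitSq hy) hzS
  choose! ζ hζ1 hζ2 g hg1 hg2 using hex
  have hpow : ∀ w ∈ s, (p : ℝ) ^ (g w).length * p ^ k = p ^ w.length := fun w hw => by
    rw [← pow_add, hg1 w hw]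
  refine summable_of_near (fun _ => sq_nonneg _) (fun _ => sq_nonneg _) (hu.2 (2 * l + 1)) k
    (2 * l + 2) s g (fun w hk hw => ?_) (fun w hw _ => ?_) fun v hv w hw h => ?_
  · have : osc (Carpet.patch τ e u) (near l w) = 0 := osc_eq_zero (a := e) fun z hz =>
      patch_of_notMem fun h => hw ⟨hk, z, hz, h⟩
    rw [this]; simp
  · have hmem : ∀ z ∈ near l w, ∃ b ∈ near (2 * l + 1) (g w), u b = Carpet.patch τ e u z := by
      intro z hz
      obtain ⟨b, hb, h1, h2, h3⟩ := patch_sub_le hτ hO hz.1 (hζ2 w hw)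
      obtain ⟨h4, h5⟩ := abs_sub_le_of_near (hζ1 w hw) hz
      have aux : ∀ t b x y c : ℝ, |t - b| ≤ p ^ k * |x - y| →
          |x - y| ≤ 2 * l * (1 / p : ℝ) ^ w.length → |p ^ (g w).length * t - c| ≤ (1 : ℕ) →
          |p ^ (g w).length * b - c| ≤ ((2 * l + 1 : ℕ) : ℝ) := by
        intro t b x y c i1 i2 i3
        have i4 : |p ^ (g w).length * t - p ^ (g w).length * b| ≤ 2 * l := by
          rw [← mul_sub, abs_mul, abs_of_pos (pow_base_pos _)]
          have h0 := pow_base_pos (p := p) w.length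
          have := base_pos (p := p)
          calc (p : ℝ) ^ (g w).length * |t - b|
              ≤ p ^ (g w).length * (p ^ k * (2 * l * (1 / p : ℝ) ^ w.length)) := by
                gcongr; exact i1.trans (by gcongr)
            _ = p ^ w.length * (2 * l * (1 / p : ℝ) ^ w.length) := by
                rw [← hpow w hw]; ring
            _ = 2 * l := by rw [div_pow, one_pow]; field_simp
        push_cast at i3 ⊢
        rw [abs_le] at i3 i4 ⊢
        constructor <;> linarith
      exact ⟨b, ⟨hb, aux _ _ _ _ _ h2 h4 (hg2 w hw).2.1, aux _ _ _ _ _ h3 h5 (hg2 w hw).2.2⟩, h1⟩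
    refine pow_le_pow_left₀ (osc_nonneg _ _) (osc_le (osc_nonneg _ _) fun x hx y hy => ?_) 2
    obtain ⟨a, ha, e1⟩ := hmem x hx
    obtain ⟨b, hb, e2⟩ := hmem y hy
    rw [← e1, ← e2]
    exact le_osc hu.1 (near_subset _ _) ha hb
  · have hlen : v.length = w.length := by rw [← hg1 v hv, ← hg1 w hw, h]
    have n1 := hg2 v hv
    have n2 := hg2 w hw
    rw [h] at n1
    have h0 := pow_base_pos (p := p) (g w).length
    have aux : ∀ (a b x y c : ℝ) (i j : ℕ), |a - b| = p ^ k * |x - y| →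
        |p ^ (g w).length * a - c| ≤ (1 : ℕ) → |p ^ (g w).length * b - c| ≤ (1 : ℕ) →
        |p ^ w.length * x - i| ≤ l → |p ^ w.length * y - j| ≤ l →
        |(i : ℤ) - j| ≤ ((2 * l + 2 : ℕ) : ℤ) := by
      intro a b x y c i j i1 i2 i3 i4 i5
      have i6 : p ^ (g w).length * |a - b| ≤ 2 := by
        rw [← abs_of_pos h0, ← abs_mul, mul_sub]
        push_cast at i2 i3
        rw [abs_le] at i2 i3 ⊢
        constructor <;> linarith
      rw [i1, ← mul_assoc, hpow w hw, ← abs_of_pos (pow_base_pos (p := p) w.length), ← abs_mul,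
        mul_sub] at i6
      have : |((i : ℤ) : ℝ) - (j : ℤ)| ≤ (((2 * l + 2 : ℕ) : ℤ) : ℝ) := by
        push_cast
        rw [abs_le] at i4 i5 i6 ⊢
        constructor <;> linarith
      exact_mod_cast this
    have z1 := hζ1 v hv
    have z2 := hζ1 w hw
    rw [near, hlen] at z1
    exact ⟨hlen, aux _ _ _ _ _ _ _ (hτ.re _ _) n1.2.1 n2.2.1 z1.2.1 z2.2.1,
      aux _ _ _ _ _ _ _ (hτ.im _ _) n1.2.2 n2.2.2 z1.2.2 z2.2.2⟩

lemma patch_mem_Icc {k : ℕ} {τ : ℂ → ℂ} (hτ : IsZoom p k τ) {u : ℂ → ℝ}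
    (hu : ∀ z ∈ sierpinskiCarpet p, u z ∈ Icc (0 : ℝ) 1) {z : ℂ} (hz : z ∈ sierpinskiCarpet p) :
    patch τ 1 u z ∈ Icc (0 : ℝ) 1 := by
  by_cases h : τ z ∈ unitSq
  · rw [patch_of_mem h]; exact hu _ (hτ.mem z hz h)
  · rw [patch_of_notMem h]; exact ⟨zero_le_one, le_rfl⟩

/-- A patched function is constant where `τ` leaves the open unit square. -/
lemma patch_eq {τ : ℂ → ℂ} {e : ℝ} {u : ℂ → ℝ} (hO : ∀ z ∈ outerSquare, u z = e) {z : ℂ}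
    (hz : τ z ∉ openSq) : patch τ e u z = e := by
  by_cases h : τ z ∈ unitSq
  · rw [patch_of_mem h]; exact hO _ (mem_outer_iff.2 ⟨h, hz⟩)
  · exact patch_of_notMem h

lemma osc_patch {τ : ℂ → ℂ} {e : ℝ} {u : ℂ → ℝ} {c c' : Option (Word p)}
    (h : τ '' circ c = circ c') : osc (patch τ e u) (circ c) = osc u (circ c') := by
  rw [osc, osc, ← h, image_image]
  congr 1
  refine image_congr fun z hz => patch_of_mem ?_
  have : τ z ∈ circ c' := h ▸ mem_image_of_mem τ hz
  exact carpet_subset_unitSq (circ_subset_carpet c' this)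

/-- Energies of patched functions. -/
lemma energy_patch_le {τ : ℂ → ℂ} (hτ : Function.Injective τ) {e : ℝ} {u : ℂ → ℝ} (hu : Adm p u)
    (hO : ∀ z ∈ outerSquare, u z = e) {I I' : Set (Option (Word p))}
    (h : ∀ c ∈ I, (∀ z ∈ circ c, τ z ∉ openSq) ∨ ∃ c' ∈ I', τ '' circ c = circ c') :
    energy I (patch τ e u) ≤ energy I' u := by
  classical
  set D : Set (Option (Word p)) := {c | ∃ c' ∈ I', τ '' circ c = circ c'} with hD
  have hex : ∀ c : Option (Word p), c ∈ D → ∃ c' ∈ I', τ '' circ c = circ c' := fun c hc => hc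
  choose! σ h1 h2 using hex
  refine energy_le_of_injOn hu D σ (fun a ha b hb hab => ?_) (fun c hc hcD => ?_)
    (fun c _ hcD => h1 c hcD) fun c _ hcD => (osc_patch (h2 c hcD)).le
  · have h3 := (h2 a ha).trans ((congrArg circ hab).trans (h2 b hb).symm)
    exact circ_injective (hτ.image_injective h3)
  · exact osc_eq_zero (a := e) fun z hz => patch_eq hO (((h c hc).resolve_right hcD) z hz)

lemma IsZoom.injective {k : ℕ} {τ : ℂ → ℂ} (hτ : IsZoom p k τ) : Function.Injective τ := by
  intro x y h
  have h0 := (pow_base_pos (p := p) k).ne'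
  have h1 := hτ.re x y
  have h2 := hτ.im x y
  rw [h, sub_self, abs_zero, eq_comm, mul_eq_zero, or_iff_right h0, abs_eq_zero,
    sub_eq_zero] at h1 h2
  exact Complex.ext h1 h2

end

noncomputable section

variable {p : ℕ} [hp : OddBase p]

lemma isZoom_wordInv (w : Word p) : IsZoom p w.length (wordInv w) where
  re x y := by
    simp only [wordInv]
    rw [sub_sub_sub_cancel_right, ← mul_sub, abs_mul, abs_of_pos (pow_base_pos _)]
  im x y := by
    simp only [wordInv]
    rw [sub_sub_sub_cancel_right, ← mul_sub, abs_mul, abs_of_pos (pow_base_pos _)]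
  mem z hz h := mem_carpet_of_wordMap w h (by rwa [wordMap_wordInv])

lemma wordInv_image_circ (w v : Word p) :
    wordInv w '' circ (some (w ++ v)) = circ (some v) := by
  have : circ (some (w ++ v)) = wordMap w '' circ (some v) := by
    simp only [circ, image_image, wordMap_append]
  rw [this, image_image]
  simp [wordInv_wordMap]

/-- The closed set bounded by a peripheral square inside the unit square, or the outer square. -/
def fill : Option (Word p) → Set ℂ
  | none => outerSquare
  | some w => solid w

lemma circ_subset_fill (c : Option (Word p)) : circ c ⊆ fill c := by
  cases c with
  | none => exact subset_rfl
  | some w => exact circ_some_subset_solid w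

/-- A peripheral square that does not lie in the interior of the cell `w`. -/
def Outside (w : Word p) (c : Option (Word p)) : Prop := ∀ v, c = some v → ¬ w <+: v

lemma Outside.notMem_fill {w : Word p} {c : Option (Word p)} (hc : Outside w c) {y : ℂ}
    (hy : y ∈ openSq) : wordMap w y ∉ fill c := by
  cases c with
  | none => exact fun h => (mem_outer_iff.1 h).2 (wordMap_mem_openSq w hy)
  | some v => exact openCell_not_solid (hc v rfl) hy

lemma Outside.side {w : Word p} (hw : w ≠ []) {c : Option (Word p)} (hc : Outside w c) :
    (∀ t ∈ Ioo (0 : ℝ) 1, wordMap w ⟨0, t⟩ ∉ fill c) ∨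
      ∀ t ∈ Ioo (0 : ℝ) 1, wordMap w ⟨1, t⟩ ∉ fill c := by
  by_contra h
  push Not at h
  obtain ⟨⟨s, hs, h1⟩, t, ht, h2⟩ := h
  have h0 := pow_base_pos (p := p) w.length
  cases c with
  | none =>
    have hX : (cornerX w : ℝ) + 1 ≤ p ^ w.length := by exact_mod_cast cornerX_lt w
    have hY : (cornerY w : ℝ) + 1 ≤ p ^ w.length := by exact_mod_cast cornerY_lt w
    have hX0 : (0 : ℝ) ≤ cornerX w := Nat.cast_nonneg _
    have hY0 : (0 : ℝ) ≤ cornerY w := Nat.cast_nonneg _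
    have key : ∀ r q : ℝ, q ∈ Ioo (0 : ℝ) 1 → wordMap w ⟨r, q⟩ ∈ outerSquare →
        0 < cornerX w + r → cornerX w + r < p ^ w.length → False := by
      intro r q hq h i1 i2
      refine (mem_outer_iff.1 h).2 ⟨?_, ?_⟩
      · rw [wordMap_re]
        exact ⟨by positivity, by rw [div_lt_one h0]; exact i2⟩
      · rw [wordMap_im]
        exact ⟨div_pos (by linarith [hq.1]) h0, by rw [div_lt_one h0]; linarith [hq.2]⟩
    have e1 : (cornerX w : ℝ) = 0 := by
      by_contra hne
      exact key 0 s hs h1 (by rw [add_zero]; exact lt_of_le_of_ne hX0 (Ne.symm hne)) (by linarith)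
    have e2 : (p : ℝ) ^ w.length ≤ 1 := by
      by_contra hlt
      push Not at hlt
      exact key 1 t ht h2 (by linarith) (by rw [e1]; linarith)
    have h3 : 1 < (p : ℝ) := by linarith [three_le_cast (p := p)]
    have h4 := one_lt_pow₀ h3 (n := w.length) (by simpa using hw)
    linarith
  | some v =>
    refine hc.notMem_fill (y := ⟨1 / 2, (s + t) / 2⟩) ⟨by constructor <;> norm_num,
      by constructor <;> simp only <;> linarith [hs.1, hs.2, ht.1, ht.2]⟩ ?_
    have er : (wordMap w ⟨1 / 2, (s + t) / 2⟩).re =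
      ((wordMap w ⟨0, s⟩).re + (wordMap w ⟨1, t⟩).re) / 2 := by
      simp only [wordMap_re]; ring
    have ei : (wordMap w ⟨1 / 2, (s + t) / 2⟩).im =
      ((wordMap w ⟨0, s⟩).im + (wordMap w ⟨1, t⟩).im) / 2 := by
      simp only [wordMap_im]; ring
    simp only [fill, solid, mem_wordMap_image, solidMid, wordInv, mem_ofPred_eq, mem_Icc] at h1 h2 ⊢
    rw [er, ei]
    obtain ⟨⟨a1, a2⟩, a3, a4⟩ := h1
    obtain ⟨⟨b1, b2⟩, b3, b4⟩ := h2
    refine ⟨⟨?_, ?_⟩, ?_, ?_⟩ <;> linarith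

/-- The lower left corner of the peripheral square with address `w`. -/
def lowCorner (w : Word p) : ℂ := wordMap w ⟨mid p / p, mid p / p⟩

/-- The upper right corner of the peripheral square with address `w`. -/
def highCorner (w : Word p) : ℂ := wordMap w ⟨(mid p + 1) / p, (mid p + 1) / p⟩

lemma lowCorner_mem (w : Word p) : lowCorner w ∈ openSq := by
  have := base_pos (p := p)
  refine solid_subset_openSq w ⟨_, ?_, rfl⟩
  simp only [solidMid, mem_ofPred_eq]
  rw [mul_div_cancel₀ _ this.ne']
  simp

lemma highCorner_mem (w : Word p) : highCorner w ∈ openSq := by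
  have := base_pos (p := p)
  refine solid_subset_openSq w ⟨_, ?_, rfl⟩
  simp only [solidMid, mem_ofPred_eq]
  rw [mul_div_cancel₀ _ this.ne']
  simp

lemma lowCorner_im_lt (w : Word p) : (lowCorner w).im < (highCorner w).im := by
  have h0 := pow_base_pos (p := p) w.length
  have := base_pos (p := p)
  simp only [lowCorner, highCorner, wordMap_im]
  gcongr
  linarith

lemma mk_mem_circ (w : Word p) {x y : ℂ} (hx : x = lowCorner w ∨ x = highCorner w)
    (h1 : y.re = x.re) (h2 : y.im ∈ Icc (lowCorner w).im (highCorner w).im) :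
    y ∈ circ (some w) := by
  have hp0 := base_pos (p := p)
  have h0 := pow_base_pos (p := p) w.length
  have hre : p * (wordInv w y).re = mid p ∨ p * (wordInv w y).re = mid p + 1 := by
    simp only [wordInv]
    rw [h1]
    rcases hx with rfl | rfl
    · left; simp only [lowCorner]; rw [scaled_wordMap_re]; field_simp; ring
    · right; simp only [highCorner]; rw [scaled_wordMap_re]; field_simp; ring
  have him : p * (wordInv w y).im ∈ Icc (mid p : ℝ) (mid p + 1) := by
    have e1 := scaled_wordMap_im w (⟨mid p / p, mid p / p⟩ : ℂ)
    have e2 := scaled_wordMap_im w (⟨(mid p + 1) / p, (mid p + 1) / p⟩ : ℂ)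
    have i1 : (p : ℝ) ^ w.length * (lowCorner w).im ≤ p ^ w.length * y.im := by gcongr; exact h2.1
    have i2 : (p : ℝ) ^ w.length * y.im ≤ p ^ w.length * (highCorner w).im := by gcongr; exact h2.2
    simp only [lowCorner, highCorner] at i1 i2
    rw [e1] at i1
    rw [e2] at i2
    simp only [wordInv]
    have i3 : (mid p : ℝ) / p ≤ p ^ w.length * y.im - cornerY w := by linarith
    have i4 : (p : ℝ) ^ w.length * y.im - cornerY w ≤ (mid p + 1) / p := by linarith
    rw [div_le_iff₀ hp0] at i3
    rw [le_div_iff₀ hp0] at i4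
    constructor <;> linarith
  rw [circ, mem_wordMap_image, mem_middle_iff]
  refine ⟨⟨?_, him⟩, fun h => ?_⟩
  · rcases hre with h | h <;> rw [h] <;> simp
  · rcases hre with h' | h' <;> rw [openMid, mem_ofPred_eq, h'] at h <;> simp at h

/-- Pulling a function on the carpet back to a cell decreases the energy of separating
a peripheral square of the cell from a peripheral square outside of it. -/
lemma patch_wordInv_mem_cls (w v : Word p) {c : Option (Word p)} (hc : Outside w c) {u : ℂ → ℝ}
    (hu : u ∈ Cls p (circ (some v)) (circ (p := p) none)) :
    patch (wordInv w) 1 u ∈ Cls p (circ (some (w ++ v))) (circ c) := by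
  have hO : ∀ z ∈ outerSquare, u z = 1 := hu.2.2.2
  refine ⟨hu.1.patch (isZoom_wordInv w) hO, fun z hz => patch_mem_Icc (isZoom_wordInv w) hu.2.1 hz,
    fun z hz => ?_, fun z hz => ?_⟩
  · have h : wordInv w z ∈ circ (some v) := wordInv_image_circ w v ▸ mem_image_of_mem _ hz
    rw [patch_of_mem (carpet_subset_unitSq (circ_subset_carpet _ h))]
    exact hu.2.2.1 _ h
  · refine patch_eq hO fun h => hc.notMem_fill h ?_
    rw [wordMap_wordInv]; exact circ_subset_fill c hz

lemma energy_patch_wordInv_le (w : Word p) {u : ℂ → ℝ} (hu : Adm p u)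
    (hO : ∀ z ∈ outerSquare, u z = 1) :
    energy (univ : Set (Option (Word p))) (patch (wordInv w) 1 u) ≤
      energy (univ : Set (Option (Word p))) u := by
  refine energy_patch_le (isZoom_wordInv w).injective hu hO fun c _ => ?_
  by_cases hc : Outside w c
  · left
    intro z hz h
    refine hc.notMem_fill h ?_
    rw [wordMap_wordInv]; exact circ_subset_fill c hz
  · right
    simp only [Outside] at hc
    push Not at hc
    obtain ⟨_, rfl, v, rfl⟩ := hc
    exact ⟨some v, mem_univ _, wordInv_image_circ w v⟩

/-- Separating sequences of almost minimal energy. -/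
lemma exists_minimizing {c d : Option (Word p)} (hcd : c ≠ d) (I : Set (Option (Word p))) :
    ∃ u : ℕ → ℂ → ℝ, (∀ n, u n ∈ Cls p (circ c) (circ d)) ∧
      ∀ n : ℕ, energy I (u n) ≤ cap I (circ c) (circ d) + 1 / ((n : ℝ) + 1) := by
  have h : ∀ n : ℕ, ∃ u ∈ Cls p (circ c) (circ d),
      energy I u < cap I (circ c) (circ d) + 1 / ((n : ℝ) + 1) := fun n =>
    exists_lt_of_cap_lt (cls_nonempty hcd) (lt_add_of_pos_right _ Nat.one_div_pos_of_nat)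
  choose u h1 h2 using h
  exact ⟨u, h1, fun n => (h2 n).le⟩

lemma cap_append_lt_of_bundle {w v : Word p} {c : Option (Word p)} (hc : Outside w c) {r s : ℝ}
    (hrs : r ≤ s) (hr : 0 ≤ r) (hs : s ≤ 1)
    (hdis : ∀ y : ℂ, y.re ∈ Icc r s → y.im ∈ Ioo (0 : ℝ) 1 → wordMap w y ∉ fill c)
    (hends : (r = 0 ∧ s = (lowCorner v).re) ∨ (r = (highCorner v).re ∧ s = 1)) :
    cap (p := p) univ (circ (some (w ++ v))) (circ c) < cap (p :=
      p) univ (circ (some v)) (circ (p := p) none) := by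
  obtain ⟨u, hu, hE⟩ := exists_minimizing (p := p) (c := some v) (d := none) (by simp) univ
  have h0 := pow_base_pos (p := p) w.length
  have hlow := lowCorner_mem v
  have hhigh := highCorner_mem v
  have hinv : ∀ z : ℂ, z.re ∈ Icc (wordMap w ⟨r, 0⟩).re (wordMap w ⟨s, 0⟩).re →
      z.im ∈ Icc (wordMap w (lowCorner v)).im (wordMap w (highCorner v)).im →
      (wordInv w z).re ∈ Icc r s ∧ (wordInv w z).im ∈ Icc (lowCorner v).im (highCorner v).im := by
    intro z h1 h2
    simp only [wordMap_re, wordMap_im, mem_Icc, div_le_iff₀ h0, le_div_iff₀ h0] at h1 h2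
    simp only [wordInv, mem_Icc]
    refine ⟨⟨?_, ?_⟩, ?_, ?_⟩ <;> linarith [h1.1, h1.2, h2.1, h2.2]
  have hedge : ∀ q : ℝ, ∀ y ∈ Icc (wordMap w (lowCorner v)).im (wordMap w (highCorner v)).im,
      q ∈ Icc r s → (wordInv w ⟨(wordMap w ⟨q, 0⟩).re, y⟩).re = q ∧
        (wordInv w ⟨(wordMap w ⟨q, 0⟩).re, y⟩).im ∈ Icc (lowCorner v).im (highCorner v).im := by
    intro q y hy hq
    refine ⟨by simp only [wordInv]; rw [scaled_wordMap_re]; ring, (hinv _ ?_ hy).2⟩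
    simp only [wordMap_re]
    exact ⟨by gcongr; exact hq.1, by gcongr; exact hq.2⟩
  have hIoo : ∀ t ∈ Icc (lowCorner v).im (highCorner v).im, t ∈ Ioo (0 : ℝ) 1 := fun t ht =>
    ⟨hlow.2.1.trans_le ht.1, ht.2.trans_lt hhigh.2.2⟩
  have hbd : ∀ y : ℂ, (y.re = 0 ∨ y.re = 1) → y.im ∈ Icc (lowCorner v).im (highCorner v).im →
      y ∈ outerSquare := by
    intro y h1 h2
    have h3 := hIoo _ h2
    refine mem_outer_iff.2 ⟨⟨?_, Ioo_subset_Icc_self h3⟩, fun h => ?_⟩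
    · rcases h1 with h | h <;> rw [h] <;> simp
    · rcases h1 with h' | h' <;> rw [openSq, mem_ofPred_eq, h'] at h <;> simp at h
  have hval : ∀ q : ℝ, ∀ y ∈ Icc (wordMap w (lowCorner v)).im (wordMap w (highCorner v)).im,
      q ∈ Icc r s → (q = 0 ∨ q = 1) → (⟨(wordMap w ⟨q, 0⟩).re, y⟩ : ℂ) ∈ sierpinskiCarpet p ∧
      ∀ n, patch (wordInv w) 1 (u n) ⟨(wordMap w ⟨q, 0⟩).re, y⟩ = 1 := by
    intro q y hy hq h01
    obtain ⟨h1, h2⟩ := hedge q y hy hq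
    have h3 := hbd _ (by rwa [h1]) h2
    refine ⟨?_, fun n => ?_⟩
    · rw [← wordMap_wordInv w ⟨_, y⟩]
      exact wordMap_mem_carpet w (outer_subset_carpet h3)
    · exact patch_eq (hu n).2.2.2 (mem_outer_iff.1 h3).2
  have hzero : ∀ q : ℝ, ∀ y ∈ Icc (wordMap w (lowCorner v)).im (wordMap w (highCorner v)).im,
      q ∈ Icc r s → (q = (lowCorner v).re ∨ q = (highCorner v).re) →
      (⟨(wordMap w ⟨q, 0⟩).re, y⟩ : ℂ) ∈ circ (some (w ++ v)) := by
    intro q y hy hq h01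
    obtain ⟨h1, h2⟩ := hedge q y hy hq
    have h3 : wordInv w ⟨(wordMap w ⟨q, 0⟩).re, y⟩ ∈ circ (some v) := by
      rcases h01 with h | h
      · exact mk_mem_circ v (Or.inl rfl) (by rw [h1, h]) h2
      · exact mk_mem_circ v (Or.inr rfl) (by rw [h1, h]) h2
    rw [← wordInv_image_circ w v] at h3
    exact (isZoom_wordInv w).injective.mem_set_image.1 h3
  have hcls := fun n => patch_wordInv_mem_cls w v hc (hu n)
  have hPf : ∀ z ∈ (Icc (wordMap w ⟨r, 0⟩).re (wordMap w ⟨s, 0⟩).re ×ℂ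
      Icc (wordMap w (lowCorner v)).im (wordMap w (highCorner v)).im), z ∉ fill c := by
    intro z hz
    obtain ⟨h1, h2⟩ := hinv z hz.1 hz.2
    have := hdis _ h1 (hIoo _ h2)
    rwa [wordMap_wordInv] at this
  have hrI : r ∈ Icc r s := ⟨le_rfl, hrs⟩
  have hsI : s ∈ Icc r s := ⟨hrs, le_rfl⟩
  refine cap_lt_of_jump (p := p) (fun n => patch (wordInv w) 1 (u n)) hcls
    (fun n => (energy_patch_wordInv_le w (hu n).1 (hu n).2.2.2).trans (hE n))
    (a := (wordMap w ⟨r, 0⟩).re) (b := (wordMap w ⟨s, 0⟩).re)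
    (y₁ := (wordMap w (lowCorner v)).im) (y₂ := (wordMap w (highCorner v)).im) ?_ ?_ rfl
    (fun z hz => ?_) (fun y hy => ?_) (fun y hy => ?_) (fun n y hy => ?_)
    (fun z hz h => hPf z hz (circ_subset_fill c h)) (fun t ht h => ?_) (fun _ _ => mem_univ _)
  · simp only [wordMap_re]; gcongr
  · have := lowCorner_im_lt v
    simp only [wordMap_im]; gcongr
  · obtain ⟨h1, h2⟩ := hinv z hz.1 hz.2
    rw [← wordMap_wordInv w z]
    exact wordMap_mem_unitSq w ⟨⟨hr.trans h1.1, h1.2.trans hs⟩, Ioo_subset_Icc_self (hIoo _ h2)⟩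
  · rcases hends with ⟨h, -⟩ | ⟨h, -⟩
    · exact (hval r y hy hrI (Or.inl h)).1
    · exact circ_subset_carpet _ (hzero r y hy hrI (Or.inr h))
  · rcases hends with ⟨-, h⟩ | ⟨-, h⟩
    · exact circ_subset_carpet _ (hzero s y hy hsI (Or.inl h))
    · exact (hval s y hy hsI (Or.inr h)).1
  · rcases hends with ⟨h, h'⟩ | ⟨h, h'⟩
    · rw [(hval r y hy hrI (Or.inl h)).2 n, (hcls n).2.2.1 _ (hzero s y hy hsI (Or.inl h'))]; simp
    · rw [(hval s y hy hsI (Or.inr h')).2 n, (hcls n).2.2.1 _ (hzero r y hy hrI (Or.inr h))]; simp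
  · obtain ⟨z, hz1, hz2⟩ := ht
    refine hPf z hz2 ?_
    rw [← h]; exact hz1

/-- Inside a proper cell, a peripheral square is separated from the squares outside of the cell
at a smaller cost than in the whole carpet. -/
lemma cap_append_lt {w : Word p} (hw : w ≠ []) (v : Word p) {c : Option (Word p)}
    (hc : Outside w c) :
    cap (p := p) univ (circ (some (w ++ v))) (circ c) < cap (p :=
      p) univ (circ (some v)) (circ (p := p) none) := by
  have hlow := lowCorner_mem v
  have hhigh := highCorner_mem v
  rcases hc.side hw with h | h
  · refine cap_append_lt_of_bundle hc hlow.1.1.le le_rfl hlow.1.2.le (fun y hy1 hy2 => ?_)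
      (Or.inl ⟨rfl, rfl⟩)
    rcases hy1.1.eq_or_lt with h0 | h0
    · have := h _ hy2
      rwa [h0] at this
    · exact hc.notMem_fill ⟨⟨h0, hy1.2.trans_lt hlow.1.2⟩, hy2⟩
  · refine cap_append_lt_of_bundle hc hhigh.1.2.le hhigh.1.1.le le_rfl (fun y hy1 hy2 => ?_)
      (Or.inr ⟨rfl, rfl⟩)
    rcases hy1.2.eq_or_lt with h0 | h0
    · have := h _ hy2
      rwa [← h0] at this
    · exact hc.notMem_fill ⟨⟨hhigh.1.1.trans_le hy1.1, h0⟩, hy2⟩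

end

noncomputable section

variable {p : ℕ} [hp : OddBase p]

/-- Isometric involutions of the unit square that permute the cells of the carpet. -/
structure IsSym (A : ℂ → ℂ) (δ : Digit p → Digit p) : Prop where
  invol : ∀ z, A (A z) = z
  dist : ∀ x y, dist (A x) (A y) = dist x y
  cell : ∀ d z, A (cellMap d z) = cellMap (δ d) (A z)
  unit : ∀ z ∈ unitSq, A z ∈ unitSq
  openSq : ∀ z ∈ openSq, A z ∈ Carpet.openSq
  solidMid : ∀ z ∈ solidMid p, A z ∈ Carpet.solidMid p
  openMid : ∀ z ∈ openMid p, A z ∈ Carpet.openMid p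

namespace IsSym

variable {A : ℂ → ℂ} {δ : Digit p → Digit p}

lemma apply_wordMap (h : IsSym A δ) (w : Word p) (z : ℂ) : A (wordMap w z) = wordMap (w.map δ)
    (A z) := by
  induction w with
  | nil => rfl
  | cons d w ih =>
    change A (cellMap d (wordMap w z)) = cellMap (δ d) (wordMap (w.map δ) (A z))
    rw [h.cell, ih]

lemma image_outer (h : IsSym A δ) : A '' outerSquare = outerSquare := by
  have key : ∀ z ∈ outerSquare, A z ∈ outerSquare := fun z hz => by
    rw [mem_outer_iff] at hz ⊢
    refine ⟨h.unit z hz.1, fun h' => hz.2 ?_⟩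
    rw [← h.invol z]; exact h.openSq _ h'
  exact Subset.antisymm (image_subset_iff.2 key) fun z hz => ⟨A z, key z hz, h.invol z⟩

lemma image_middle (h : IsSym A δ) : A '' middleSquare p = middleSquare p := by
  have key : ∀ z ∈ middleSquare p, A z ∈ middleSquare p := fun z hz => by
    rw [mem_middle_iff] at hz ⊢
    refine ⟨h.solidMid z hz.1, fun h' => hz.2 ?_⟩
    rw [← h.invol z]; exact h.openMid _ h'
  exact Subset.antisymm (image_subset_iff.2 key) fun z hz => ⟨A z, key z hz, h.invol z⟩

lemma image_circ (h : IsSym A δ) (c : Option (Word p)) : A '' circ c = circ (c.map (List.map δ))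
    := by
  cases c with
  | none => exact h.image_outer
  | some w =>
    change A '' (wordMap w '' middleSquare p) = wordMap (w.map δ) '' middleSquare p
    conv_rhs => rw [← h.image_middle]
    simp only [image_image, h.apply_wordMap]

lemma mem_hole (h : IsSym A δ) {w : Word p} {z : ℂ} (hz : z ∈ hole w) : A z ∈ hole (w.map δ) := by
  obtain ⟨y, hy, rfl⟩ := hz
  exact ⟨A y, h.openMid y hy, (h.apply_wordMap w y).symm⟩

lemma mem_carpet (h : IsSym A δ) {z : ℂ} (hz : z ∈ sierpinskiCarpet p)
    : A z ∈ sierpinskiCarpet p := by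
  refine mem_carpet_of (h.unit z (carpet_subset_unitSq hz)) fun w hw => ?_
  have := h.mem_hole hw
  rw [h.invol] at this
  exact carpet_not_hole hz _ this

/-- The self-homeomorphism of the carpet induced by a symmetry. -/
def homeo (h : IsSym A δ) : ↥(sierpinskiCarpet p) ≃ₜ ↥(sierpinskiCarpet p) :=
  have hc : Continuous A := (Isometry.of_dist_eq h.dist).continuous
  { toFun := fun x => ⟨A x, h.mem_carpet x.2⟩
    invFun := fun x => ⟨A x, h.mem_carpet x.2⟩
    left_inv := fun x => Subtype.ext (h.invol x)
    right_inv := fun x => Subtype.ext (h.invol x)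
    continuous_toFun := (hc.comp continuous_subtype_val).subtype_mk _
    continuous_invFun := (hc.comp continuous_subtype_val).subtype_mk _ }

lemma isQSMap_homeo (h : IsSym A δ) : IsQSMap h.homeo := by
  refine ⟨fun t => t, ⟨continuousOn_id, strictMonoOn_id, rfl, surjOn_id _⟩, fun u v w huw => ?_⟩
  have hd : ∀ x y, Dist.dist (h.homeo x) (h.homeo y) = Dist.dist x y := fun x y => h.dist x y
  rw [hd, hd, div_mul_cancel₀ _ (dist_pos.2 huw).ne']

lemma circPerm_homeo (h : IsSym A δ) (c : Option (Word p))
    : circPerm h.homeo c = c.map (List.map δ) := by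
  refine circ_injective ?_
  rw [← push_circ, ← h.image_circ]
  ext z
  constructor
  · rintro ⟨x, hx, rfl⟩
    exact ⟨x, hx, rfl⟩
  · rintro ⟨x, hx, rfl⟩
    exact ⟨⟨x, circ_subset_carpet c hx⟩, hx, rfl⟩

lemma cap_le (h : IsSym A δ) {I : Set (Option (Word p))} {c d : Option (Word p)} (hcd : c ≠ d)
    (hI : ∀ c ∈ I, c.map (List.map δ) ∈ I) :
    cap I (circ c) (circ d) ≤
      cap I (circ (c.map (List.map δ))) (circ (d.map (List.map δ))) := by
  have := cap_le_cap_image h.isQSMap_homeo hcd (I := I) (I' := I)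
    fun c hc => by rw [h.circPerm_homeo]; exact hI c hc
  rwa [h.circPerm_homeo, h.circPerm_homeo] at this

end IsSym

/-- The reflection of the unit square in its horizontal axis. -/
def flip (z : ℂ) : ℂ := ⟨z.re, 1 - z.im⟩

/-- The action of `flip` on digits. -/
def flipDigit (d : Digit p) : Digit p := ⟨(d.1.1, p - 1 - d.1.2), by
  have h1 := d.2
  have h2 := two_mid_add_one (p := p)
  refine ⟨h1.1, by omega, fun h => h1.2.2 ⟨h.1, ?_⟩⟩
  have := h.2
  have := h1.2.1
  simp only at *
  omega⟩

lemma dist_eq_sqrt (x y : ℂ) : dist x y = √((x.re - y.re) ^ 2 + (x.im - y.im) ^ 2) :=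
  Complex.dist_eq_re_im x y

lemma isSym_flip : IsSym (p := p) flip flipDigit where
  invol z := by simp [flip]
  dist x y := by
    rw [dist_eq_sqrt, dist_eq_sqrt]
    simp only [flip]
    ring_nf
  cell d z := by
    have h0 := base_pos (p := p)
    have h1 := d.2.2.1
    apply Complex.ext
    · simp only [flip, cellMap_re, flipDigit]
    · simp only [flip, cellMap_im, flipDigit]
      rw [Nat.cast_sub (by omega), Nat.cast_sub (by omega)]
      field_simp
      push_cast
      ring
  unit z hz := ⟨hz.1, by constructor <;> simp only [flip] <;> linarith [hz.2.1, hz.2.2]⟩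
  openSq z hz := ⟨hz.1, by constructor <;> simp only [flip] <;> linarith [hz.2.1, hz.2.2]⟩
  solidMid z hz := ⟨hz.1, by
    have := cast_base (p := p)
    constructor <;> simp only [flip] <;> linarith [hz.2.1, hz.2.2]⟩
  openMid z hz := ⟨hz.1, by
    have := cast_base (p := p)
    constructor <;> simp only [flip] <;> linarith [hz.2.1, hz.2.2]⟩

/-- The reflection of the unit square in its diagonal. -/
def transpose (z : ℂ) : ℂ := ⟨z.im, z.re⟩

/-- The action of `transpose` on digits. -/
def transposeDigit (d : Digit p) : Digit p :=
  ⟨(d.1.2, d.1.1), d.2.2.1, d.2.1, fun h => d.2.2.2 ⟨h.2, h.1⟩⟩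

lemma isSym_transpose : IsSym (p := p) transpose transposeDigit where
  invol z := rfl
  dist x y := by
    rw [dist_eq_sqrt, dist_eq_sqrt]
    simp only [transpose]
    rw [add_comm]
  cell d z := by
    apply Complex.ext
    · simp only [transpose, cellMap_re, cellMap_im, transposeDigit]
    · simp only [transpose, cellMap_re, cellMap_im, transposeDigit]
  unit z hz := ⟨hz.2, hz.1⟩
  openSq z hz := ⟨hz.2, hz.1⟩
  solidMid z hz := ⟨hz.2, hz.1⟩
  openMid z hz := ⟨hz.2, hz.1⟩

/-- A translation by `s` columns combined with the reflection that interchanges the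
rows `0` and `j`. -/
def reflect (p : ℕ) (s : ℤ) (j : ℕ) (z : ℂ) : ℂ := ⟨z.re + s / p, (j + 1) / p - z.im⟩

lemma scaled_reflect_re (s : ℤ) (j : ℕ) (z : ℂ) : p * (reflect p s j z).re = p * z.re + s := by
  have := base_pos (p := p)
  simp only [reflect]; field_simp

lemma scaled_reflect_im (s : ℤ) (j : ℕ) (z : ℂ) :
    p * (reflect p s j z).im = j + 1 - p * z.im := by
  have := base_pos (p := p)
  simp only [reflect]; field_simp

lemma reflect_reflect (s : ℤ) (j : ℕ) (z : ℂ) : reflect p (-s) j (reflect p s j z) = z := by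
  apply Complex.ext <;> simp only [reflect]
  · push_cast; ring
  · ring

lemma reflect_cellMap {s : ℤ} {j : ℕ} {d d' : Digit p} (h1 : (d'.1.1 : ℤ) = d.1.1 + s)
    (h2 : d.1.2 + d'.1.2 = j) (y : ℂ) : reflect p s j (cellMap d y) = cellMap d' (flip y) := by
  have h0 := base_pos (p := p)
  have h1' : (d'.1.1 : ℝ) = d.1.1 + s := by exact_mod_cast h1
  apply Complex.ext
  · simp only [reflect, cellMap_re, flip, h1']; field_simp; ring
  · simp only [reflect, cellMap_im, flip, ← h2]; push_cast; field_simp; ring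

lemma exists_reflect_digit {s : ℤ} {j : ℕ} (hj : j < mid p) {d : Digit p} (h1 : 0 ≤ d.1.1 + s)
    (h2 : d.1.1 + s < p) (h3 : d.1.2 ≤ j) :
    ∃ d' : Digit p, (d'.1.1 : ℤ) = d.1.1 + s ∧ d.1.2 + d'.1.2 = j := by
  have := two_mid_add_one (p := p)
  refine ⟨⟨((d.1.1 + s).toNat, j - d.1.2), by simp only; omega, by simp only; omega, fun h => ?_⟩,
    by simp only; omega, by simp only; omega⟩
  have := h.2
  simp only at this
  omega

lemma reflect_image_circ {s : ℤ} {j : ℕ} {d d' : Digit p} (h1 : (d'.1.1 : ℤ) = d.1.1 + s)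
    (h2 : d.1.2 + d'.1.2 = j) (w : Word p) :
    reflect p s j '' circ (some (d :: w)) = circ (some (d' :: w.map flipDigit)) := by
  have := isSym_flip.image_circ (some w)
  rw [circ_cons, circ_cons, image_image]
  simp only [reflect_cellMap h1 h2]
  rw [← image_image (cellMap d') flip, this]
  rfl

lemma scaled_cellMap {d : Digit p} {y : ℂ} (hy : y ∈ openSq) :
    p * (cellMap d y).re ∈ Ioo (d.1.1 : ℝ) (d.1.1 + 1) ∧
      p * (cellMap d y).im ∈ Ioo (d.1.2 : ℝ) (d.1.2 + 1) := by
  have h0 := base_pos (p := p)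
  rw [cellMap_re, cellMap_im, mul_div_cancel₀ _ h0.ne', mul_div_cancel₀ _ h0.ne']
  exact ⟨⟨by linarith [hy.1.1], by linarith [hy.1.2]⟩, by linarith [hy.2.1], by linarith [hy.2.2]⟩

lemma scaled_unitSq {z : ℂ} (hz : z ∈ unitSq) :
    p * z.re ∈ Icc (0 : ℝ) p ∧ p * z.im ∈ Icc (0 : ℝ) p := by
  have h0 := base_pos (p := p)
  obtain ⟨⟨a, b⟩, c, d⟩ := hz
  refine ⟨⟨?_, ?_⟩, ?_, ?_⟩ <;> nlinarith

lemma isZoom_reflect (s : ℤ) {j : ℕ} (hj : j < mid p) : IsZoom p 0 (reflect p s j) where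
  re x y := by simp [reflect]
  im x y := by simp [reflect, abs_sub_comm]
  mem z hz h := by
    have hjm : (j : ℝ) + 1 ≤ mid p := by exact_mod_cast hj
    have hzu := scaled_unitSq (p := p) (carpet_subset_unitSq hz)
    have er := scaled_reflect_re (p := p) s j z
    have ei := scaled_reflect_im (p := p) s j z
    refine mem_carpet_of h fun w hw => ?_
    cases w with
    | nil =>
      obtain ⟨y, hy, hyz⟩ := hw
      change y = _ at hyz
      subst hyz
      linarith [hy.2.1, hzu.2.1]
    | cons d w =>
      rw [hole_cons] at hw
      obtain ⟨y, hy, hyz⟩ := hw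
      have h1 := scaled_cellMap (d := d) (hole_subset_openSq w hy)
      rw [hyz, er, ei] at h1
      have i1 : (d.1.2 : ℝ) < j + 1 := by linarith [h1.2.1, hzu.2.1]
      have i2 : (-1 : ℝ) < d.1.1 - s := by linarith [h1.1.2, hzu.1.1]
      have i3 : (d.1.1 - s : ℝ) < p := by linarith [h1.1.1, hzu.1.2]
      have i1' : d.1.2 < j + 1 := by exact_mod_cast i1
      have i2' : (-1 : ℤ) < d.1.1 - s := by exact_mod_cast i2
      have i3' : (d.1.1 - s : ℤ) < p := by exact_mod_cast i3
      obtain ⟨d', e1, e2⟩ := exists_reflect_digit (s := -s) hj (d := d) (by omega) (by omega)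
        (by omega)
      have h2 := reflect_cellMap e1 e2 y
      rw [hyz, reflect_reflect] at h2
      refine carpet_not_hole hz (d' :: w.map flipDigit) ?_
      rw [hole_cons, h2]
      exact mem_image_of_mem _ (isSym_flip.mem_hole hy)

lemma reflect_circ (s : ℤ) {j : ℕ} (hj : j < mid p) {c : Option (Word p)} (hc : c ≠ none) :
    (∀ z ∈ circ c, reflect p s j z ∉ openSq) ∨
      ∃ (d : Digit p) (w : Word p), reflect p s j '' circ c = circ (some (d :: w)) := by
  have hjm : (j : ℝ) + 1 ≤ mid p := by exact_mod_cast hj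
  have h0 := base_pos (p := p)
  obtain ⟨w, rfl⟩ := Option.ne_none_iff_exists'.1 hc
  cases w with
  | nil =>
    left
    intro z hz h
    obtain ⟨y, hy, hyz⟩ := circ_some_subset_solid _ hz
    change y = z at hyz
    subst hyz
    have ei := scaled_reflect_im (p := p) s j y
    linarith [mul_pos h0 h.2.1, hy.2.1]
  | cons d w =>
    by_cases hd : 0 ≤ d.1.1 + s ∧ d.1.1 + s < p ∧ d.1.2 ≤ j
    · obtain ⟨d', e1, e2⟩ := exists_reflect_digit hj hd.1 hd.2.1 hd.2.2
      exact Or.inr ⟨d', _, reflect_image_circ e1 e2 w⟩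
    · left
      intro z hz h
      refine hd ?_
      have hz' := circ_some_subset_solid _ hz
      rw [solid_cons] at hz'
      obtain ⟨y, hy, hyz⟩ := hz'
      have h1 := scaled_cellMap (d := d) (solid_subset_openSq w hy)
      rw [hyz] at h1
      have er := scaled_reflect_re (p := p) s j z
      have ei := scaled_reflect_im (p := p) s j z
      have i1 : (d.1.2 : ℝ) < j + 1 := by linarith [h1.2.1, mul_pos h0 h.2.1]
      have i2 : (-1 : ℝ) < d.1.1 + s := by linarith [h1.1.2, mul_pos h0 h.1.1]
      have i3 : (d.1.1 + s : ℝ) < p := by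
        have := mul_lt_mul_of_pos_left h.1.2 h0
        linarith [h1.1.1]
      have i1' : d.1.2 < j + 1 := by exact_mod_cast i1
      have i2' : (-1 : ℤ) < d.1.1 + s := by exact_mod_cast i2
      have i3' : (d.1.1 + s : ℤ) < p := by exact_mod_cast i3
      exact ⟨by omega, by omega, by omega⟩

end

noncomputable section

variable {p : ℕ} [hp : OddBase p]

/-- The peripheral squares other than the outer and the middle one. -/
def properCircs (p : ℕ) : Set (Option (Word p)) := {c | c ≠ none ∧ c ≠ some []}

lemma patch_reflect_mem_cls {d e : Digit p} (hd : d.1.2 < mid p) (he : e.1.2 = 0) {u : ℂ → ℝ}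
    (hu : u ∈ Cls p (circ (some [e])) (circ (p := p) none)) :
    patch (reflect p (e.1.1 - d.1.1) d.1.2) 1 u ∈
      Cls p (circ (some [d])) (circ (p := p) (some [])) := by
  have hO : ∀ z ∈ outerSquare, u z = 1 := hu.2.2.2
  have hτ := isZoom_reflect (e.1.1 - d.1.1 : ℤ) hd
  refine ⟨hu.1.patch hτ hO, fun z hz => patch_mem_Icc hτ hu.2.1 hz, fun z hz => ?_, fun z hz => ?_⟩
  · have hi := reflect_image_circ (s := (e.1.1 - d.1.1 : ℤ)) (j := d.1.2) (d := d) (d' := e)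
      (by omega) (by omega) []
    have h : reflect p (e.1.1 - d.1.1) d.1.2 z ∈ circ (some [e]) := hi ▸ mem_image_of_mem _ hz
    rw [patch_of_mem (carpet_subset_unitSq (circ_subset_carpet _ h))]
    exact hu.2.2.1 _ h
  · refine patch_eq hO fun h => ?_
    have h0 := base_pos (p := p)
    have hjm : (d.1.2 : ℝ) + 1 ≤ mid p := by exact_mod_cast hd
    obtain ⟨y, hy, hyz⟩ := circ_some_subset_solid _ hz
    change y = z at hyz
    subst hyz
    have ei := scaled_reflect_im (p := p) (e.1.1 - d.1.1) d.1.2 y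
    linarith [mul_pos h0 h.2.1, hy.2.1]

lemma energy_patch_reflect_le (s : ℤ) {j : ℕ} (hj : j < mid p) {u : ℂ → ℝ} (hu : Adm p u)
    (hO : ∀ z ∈ outerSquare, u z = 1) :
    energy (properCircs p) (patch (reflect p s j) 1 u) ≤ energy (properCircs p) u := by
  refine energy_patch_le (isZoom_reflect s hj).injective hu hO fun c hc => ?_
  refine (reflect_circ s hj hc.1).imp_right ?_
  rintro ⟨d, w, h⟩
  exact ⟨some (d :: w), ⟨by simp, by simp⟩, h⟩

/-- Squares of first generation below the middle square are separated from it at a smaller cost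
than squares in the bottom row are separated from the outer square. -/
lemma cap_middle_lt {d e : Digit p} (hd : d.1.2 < mid p) (he : e.1.2 = 0) :
    cap (properCircs p) (circ (some [d])) (circ (p := p) (some [])) <
      cap (properCircs p) (circ (some [e])) (circ (p := p) none) := by
  obtain ⟨u, hu, hE⟩ := exists_minimizing (p := p) (c := some [e]) (d := none) (by simp)
    (properCircs p)
  have h0 := base_pos (p := p)
  have hjm : (d.1.2 : ℝ) + 1 ≤ mid p := by exact_mod_cast hd
  have hcb := cast_base (p := p)
  set s : ℤ := e.1.1 - d.1.1 with hs
  have hlow := scaled_cellMap (d := d) (lowCorner_mem (p := p) [])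
  have hhigh := scaled_cellMap (d := d) (highCorner_mem (p := p) [])
  change p * (lowCorner [d]).re ∈ _ ∧ p * (lowCorner [d]).im ∈ _ at hlow
  change p * (highCorner [d]).re ∈ _ ∧ p * (highCorner [d]).im ∈ _ at hhigh
  have hcls := fun n => patch_reflect_mem_cls hd he (hu n)
  have him : ∀ y ∈ Icc (lowCorner [d]).im (highCorner [d]).im,
      0 < y ∧ y < 1 ∧ (p : ℝ) * y < mid p := by
    intro y hy
    have h1 := mul_le_mul_of_nonneg_left hy.1 h0.le
    have h2 := mul_le_mul_of_nonneg_left hy.2 h0.le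
    have h3 : (p : ℝ) * y < mid p := by linarith [hhigh.2.2]
    have h4 : (0 : ℝ) < p * y := by
      linarith [hlow.2.1, (Nat.cast_nonneg d.1.2 : (0 : ℝ) ≤ d.1.2)]
    exact ⟨pos_of_mul_pos_right h4 h0.le, by nlinarith, h3⟩
  have hedge : ∀ x y : ℝ, x ∈ Icc (0 : ℝ) 1 → y ∈ Icc (lowCorner [d]).im (highCorner [d]).im →
      (p * x = -s ∨ p * x = p - s) → (⟨x, y⟩ : ℂ) ∈ sierpinskiCarpet p ∧
      ∀ n, patch (reflect p s d.1.2) 1 (u n) ⟨x, y⟩ = 1 := by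
    intro x y hx hy hxs
    obtain ⟨i1, i2, i3⟩ := him y hy
    refine ⟨grid_mem_carpet ⟨hx, i1.le, i2.le⟩ (Or.inl ?_), fun n => ?_⟩
    · rcases hxs with h | h
      · exact ⟨-s, by push_cast; exact h⟩
      · exact ⟨p - s, by push_cast; exact h⟩
    · refine patch_eq (hu n).2.2.2 fun h => ?_
      have er := scaled_reflect_re (p := p) s d.1.2 ⟨x, y⟩
      have h1 := mul_pos h0 h.1.1
      have h2 := mul_lt_mul_of_pos_left h.1.2 h0
      rcases hxs with h3 | h3
      · linarith
      · linarith
  have hcirc : ∀ x y : ℝ, (x = (lowCorner [d]).re ∨ x = (highCorner [d]).re) →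
      y ∈ Icc (lowCorner [d]).im (highCorner [d]).im → (⟨x, y⟩ : ℂ) ∈ circ (some [d]) := by
    rintro x y (h | h) hy
    · exact mk_mem_circ [d] (Or.inl rfl) h hy
    · exact mk_mem_circ [d] (Or.inr rfl) h hy
  have key : ∀ a b : ℝ, 0 ≤ a → a ≤ b → b ≤ 1 →
      ((p * a = -s ∧ b = (lowCorner [d]).re) ∨ (a = (highCorner [d]).re ∧ p * b = p - s)) →
      cap (properCircs p) (circ (some [d])) (circ (p := p) (some [])) <
      cap (properCircs p) (circ (some [e])) (circ (p := p) none) := by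
    intro a b ha hab hb hends
    have hPs : ∀ z ∈ Icc a b ×ℂ Icc (lowCorner [d]).im (highCorner [d]).im,
        z ∉ solid ([] : Word p) := by
      rintro z hz ⟨y, hy, hyz⟩
      change y = z at hyz
      subst hyz
      linarith [(him _ hz.2).2.2, hy.2.1]
    have hne : ∀ v ∈ meeting p (Icc a b ×ℂ Icc (lowCorner [d]).im (highCorner [d]).im),
        some v ≠ some [] := by
      rintro v ⟨z, hz1, hz2⟩ h
      rw [Option.some.inj h] at hz1
      exact hPs z hz2 hz1
    refine cap_lt_of_jump (p := p) (fun n => patch (reflect p s d.1.2) 1 (u n)) hcls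
      (fun n => (energy_patch_reflect_le s hd (hu n).1 (hu n).2.2.2).trans (hE n)) hab
      (lowCorner_im_lt [d]) rfl (fun z hz => ?_) (fun y hy => ?_) (fun y hy => ?_)
      (fun n y hy => ?_) (fun z hz h => hPs z hz (circ_some_subset_solid _ h)) hne
      (fun v hv => ⟨by simp, hne v hv⟩)
    · have := him _ hz.2
      exact ⟨⟨ha.trans hz.1.1, hz.1.2.trans hb⟩, this.1.le, this.2.1.le⟩
    · rcases hends with ⟨h, -⟩ | ⟨h, -⟩
      · exact (hedge a y ⟨ha, hab.trans hb⟩ hy (Or.inl h)).1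
      · exact circ_subset_carpet _ (hcirc a y (Or.inr h) hy)
    · rcases hends with ⟨-, h⟩ | ⟨-, h⟩
      · exact circ_subset_carpet _ (hcirc b y (Or.inl h) hy)
      · exact (hedge b y ⟨ha.trans hab, hb⟩ hy (Or.inr h)).1
    · rcases hends with ⟨h, h'⟩ | ⟨h, h'⟩
      · rw [(hedge a y ⟨ha, hab.trans hb⟩ hy (Or.inl h)).2 n,
          (hcls n).2.2.1 _ (hcirc b y (Or.inl h') hy)]
        simp
      · rw [(hedge b y ⟨ha.trans hab, hb⟩ hy (Or.inr h')).2 n,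
          (hcls n).2.2.1 _ (hcirc a y (Or.inr h) hy)]
        simp
  have hX : (d.1.1 : ℝ) + 1 ≤ p := by exact_mod_cast d.2.1
  have hX' : (e.1.1 : ℝ) + 1 ≤ p := by exact_mod_cast e.2.1
  have hXe : (0 : ℝ) ≤ e.1.1 := Nat.cast_nonneg _
  have hXd : (0 : ℝ) ≤ d.1.1 := Nat.cast_nonneg _
  have hsr : (s : ℝ) = e.1.1 - d.1.1 := by rw [hs]; push_cast; ring
  rcases le_total s 0 with h | h
  · have h' : (s : ℝ) ≤ 0 := by exact_mod_cast h
    have hp1 : p * (-s / p : ℝ) = -s := by field_simp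
    refine key (-s / p) (lowCorner [d]).re (div_nonneg (by linarith) h0.le) ?_ ?_
      (Or.inl ⟨hp1, rfl⟩)
    · refine le_of_mul_le_mul_left ?_ h0
      rw [hp1]; linarith [hlow.1.1]
    · refine le_of_mul_le_mul_left ?_ h0
      linarith [hlow.1.2]
  · have h' : (0 : ℝ) ≤ s := by exact_mod_cast h
    have hp1 : p * ((p - s) / p : ℝ) = p - s := by field_simp
    refine key (highCorner [d]).re ((p - s) / p) ?_ ?_ ?_ (Or.inr ⟨rfl, hp1⟩)
    · refine le_of_mul_le_mul_left ?_ h0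
      linarith [hhigh.1.1]
    · refine le_of_mul_le_mul_left ?_ h0
      rw [hp1]; linarith [hhigh.1.2]
    · rw [div_le_one h0]; linarith

end

noncomputable section

variable {p : ℕ} [hp : OddBase p]

/-- The height of the axis of `reflect p s j`. -/
def axis (p j : ℕ) : ℝ := (j + 1) / (2 * p)

lemma axis_pos (j : ℕ) : 0 < axis p j := by
  have := base_pos (p := p)
  unfold axis; positivity

lemma reflect_im_axis (s : ℤ) (j : ℕ) (z : ℂ) : (reflect p s j z).im = 2 * axis p j - z.im := by
  have := base_pos (p := p)
  simp only [reflect, axis]; field_simp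

lemma reflect_zero_re (j : ℕ) (z : ℂ) : (reflect p 0 j z).re = z.re := by
  simp [reflect]

lemma reflect_reflect_zero (j : ℕ) (z : ℂ) : reflect p 0 j (reflect p 0 j z) = z := by
  simpa using reflect_reflect (p := p) 0 j z

lemma reflect_of_im_eq {j : ℕ} {z : ℂ} (h : z.im = axis p j) : reflect p 0 j z = z :=
  Complex.ext (reflect_zero_re j z) (by rw [reflect_im_axis, h]; ring)

lemma two_mul_axis_lt {j : ℕ} (hj : j < mid p) : 2 * axis p j < 1 := by
  have h0 := base_pos (p := p)
  have hjm : (j : ℝ) + 1 ≤ mid p := by exact_mod_cast hj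
  have hcb := cast_base (p := p)
  have e : 2 * axis p j = (j + 1) / p := by unfold axis; field_simp
  rw [e, div_lt_one h0]
  have : (0 : ℝ) ≤ j := Nat.cast_nonneg j
  linarith

lemma reflect_mem_unitSq {j : ℕ} (hj : j < mid p) {z : ℂ} (hz : z ∈ unitSq)
    (h : z.im ≤ 2 * axis p j) : reflect p 0 j z ∈ unitSq := by
  have := two_mul_axis_lt hj
  refine ⟨by rw [reflect_zero_re]; exact hz.1, ?_, ?_⟩
  · rw [reflect_im_axis]; linarith
  · rw [reflect_im_axis]; linarith [hz.2.1]

/-- The polarization of `u` with respect to the reflection in the axis: the larger of the values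
at a pair of reflected points is moved below the axis. -/
def polar (p j : ℕ) (u : ℂ → ℝ) (z : ℂ) : ℝ :=
  if z.im ≤ axis p j then max (u z) (patch (reflect p 0 j) 1 u z)
  else min (u z) (patch (reflect p 0 j) 1 u z)

lemma polar_of_le {j : ℕ} {u : ℂ → ℝ} {z : ℂ} (h : z.im ≤ axis p j) :
    polar p j u z = max (u z) (patch (reflect p 0 j) 1 u z) := if_pos h

lemma patch_of_im_eq {j : ℕ} {u : ℂ → ℝ} {z : ℂ} (hz : z ∈ unitSq) (h : z.im = axis p j) :
    patch (reflect p 0 j) 1 u z = u z := by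
  rw [patch_of_mem (by rwa [reflect_of_im_eq h]), reflect_of_im_eq h]

lemma polar_of_ge {j : ℕ} {u : ℂ → ℝ} {z : ℂ} (hz : z ∈ unitSq) (h : axis p j ≤ z.im) :
    polar p j u z = min (u z) (patch (reflect p 0 j) 1 u z) := by
  rcases h.eq_or_lt with h | h
  · rw [polar_of_le h.ge, patch_of_im_eq hz h.symm]; simp
  · exact if_neg (not_le.2 h)

lemma polar_eq_or {j : ℕ} {u : ℂ → ℝ} {z : ℂ} (h : reflect p 0 j z ∈ unitSq) :
    polar p j u z = u z ∨ polar p j u z = u (reflect p 0 j z) := by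
  unfold polar
  rw [patch_of_mem h]
  split_ifs
  · exact max_choice _ _
  · exact min_choice _ _

lemma continuousOn_polar {j : ℕ} (hj : j < mid p) {u : ℂ → ℝ} (hu : Adm p u)
    (hO : ∀ z ∈ outerSquare, u z = 1) : ContinuousOn (polar p j u) (sierpinskiCarpet p) := by
  have hv := hu.patch (isZoom_reflect 0 hj) hO
  refine ContinuousOn.if (fun z hz => ?_) ((hu.max hv).1.mono inter_subset_left)
    ((hu.min hv).1.mono inter_subset_left)
  have : z.im = axis p j := by
    have h := hz.2
    rw [Complex.frontier_setOfPred_im_le] at h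
    exact h
  rw [patch_of_im_eq (carpet_subset_unitSq hz.1) this]; simp

lemma adm_polar {j : ℕ} (hj : j < mid p) {u : ℂ → ℝ} (hu : Adm p u)
    (hO : ∀ z ∈ outerSquare, u z = 1) : Adm p (polar p j u) := by
  have hτ := isZoom_reflect (p := p) 0 hj
  have hv := hu.patch hτ hO
  refine ⟨continuousOn_polar hj hu hO, fun l => ?_⟩
  have hc := axis_pos (p := p) j
  have h0 := base_pos (p := p)
  have hp1 : (1 / p : ℝ) < 1 := by
    rw [div_lt_one h0]; linarith [three_le_cast (p := p)]
  obtain ⟨n₀, hn₀⟩ : ∃ n₀ : ℕ, ∀ n, n₀ ≤ n → 2 * l * (1 / p : ℝ) ^ n < axis p j := by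
    have ht : Filter.Tendsto (fun n : ℕ => 2 * l * (1 / p : ℝ) ^ n) Filter.atTop (nhds 0) := by
      simpa using (tendsto_pow_atTop_nhds_zero_of_lt_one (by positivity) hp1).const_mul (2 * l : ℝ)
    exact Filter.eventually_atTop.1 (ht.eventually_lt_const hc)
  refine summable_of_near (fun _ => sq_nonneg _) (fun _ => by positivity)
    (((hu.2 (5 * l)).add ((hu.max hv).2 l)).add ((hu.min hv).2 l)) n₀ 0 univ id (by simp)
    (fun w _ hw => ?_) (fun v _ w _ h => by
      change v = w at h
      subst h; simp)
  by_cases h1 : ∀ z ∈ near l w, z.im ≤ axis p j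
  · rw [osc_congr fun z hz => polar_of_le (h1 z hz)]
    simp only [id]
    linarith [sq_nonneg (osc u (near (5 * l) w)),
      sq_nonneg (osc (fun z => min (u z) (patch (reflect p 0 j) 1 u z)) (near l w))]
  by_cases h2 : ∀ z ∈ near l w, axis p j ≤ z.im
  · rw [osc_congr fun z hz => polar_of_ge (carpet_subset_unitSq hz.1) (h2 z hz)]
    simp only [id]
    linarith [sq_nonneg (osc u (near (5 * l) w)),
      sq_nonneg (osc (fun z => max (u z) (patch (reflect p 0 j) 1 u z)) (near l w))]
  push Not at h1 h2
  obtain ⟨a, ha, ha'⟩ := h1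
  obtain ⟨b, hb, hb'⟩ := h2
  have hmem : ∀ z ∈ near l w, ∃ y ∈ near (5 * l) w, polar p j u z = u y := by
    intro z hz
    have hza := abs_le.1 (abs_sub_le_of_near hz ha).2
    have hzb := abs_le.1 (abs_sub_le_of_near hz hb).2
    have hlt := hn₀ _ hw
    have hm := reflect_mem_unitSq hj (carpet_subset_unitSq hz.1) (by linarith)
    rcases polar_eq_or (u := u) hm with h | h
    · exact ⟨z, near_mono (by omega) w hz, h⟩
    · refine ⟨_, ⟨hτ.mem z hz.1 hm, ?_, ?_⟩, h⟩
      · rw [reflect_zero_re]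
        refine hz.2.1.trans ?_
        push_cast; linarith [(Nat.cast_nonneg l : (0 : ℝ) ≤ l)]
      · have h3 := abs_le.1 hz.2.2
        have hpw := pow_base_pos (p := p) w.length
        have e1 : (p : ℝ) ^ w.length * (2 * l * (1 / p : ℝ) ^ w.length) = 2 * l := by
          rw [div_pow, one_pow]; field_simp
        have e2 : (p : ℝ) ^ w.length * (z.im - axis p j) ≤ 2 * l := by
          rw [← e1]; exact mul_le_mul_of_nonneg_left (by linarith) hpw.le
        have e3 : -(2 * l : ℝ) ≤ p ^ w.length * (z.im - axis p j) := by
          have := mul_le_mul_of_nonneg_left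
            (show axis p j - z.im ≤ 2 * l * (1 / p : ℝ) ^ w.length by linarith) hpw.le
          rw [e1] at this; linarith
        rw [reflect_im_axis, abs_le]
        push_cast
        constructor <;> nlinarith
  have h3 : osc (polar p j u) (near l w) ≤ osc u (near (5 * l) w) := by
    refine osc_le (osc_nonneg _ _) fun x hx y hy => ?_
    obtain ⟨a, ha, e1⟩ := hmem x hx
    obtain ⟨b, hb, e2⟩ := hmem y hy
    rw [e1, e2]
    exact le_osc hu.1 (near_subset _ _) ha hb
  have h4 := pow_le_pow_left₀ (osc_nonneg _ _) h3 2
  simp only [id]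
  linarith [sq_nonneg (osc (fun z => min (u z) (patch (reflect p 0 j) 1 u z)) (near l w)),
    sq_nonneg (osc (fun z => max (u z) (patch (reflect p 0 j) 1 u z)) (near l w))]

lemma polar_mem_Icc {j : ℕ} (hj : j < mid p) {u : ℂ → ℝ}
    (hu : ∀ z ∈ sierpinskiCarpet p, u z ∈ Icc (0 : ℝ) 1) {z : ℂ} (hz : z ∈ sierpinskiCarpet p) :
    polar p j u z ∈ Icc (0 : ℝ) 1 := by
  have h1 := hu z hz
  have h2 := patch_mem_Icc (isZoom_reflect 0 hj) hu hz
  unfold polar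
  split_ifs
  · exact ⟨h1.1.trans (le_max_left _ _), max_le h1.2 h2.2⟩
  · exact ⟨le_min h1.1 h2.1, (min_le_left _ _).trans h1.2⟩

lemma polar_outer {j : ℕ} (hj : j < mid p) {u : ℂ → ℝ}
    (hu : ∀ z ∈ sierpinskiCarpet p, u z ∈ Icc (0 : ℝ) 1)
    (hO : ∀ z ∈ outerSquare, u z = 1) {z : ℂ} (hz : z ∈ outerSquare) : polar p j u z = 1 := by
  have h2 := patch_mem_Icc (isZoom_reflect 0 hj) hu (outer_subset_carpet hz)
  rcases le_total z.im (axis p j) with h | h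
  · rw [polar_of_le h, hO z hz, max_eq_left h2.2]
  · have hz' := mem_outer_iff.1 hz
    rw [polar_of_ge hz'.1 h, hO z hz, patch_eq hO fun h3 => hz'.2 ?_, min_self]
    have h4 := h3.2
    rw [reflect_im_axis] at h4
    refine ⟨by simpa only [reflect_zero_re] using h3.1, ?_, ?_⟩
    · linarith [axis_pos (p := p) j]
    · linarith [h4.1, two_mul_axis_lt hj]

lemma polar_mem_cls {d e : Digit p} (hd : d.1.2 < mid p) (he : e.1.2 = 0) (hde : d.1.1 = e.1.1)
    (hd0 : d.1.2 ≠ 0) {u : ℂ → ℝ} (hu : u ∈ Cls p (circ (some [e])) (circ (p := p) none)) :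
    polar p d.1.2 u ∈ Cls p (circ (some [d])) (circ (p := p) none) := by
  have hO : ∀ z ∈ outerSquare, u z = 1 := hu.2.2.2
  refine ⟨adm_polar hd hu.1 hO, fun z hz => polar_mem_Icc hd hu.2.1 hz, fun z hz => ?_,
    fun z hz => polar_outer hd hu.2.1 hO hz⟩
  have hi := reflect_image_circ (s := 0) (j := d.1.2) (d := d) (d' := e)
    (by omega) (by omega) []
  have h : reflect p 0 d.1.2 z ∈ circ (some [e]) := hi ▸ mem_image_of_mem _ hz
  have hzS := circ_subset_carpet _ hz
  have h0 := base_pos (p := p)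
  have hax : axis p d.1.2 ≤ z.im := by
    obtain ⟨y, hy, hyz⟩ := circ_some_subset_solid _ hz
    have h1 := (scaled_cellMap (d := d) (solid_subset_openSq [] ⟨y, hy, rfl⟩)).2.1
    have h2 : (p : ℝ) * z.im > d.1.2 := by rw [← hyz]; exact h1
    have h3 : (1 : ℝ) ≤ d.1.2 := by exact_mod_cast Nat.one_le_iff_ne_zero.2 hd0
    rw [axis, div_le_iff₀ (by positivity)]
    linarith
  rw [polar_of_ge (carpet_subset_unitSq hzS) hax,
    patch_of_mem (carpet_subset_unitSq (circ_subset_carpet _ h)), hu.2.2.1 _ h]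
  exact min_eq_right (hu.2.1 z hzS).1

lemma solid_im_mem {w : Word p} {z : ℂ} (hz : z ∈ solid w) :
    z.im ∈ Icc (lowCorner w).im (highCorner w).im := by
  obtain ⟨y, hy, rfl⟩ := hz
  have h0 := base_pos (p := p)
  have hpw := pow_base_pos (p := p) w.length
  have h1 : (mid p : ℝ) / p ≤ y.im := by rw [div_le_iff₀ h0]; linarith [hy.2.1]
  have h2 : y.im ≤ (mid p + 1 : ℝ) / p := by rw [le_div_iff₀ h0]; linarith [hy.2.2]
  simp only [lowCorner, highCorner, wordMap_im]
  constructor <;> gcongr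

lemma exists_mem_circ_im {w : Word p} {x y : ℂ} (hx : x ∈ circ (some w)) (hy : y ∈ circ (some w))
    {t : ℝ} (hxt : x.im ≤ t) (hty : t ≤ y.im) : ∃ z ∈ circ (some w), z.im = t :=
  ⟨⟨(lowCorner w).re, t⟩, mk_mem_circ w (Or.inl rfl) rfl
    ⟨(solid_im_mem (circ_some_subset_solid _ hx)).1.trans hxt,
      hty.trans (solid_im_mem (circ_some_subset_solid _ hy)).2⟩, rfl⟩

lemma osc_polar_pair_of_le {j : ℕ} (hj : j < mid p) {u : ℂ → ℝ} (hu : Adm p u)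
    (hO : ∀ z ∈ outerSquare, u z = 1) {c c' : Option (Word p)}
    (h : reflect p 0 j '' circ c = circ c') (hle : ∀ z ∈ circ c, z.im ≤ axis p j) :
    osc (polar p j u) (circ c) ^ 2 + osc (polar p j u) (circ c') ^ 2 ≤
      osc u (circ c) ^ 2 + osc u (circ c') ^ 2 := by
  have hv := hu.patch (isZoom_reflect 0 hj) hO
  have hm := (osc_min_max hu.1 hv.1 (circ_subset_carpet c) (circ_nonempty c)).2
  rw [osc_patch h] at hm
  have e1 : osc (polar p j u) (circ c) =
      osc (fun z => max (u z) (patch (reflect p 0 j) 1 u z)) (circ c) :=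
    osc_congr fun z hz => polar_of_le (hle z hz)
  have e2 : osc (polar p j u) (circ c') =
      osc (fun z => min (u z) (patch (reflect p 0 j) 1 u z)) (circ c) := by
    rw [osc, osc, ← h, image_image]
    congr 1
    refine image_congr fun z hz => ?_
    have hz1 := carpet_subset_unitSq (circ_subset_carpet c hz)
    have hz2 : reflect p 0 j z ∈ unitSq :=
      carpet_subset_unitSq (circ_subset_carpet c' (h ▸ mem_image_of_mem _ hz))
    rw [polar_of_ge hz2 (by rw [reflect_im_axis]; linarith [hle z hz]), patch_of_mem hz2,
      patch_of_mem (by rwa [reflect_reflect_zero]), reflect_reflect_zero, min_comm]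
  rw [e1, e2]
  linarith

lemma reflect_image_symm {j : ℕ} {A B : Set ℂ} (h : reflect p 0 j '' A = B) :
    reflect p 0 j '' B = A := by
  rw [← h, image_image]
  simp only [reflect_reflect_zero, image_id']

lemma osc_polar_pair {j : ℕ} (hj : j < mid p) {u : ℂ → ℝ} (hu : Adm p u)
    (hO : ∀ z ∈ outerSquare, u z = 1) {w : Word p} {c : Option (Word p)}
    (h : reflect p 0 j '' circ (some w) = circ c) :
    osc (polar p j u) (circ (some w)) ^ 2 + osc (polar p j u) (circ c) ^ 2 ≤
      osc u (circ (some w)) ^ 2 + osc u (circ c) ^ 2 := by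
  by_cases h1 : ∀ z ∈ circ (some w), z.im ≤ axis p j
  · exact osc_polar_pair_of_le hj hu hO h h1
  by_cases h2 : ∀ z ∈ circ c, z.im ≤ axis p j
  · have := osc_polar_pair_of_le hj hu hO (reflect_image_symm h) h2
    linarith
  push Not at h1 h2
  obtain ⟨a, ha, ha'⟩ := h1
  obtain ⟨b, hb, hb'⟩ := h2
  have hb2 : reflect p 0 j b ∈ circ (some w) := reflect_image_symm h ▸ mem_image_of_mem _ hb
  obtain ⟨z, hz, hzt⟩ := exists_mem_circ_im hb2 ha
    (show _ ≤ axis p j by rw [reflect_im_axis]; linarith) ha'.le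
  have hc : some w = c := by
    by_contra hne
    refine circ_disjoint hne hz ?_
    rw [← h, ← reflect_of_im_eq hzt]
    exact mem_image_of_mem _ hz
  subst hc
  have hmem : ∀ z ∈ circ (some w), ∃ y ∈ circ (some w), polar p j u z = u y := by
    intro z hz
    have hz2 : reflect p 0 j z ∈ circ (some w) := h.subset (mem_image_of_mem _ hz)
    rcases polar_eq_or (u := u) (carpet_subset_unitSq (circ_subset_carpet _ hz2)) with h | h
    · exact ⟨z, hz, h⟩
    · exact ⟨_, hz2, h⟩
  have h3 : osc (polar p j u) (circ (some w)) ≤ osc u (circ (some w)) := by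
    refine osc_le (osc_nonneg _ _) fun x hx y hy => ?_
    obtain ⟨a, ha, e1⟩ := hmem x hx
    obtain ⟨b, hb, e2⟩ := hmem y hy
    rw [e1, e2]
    exact le_osc hu.1 (circ_subset_carpet _) ha hb
  have h4 := pow_le_pow_left₀ (osc_nonneg _ _) h3 2
  linarith

lemma osc_polar_single {j : ℕ} (hj : j < mid p) {u : ℂ → ℝ}
    (hr : ∀ z ∈ sierpinskiCarpet p, u z ∈ Icc (0 : ℝ) 1)
    (hO : ∀ z ∈ outerSquare, u z = 1) {c : Option (Word p)}
    (h : ¬ ∃ c' : Option (Word p), reflect p 0 j '' circ c = circ c') :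
    osc (polar p j u) (circ c) ≤ osc u (circ c) := by
  cases c with
  | none => exact (osc_eq_zero fun z hz => polar_outer hj hr hO hz).trans_le (osc_nonneg _ _)
  | some w =>
    have h1 : ∀ z ∈ circ (some w), reflect p 0 j z ∉ openSq :=
      (reflect_circ 0 hj (by simp)).resolve_right fun ⟨d, v, h2⟩ => h ⟨_, h2⟩
    refine (osc_congr fun z hz => ?_).le
    have hz1 : z ∈ openSq := solid_subset_openSq _ (circ_some_subset_solid _ hz)
    have hz2 := circ_subset_carpet _ hz
    have hax : axis p j ≤ z.im := by
      by_contra hlt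
      push Not at hlt
      refine h1 z hz ⟨by rw [reflect_zero_re]; exact hz1.1, ?_, ?_⟩
      · rw [reflect_im_axis]; linarith [axis_pos (p := p) j]
      · rw [reflect_im_axis]; linarith [hz1.2.1, two_mul_axis_lt hj]
    rw [polar_of_ge (openSq_subset hz1) hax, patch_eq hO (h1 z hz)]
    exact min_eq_left (hr z hz2).2

open Classical in
/-- The reflection acting on the peripheral squares it maps to peripheral squares. -/
def circReflect (p j : ℕ) (c : Option (Word p)) : Option (Word p) :=
  if h : ∃ c' : Option (Word p), reflect p 0 j '' circ c = circ c' then h.choose else c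

lemma circReflect_eq {j : ℕ} {c c' : Option (Word p)} (h : reflect p 0 j '' circ c = circ c') :
    circReflect p j c = c' := by
  have hex : ∃ c' : Option (Word p), reflect p 0 j '' circ c = circ c' := ⟨c', h⟩
  rw [circReflect, dif_pos hex]
  exact circ_injective (hex.choose_spec.symm.trans h)

lemma circReflect_involutive (j : ℕ) : Function.Involutive (circReflect p j) := by
  intro c
  by_cases hex : ∃ c' : Option (Word p), reflect p 0 j '' circ c = circ c'
  · obtain ⟨c', h⟩ := hex
    rw [circReflect_eq h, circReflect_eq (reflect_image_symm h)]
  · have e : circReflect p j c = c := dif_neg hex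
    rw [e, e]

lemma energy_polar_le {j : ℕ} (hj : j < mid p) {u : ℂ → ℝ} (hu : Adm p u)
    (hr : ∀ z ∈ sierpinskiCarpet p, u z ∈ Icc (0 : ℝ) 1) (hO : ∀ z ∈ outerSquare, u z = 1) :
    energy (p := p) univ (polar p j u) ≤ energy (p := p) univ u := by
  have hv := adm_polar hj hu hO
  simp only [energy, indicator_univ]
  have hs1 := hv.summable_circ
  have hs2 := hu.summable_circ
  set σ : Equiv.Perm (Option (Word p)) := (circReflect_involutive j).toPerm with hσ
  have hs1' := (σ.summable_iff).2 hs1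
  have hs2' := (σ.summable_iff).2 hs2
  have h1 := (hs1.add hs1').tsum_le_tsum (fun c => ?_) (hs2.add hs2')
  · rw [hs1.tsum_add hs1', hs2.tsum_add hs2'] at h1
    have e1 := σ.tsum_eq fun c : Option (Word p) => osc (polar p j u) (circ c) ^ 2
    have e2 := σ.tsum_eq fun c : Option (Word p) => osc u (circ c) ^ 2
    simp only [Function.comp_apply] at h1
    linarith
  · simp only [Function.comp_apply]
    change osc (polar p j u) (circ c) ^ 2 + osc (polar p j u) (circ (circReflect p j c)) ^ 2 ≤
      osc u (circ c) ^ 2 + osc u (circ (circReflect p j c)) ^ 2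
    by_cases hex : ∃ c' : Option (Word p), reflect p 0 j '' circ c = circ c'
    · obtain ⟨c', h⟩ := hex
      rw [circReflect_eq h]
      cases c with
      | some w => exact osc_polar_pair hj hu hO h
      | none =>
        cases c' with
        | some w => have := osc_polar_pair hj hu hO (reflect_image_symm h); linarith
        | none =>
          have h0 : osc (polar p j u) (circ (p := p) none) = 0 :=
            osc_eq_zero fun z hz => polar_outer hj hr hO hz
          rw [h0]
          linarith [sq_nonneg (osc u (circ (p := p) none))]
    · have e : circReflect p j c = c := dif_neg hex
      rw [e]
      have := pow_le_pow_left₀ (osc_nonneg _ _) (osc_polar_single hj hr hO hex) 2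
      linarith

/-- Among the squares of first generation in the lower half of a column, the one in the bottom row
has the largest capacity to the outer square. -/
lemma cap_outer_le {d e : Digit p} (hd : d.1.2 < mid p) (he : e.1.2 = 0) (hde : d.1.1 = e.1.1) :
    cap (p := p) univ (circ (some [d])) (circ (p := p) none) ≤
      cap (p := p) univ (circ (some [e])) (circ (p := p) none) := by
  by_cases hd0 : d.1.2 = 0
  · have : d = e := Subtype.ext (Prod.ext hde (hd0.trans he.symm))
    rw [this]
  · refine le_csInf ((cls_nonempty (by simp)).image _) ?_
    rintro _ ⟨u, hu, rfl⟩
    exact (cap_le (polar_mem_cls hd he hde hd0 hu)).trans (energy_polar_le hd hu.1 hu.2.1 hu.2.2.2)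

end

noncomputable section

variable {p : ℕ} [hp : OddBase p]

lemma cap_lt_middle_outer {w : Word p} (hw : w ≠ []) {c : Option (Word p)} (hc : Outside w c) :
    cap (p := p) univ (circ (some w)) (circ c) <
      cap (p := p) univ (circ (p := p) (some [])) (circ (p := p) none) := by
  simpa using cap_append_lt hw [] hc

/-- The middle and the outer square are the only pair of maximal capacity. -/
lemma eq_of_le_cap {a b : Option (Word p)} (hab : a ≠ b)
    (h : cap (p := p) univ (circ (p := p) (some [])) (circ (p := p) none) ≤
      cap (p := p) univ (circ a) (circ b)) :
    (a = some [] ∧ b = none) ∨ (a = none ∧ b = some []) := by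
  have h' := h
  rw [cap_symm univ (circ a)] at h'
  have key : ∀ v w : Word p, v ≠ w → v.length ≤ w.length → w ≠ [] ∧ Outside w (some v) := by
    refine fun v w hvw hlen => ⟨fun hw => ?_, fun v' hv' hpre => ?_⟩
    · subst hw
      exact hvw (List.length_eq_zero_iff.1 (by simpa using hlen))
    · cases hv'
      exact hvw (hpre.eq_of_length_le hlen).symm
  cases a with
  | none =>
    cases b with
    | none => exact absurd rfl hab
    | some w =>
      by_cases hw : w = []
      · exact Or.inr ⟨rfl, by rw [hw]⟩
      · exact absurd h' (not_le.2 (cap_lt_middle_outer hw (by simp [Outside])))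
  | some v =>
    cases b with
    | none =>
      by_cases hv : v = []
      · exact Or.inl ⟨by rw [hv], rfl⟩
      · exact absurd h (not_le.2 (cap_lt_middle_outer hv (by simp [Outside])))
    | some w =>
      have hvw : v ≠ w := fun h => hab (by rw [h])
      rcases le_total v.length w.length with hl | hl
      · obtain ⟨h1, h2⟩ := key v w hvw hl
        exact absurd h' (not_le.2 (cap_lt_middle_outer h1 h2))
      · obtain ⟨h1, h2⟩ := key w v hvw.symm hl
        exact absurd h (not_le.2 (cap_lt_middle_outer h1 h2))

lemma exists_lower_digit {H : Digit p → ℝ} (h1 : ∀ d, H d ≤ H (flipDigit d))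
    (h2 : ∀ d, H d ≤ H (transposeDigit d)) (d : Digit p) :
    ∃ d' : Digit p, d'.1.2 < mid p ∧ H d ≤ H d' := by
  have key : ∀ d : Digit p, d.1.2 ≠ mid p → ∃ d' : Digit p, d'.1.2 < mid p ∧ H d ≤ H d' := by
    intro d hd
    rcases hd.lt_or_gt with h | h
    · exact ⟨d, h, le_rfl⟩
    · refine ⟨flipDigit d, ?_, h1 d⟩
      change p - 1 - d.1.2 < mid p
      have := two_mid_add_one (p := p)
      have := d.2.2.1
      omega
  by_cases hd : d.1.2 = mid p
  · obtain ⟨d', h3, h4⟩ := key (transposeDigit d) fun h => d.2.2.2 ⟨h, hd⟩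
    exact ⟨d', h3, (h2 d).trans h4⟩
  · exact key d hd

lemma cap_digit_le {A : ℂ → ℂ} {δ : Digit p → Digit p} (h : IsSym A δ)
    {I : Set (Option (Word p))} (hI : ∀ c ∈ I, c.map (List.map δ) ∈ I) {c : Option (Word p)}
    (hc : c = none ∨ c = some []) (d : Digit p) :
    cap I (circ (some [d])) (circ c) ≤ cap I (circ (some [δ d])) (circ c) := by
  rcases hc with rfl | rfl
  · exact h.cap_le (c := some [d]) (d := none) (by simp) hI
  · exact h.cap_le (c := some [d]) (d := some []) (by simp) hI

lemma map_mem_properCircs (δ : Digit p → Digit p) :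
    ∀ c ∈ properCircs p, c.map (List.map δ) ∈ properCircs p := by
  rintro (_ | w) ⟨h1, h2⟩
  · exact absurd rfl h1
  · refine ⟨by simp, fun h => h2 ?_⟩
    simpa using h

/-- The maximal capacity of first generation squares to the outer square is attained in the
bottom row. -/
lemma exists_maximal_digit : ∃ e : Digit p, e.1.2 = 0 ∧ ∀ d : Digit p,
    cap (p := p) univ (circ (some [d])) (circ (p := p) none) ≤
      cap (p := p) univ (circ (some [e])) (circ (p := p) none) := by
  have hm := one_le_mid (p := p)
  have hm2 := two_mid_add_one (p := p)
  have hne : Nonempty (Digit p) := ⟨⟨(0, 0), by omega, by omega, fun h => by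
    have := h.1
    simp only at this
    omega⟩⟩
  obtain ⟨d, hd⟩ := Finite.exists_max fun d : Digit p =>
    cap (p := p) univ (circ (some [d])) (circ (p := p) none)
  obtain ⟨d', h1, h2⟩ := exists_lower_digit
    (cap_digit_le isSym_flip (fun _ _ => mem_univ _) (Or.inl rfl))
    (cap_digit_le isSym_transpose (fun _ _ => mem_univ _) (Or.inl rfl)) d
  refine ⟨⟨(d'.1.1, 0), d'.2.1, by omega, fun h => ?_⟩, rfl, fun a => ?_⟩
  · have := h.2
    simp only at this
    omega
  · exact (hd a).trans (h2.trans (cap_outer_le h1 rfl rfl))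

lemma not_swap {f : ↥(sierpinskiCarpet p) ≃ₜ ↥(sierpinskiCarpet p)} (hf : IsQSMap f)
    (h1 : circPerm f (some []) = none) (h2 : circPerm f none = some []) : False := by
  obtain ⟨e, he, hmax⟩ := exists_maximal_digit (p := p)
  have hinj := circPerm_injective f
  have hcap := cap_le_cap_image hf (c := some [e]) (d := none) (by simp) (I := univ) (I' := univ)
    fun _ _ => mem_univ _
  have hproper := cap_le_cap_image hf (c := some [e]) (d := none) (by simp) (I := properCircs p)
    (I' := properCircs p) fun c hc =>
      ⟨fun h => hc.2 (hinj (h.trans h1.symm)), fun h => hc.1 (hinj (h.trans h2.symm))⟩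
  rw [h2] at hcap hproper
  have hn1 : circPerm f (some [e]) ≠ none := fun h => by
    simpa using hinj (h.trans h1.symm)
  have hn2 : circPerm f (some [e]) ≠ some [] := fun h => by
    simpa using hinj (h.trans h2.symm)
  obtain ⟨w, hw⟩ := Option.ne_none_iff_exists'.1 hn1
  rw [hw] at hcap hproper hn2
  have hw0 : w ≠ [] := fun h => hn2 (by rw [h])
  by_cases hw1 : w.dropLast = []
  · have hlast := List.dropLast_append_getLast hw0
    rw [hw1, List.nil_append] at hlast
    rw [← hlast] at hproper
    obtain ⟨d', h3, h4⟩ := exists_lower_digit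
      (cap_digit_le isSym_flip (map_mem_properCircs _) (Or.inr rfl))
      (cap_digit_le isSym_transpose (map_mem_properCircs _) (Or.inr rfl)) (w.getLast hw0)
    linarith [cap_middle_lt h3 he]
  · have h3 := cap_append_lt hw1 [w.getLast hw0] (c := some []) fun v hv hpre => by
      cases hv
      exact hw1 (List.prefix_nil.1 hpre)
    rw [List.dropLast_append_getLast hw0] at h3
    linarith [hmax (w.getLast hw0)]

lemma circPerm_outer_middle {f : ↥(sierpinskiCarpet p) ≃ₜ ↥(sierpinskiCarpet p)} (hf : IsQSMap f) :
    circPerm f (some []) = some [] ∧ circPerm f none = none := by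
  have h := cap_le_cap_image hf (c := some []) (d := none) (by simp) (I := univ) (I' := univ)
    fun _ _ => mem_univ _
  rcases eq_of_le_cap (fun h => by simpa using circPerm_injective f h) h with h | h
  · exact h
  · exact (not_swap hf h.1 h.2).elim

lemma circ_nil : circ (p := p) (some []) = middleSquare p := by
  simp [circ, wordMap]

end

end Carpet

/-- **Quasisymmetries preserve the outer and the middle square individually** (Lemma 8.1).
Every quasisymmetric self-homeomorphism `f` of `S_p` (`p ≥ 3` odd) satisfies `f(O) = O`
and `f(M) = M` (images taken as subsets of the plane); in particular `f` cannot
interchange the outer square `O` and the middle square `M`. -/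
theorem qs_fixes_outer_and_middle (p : ℕ) (hp : 3 ≤ p) (hodd : Odd p)
    (f : ↥(sierpinskiCarpet p) ≃ₜ ↥(sierpinskiCarpet p)) (hf : IsQSMap f) :
    (fun x : ↥(sierpinskiCarpet p) => (f x : ℂ)) '' (Subtype.val ⁻¹' outerSquare)
        = outerSquare ∧
    (fun x : ↥(sierpinskiCarpet p) => (f x : ℂ)) '' (Subtype.val ⁻¹' middleSquare p)
        = middleSquare p := by
  have : OddBase p := ⟨hp, hodd⟩
  obtain ⟨h1, h2⟩ := Carpet.circPerm_outer_middle hf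
  have h3 := Carpet.push_circ f none
  have h4 := Carpet.push_circ f (some [])
  rw [h2] at h3
  rw [h1, Carpet.circ_nil] at h4
  exact ⟨h3, h4⟩
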